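/- arXiv:2004.09491 — 4 statements merged into one kernel-verified Lean document; each statement's English description precedes it below -/
import Mathlib

section
/- Fix an integer constant r ≥ 2 and constants χ > 0 and δ ∈ (0,1]. There exist constants c > 0, C > 0 and n₀ ∈ ℕ such that for all n ≥ n₀ the following holds: the non-elitist EA maximizing Plateau_r on {0,1}^n, using bitwise mutation with mutation probability χ/n, using either k-tournament selection with k ≥ (1+δ)e^χ or (μ,λ)-selection with λ/μ ≥ (1+δ)e^χ, and population size λ ≥ c·ln n, has expected runtime E[T] ≤ C·(n^r + n·λ). -/
open scoped ENNReal

/-- Bit strings of length `n`: the search space `{0,1}^n`. -/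
abbrev BitStr (n : ℕ) := Fin n → Bool

/-- Populations of `l` individuals from `{0,1}^n`. -/
abbrev Popn (n l : ℕ) := Fin l → BitStr n

/-- The number of one-bits `|x|` of a bit string. -/
def ones {n : ℕ} (x : BitStr n) : ℕ := (Finset.univ.filter fun i => x i = true).card

/-- The fitness function `Plateau_r`. -/
noncomputable def plateauF (n r : ℕ) (x : BitStr n) : ℝ :=
  if ones x ≤ n - r then (ones x : ℝ)
  else if ones x = n then (n : ℝ)
  else ((n - r : ℕ) : ℝ)

/-- The all-ones string, the unique global optimum of `Plateau_r`. -/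
def allOnesStr (n : ℕ) : BitStr n := fun _ => true

/-- Product of finitely many PMFs: the coordinates are independent. -/
noncomputable def prodPMF {ι α : Type*} [Fintype ι] [DecidableEq ι] [Fintype α]
    (p : ι → PMF α) : PMF (ι → α) :=
  PMF.ofFintype (fun g => ∏ i, p i (g i))
    (by
      have h1 : ∀ i : ι, ∑ a : α, p i a = 1 := fun i => by
        simpa [tsum_fintype] using (p i).tsum_coe
      calc ∑ g : ι → α, ∏ i, p i (g i)
          = ∏ i : ι, ∑ a : α, p i a := by
            rw [Finset.prod_univ_sum, Fintype.piFinset_univ]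
        _ = 1 := by simp [h1])

/-- One generation of the non-elitist EA: each of the `l` individuals of the
next population is sampled independently by first drawing a parent index via
the selection mechanism `sel` and then mutating the parent via `mutOp`. -/
noncomputable def eaStep {n l : ℕ} (sel : Popn n l → PMF (Fin l))
    (mutOp : BitStr n → PMF (BitStr n)) (P : Popn n l) : PMF (Popn n l) :=
  prodPMF fun _ : Fin l => (sel P).bind fun i => mutOp (P i)

/-- `t`-fold iteration of the EA transition kernel. -/
noncomputable def iterStep {n l : ℕ} (step : Popn n l → PMF (Popn n l)) :
    ℕ → Popn n l → PMF (Popn n l)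
  | 0 => fun P => PMF.pure P
  | (t + 1) => fun P => (step P).bind (iterStep step t)

/-- `notYet init step G t P` is the probability that the Markov chain with initial
distribution `init` and transition kernel `step` avoids the set `G` at all
times `0,…,t` and is at `P` at time `t`. -/
noncomputable def notYet {n l : ℕ} (init : PMF (Popn n l))
    (step : Popn n l → PMF (Popn n l)) (G : Set (Popn n l)) :
    ℕ → Popn n l → ℝ≥0∞
  | 0 => Gᶜ.indicator fun P => init P
  | (t + 1) => Gᶜ.indicator fun P => ∑ Q : Popn n l, notYet init step G t Q * step Q P

/-- The probability that the chain avoids `G` at all times `0,…,t`,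
i.e. `Pr(T > t)` where `T` is the first hitting time of `G`. -/
noncomputable def survProb {n l : ℕ} (init : PMF (Popn n l))
    (step : Popn n l → PMF (Popn n l)) (G : Set (Popn n l)) (t : ℕ) : ℝ≥0∞ :=
  ∑ P : Popn n l, notYet init step G t P

/-- The probability that the chain visits `G` at some time in `{0,…,t}`,
i.e. `Pr(T ≤ t)` where `T` is the first hitting time of `G`. -/
noncomputable def hitProb {n l : ℕ} (init : PMF (Popn n l))
    (step : Popn n l → PMF (Popn n l)) (G : Set (Popn n l)) (t : ℕ) : ℝ≥0∞ :=
  1 - survProb init step G t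

/-- The expected first hitting time of `G`:
`E[T] = ∑_{t≥0} Pr(T > t)` where `T = min { t | P_t ∈ G }`. -/
noncomputable def expHitTime {n l : ℕ} (init : PMF (Popn n l))
    (step : Popn n l → PMF (Popn n l)) (G : Set (Popn n l)) : ℝ≥0∞ :=
  ∑' t : ℕ, survProb init step G t

/-- Populations containing the global optimum (the all-ones string). -/
def optSet (n l : ℕ) : Set (Popn n l) := {P | ∃ i, P i = allOnesStr n}

/-- `mutOp` is the bitwise mutation operator with mutation probability `p`:
each of the `n` bits is flipped independently with probability `p`. -/
def IsBitwiseMut {n : ℕ} (p : ℝ) (mutOp : BitStr n → PMF (BitStr n)) : Prop :=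
  ∀ x y : BitStr n,
    mutOp x y = ENNReal.ofReal (p ^ hammingDist x y * (1 - p) ^ (n - hammingDist x y))

/-- `mutOp` is an unbiased mutation operator: `p_mut(y|x)` depends only on the
Hamming distance `H(x,y)`. -/
def IsUnbiasedMut {n : ℕ} (mutOp : BitStr n → PMF (BitStr n)) : Prop :=
  ∀ x y x' y' : BitStr n, hammingDist x y = hammingDist x' y' → mutOp x y = mutOp x' y'

/-- `Pr(ξ = d)`: the probability that exactly `d` bits are flipped when
mutating `x`. -/
noncomputable def flipProb {n : ℕ} (mutOp : BitStr n → PMF (BitStr n))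
    (x : BitStr n) (d : ℕ) : ℝ≥0∞ :=
  ∑ y ∈ Finset.univ.filter (fun y : BitStr n => hammingDist x y = d), mutOp x y

/-- `sel` is `k`-tournament selection for fitness `f`: `k` indices are drawn
uniformly at random with replacement, and an index of maximal fitness among
those drawn is returned (ties broken arbitrarily, encoded by `pick`). -/
def IsTournamentSel {n l : ℕ} (f : BitStr n → ℝ) (k : ℕ)
    (sel : Popn n l → PMF (Fin l)) : Prop :=
  ∀ P : Popn n l, ∃ pick : (Fin k → Fin l) → Fin l → ℝ≥0∞,
    (∀ d, ∑ i, pick d i = 1) ∧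
    (∀ d i, pick d i ≠ 0 → (∃ j, d j = i) ∧ ∀ j, f (P (d j)) ≤ f (P i)) ∧
    (∀ i, sel P i = (∑ d : Fin k → Fin l, pick d i) / (l : ℝ≥0∞) ^ k)

/-- `sel` is `(μ,λ)`-selection for fitness `f`: a uniformly random index among
the `μ` fittest individuals of the population is returned (ties broken
arbitrarily, encoded by the choice of `S`). -/
def IsMuCommaSel {n l : ℕ} (f : BitStr n → ℝ) (μ : ℕ)
    (sel : Popn n l → PMF (Fin l)) : Prop :=
  ∀ P : Popn n l, ∃ S : Finset (Fin l), S.card = μ ∧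
    (∀ i ∈ S, ∀ j, j ∉ S → f (P j) ≤ f (P i)) ∧
    (∀ i, sel P i = if i ∈ S then ((μ : ℝ≥0∞))⁻¹ else 0)

/-- `sel` is fitness-proportionate selection for fitness `f`. -/
def IsPropSel {n l : ℕ} (f : BitStr n → ℝ) (sel : Popn n l → PMF (Fin l)) : Prop :=
  ∀ P : Popn n l, ∀ i : Fin l,
    ((∑ j, f (P j)) = 0 → sel P i = ((l : ℝ≥0∞))⁻¹) ∧
    ((∑ j, f (P j)) ≠ 0 → sel P i = ENNReal.ofReal (f (P i) / ∑ j, f (P j)))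

/-- `sel` is an `f`-monotone selection mechanism. -/
def IsMonotoneSel {n l : ℕ} (f : BitStr n → ℝ) (sel : Popn n l → PMF (Fin l)) : Prop :=
  ∀ P : Popn n l, ∀ i j : Fin l, (sel P j ≤ sel P i ↔ f (P j) ≤ f (P i))

lemma aux_drift {n l : ℕ} (init : PMF (Popn n l)) (step : Popn n l → PMF (Popn n l))
    (G : Set (Popn n l)) (V : Popn n l → ℝ) (M : ℝ) (hV0 : ∀ P, 0 ≤ V P) (hM : ∀ P, V P ≤ M)
    (hd : ∀ P, P ∉ G → ∑ Q, (step P Q).toReal * V Q + 1 ≤ V P) :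
    expHitTime init step G ≤ ENNReal.ofReal M := by
  have hd' : ∀ P, P ∉ G → ∑ Q, step P Q * ENNReal.ofReal (V Q) + 1 ≤ ENNReal.ofReal (V P) := by
    intro P hP
    have h := ENNReal.ofReal_le_ofReal (hd P hP)
    rw [ENNReal.ofReal_add (Finset.sum_nonneg fun Q _ =>
        mul_nonneg ENNReal.toReal_nonneg (hV0 Q)) zero_le_one, ENNReal.ofReal_one,
      ENNReal.ofReal_sum_of_nonneg (fun Q _ => mul_nonneg ENNReal.toReal_nonneg (hV0 Q))] at h
    refine le_trans (le_of_eq ?_) h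
    congr 1
    refine Finset.sum_congr rfl fun Q _ => ?_
    rw [ENNReal.ofReal_mul ENNReal.toReal_nonneg, ENNReal.ofReal_toReal (PMF.apply_ne_top _ _)]
  have hz : ∀ t, ∀ P ∈ G, notYet init step G t P = 0 := by
    intro t P hP
    cases t <;> simp [notYet, hP]
  have hstep : ∀ t, (∑ P, notYet init step G (t+1) P * ENNReal.ofReal (V P)) + survProb init step G t
      ≤ ∑ P, notYet init step G t P * ENNReal.ofReal (V P) := by
    intro t
    have h1 : (∑ P, notYet init step G (t+1) P * ENNReal.ofReal (V P)) ≤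
        ∑ Q, notYet init step G t Q * ∑ P, step Q P * ENNReal.ofReal (V P) := by
      calc (∑ P, notYet init step G (t+1) P * ENNReal.ofReal (V P))
          ≤ ∑ P, (∑ Q, notYet init step G t Q * step Q P) * ENNReal.ofReal (V P) := by
            refine Finset.sum_le_sum fun P _ => ?_
            gcongr
            rw [notYet]
            exact Set.indicator_le_self _ _ _
        _ = _ := by
            simp_rw [Finset.sum_mul, Finset.mul_sum]
            rw [Finset.sum_comm]
            refine Finset.sum_congr rfl fun Q _ => Finset.sum_congr rfl fun P _ => ?_
            ring
    refine le_trans (add_le_add_left h1 _) ?_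
    rw [survProb, ← Finset.sum_add_distrib]
    refine Finset.sum_le_sum fun Q _ => ?_
    by_cases hQ : Q ∈ G
    · simp [hz t Q hQ]
    · calc _ = notYet init step G t Q * (∑ P, step Q P * ENNReal.ofReal (V P) + 1) := by ring
        _ ≤ _ := by gcongr; exact hd' Q hQ
  have hsum : ∀ N, ∑ t ∈ Finset.range N, survProb init step G t
      + (∑ P, notYet init step G N P * ENNReal.ofReal (V P))
      ≤ ∑ P, notYet init step G 0 P * ENNReal.ofReal (V P) := by
    intro N
    induction N with
    | zero => simp
    | succ N ih =>
      rw [Finset.sum_range_succ]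
      refine le_trans ?_ ih
      rw [add_assoc]
      gcongr
      rw [add_comm]
      exact hstep N
  rw [expHitTime]
  refine ENNReal.tsum_le_of_sum_range_le fun N => ?_
  refine le_trans le_self_add (le_trans (hsum N) ?_)
  calc ∑ P, notYet init step G 0 P * ENNReal.ofReal (V P)
      ≤ ∑ P, init P * ENNReal.ofReal M := by
        refine Finset.sum_le_sum fun P _ => ?_
        gcongr
        · rw [notYet]; exact Set.indicator_le_self _ _ _
        · exact hM P
    _ = ENNReal.ofReal M := by
        rw [← Finset.sum_mul]
        have : ∑ P, init P = 1 := by simpa [tsum_fintype] using init.tsum_coe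
        rw [this, one_mul]

lemma aux_pmf_real_sum {α : Type*} [Fintype α] (D : PMF α) : ∑ a, (D a).toReal = 1 := by
  have : ∑ a, D a = 1 := by simpa [tsum_fintype] using D.tsum_coe
  rw [← ENNReal.toReal_sum (fun a _ => PMF.apply_ne_top _ _), this]; simp

lemma aux_expo {α : Type*} [Fintype α] (l : ℕ) (D : PMF α) (S : α → Prop)
    [DecidablePred S] (θ : ℝ) :
    ∑ g : Fin l → α, (prodPMF (fun _ : Fin l => D) g).toReal *
        Real.exp (-(θ * ((Finset.univ.filter fun i => S (g i)).card : ℝ)))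
      ≤ Real.exp (-((l : ℝ) * (∑ a ∈ Finset.univ.filter S, (D a).toReal) * (1 - Real.exp (-θ)))) := by
  have h1 : ∀ g : Fin l → α, (prodPMF (fun _ : Fin l => D) g).toReal *
        Real.exp (-(θ * ((Finset.univ.filter fun i => S (g i)).card : ℝ)))
      = ∏ i, ((D (g i)).toReal * (if S (g i) then Real.exp (-θ) else 1)) := by
    intro g
    rw [Finset.prod_mul_distrib, prodPMF, PMF.ofFintype_apply, ENNReal.toReal_prod]
    congr 1
    rw [Finset.prod_ite, Finset.prod_const, Finset.prod_const_one, mul_one, ← Real.exp_nat_mul]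
    congr 1; ring
  simp_rw [h1]
  have h2 := Finset.prod_univ_sum (fun _ : Fin l => (Finset.univ : Finset α))
    (fun _ a => (D a).toReal * (if S a then Real.exp (-θ) else 1))
  rw [Fintype.piFinset_univ] at h2
  rw [← h2, Finset.prod_const, Finset.card_univ, Fintype.card_fin]
  set p := ∑ a ∈ Finset.univ.filter S, (D a).toReal with hp
  have h3 : ∑ a, (D a).toReal * (if S a then Real.exp (-θ) else 1) = 1 - p * (1 - Real.exp (-θ)) := by
    have : ∑ a, (D a).toReal * (if S a then Real.exp (-θ) else 1)
        = ∑ a, ((D a).toReal - (if S a then (D a).toReal else 0) * (1 - Real.exp (-θ))) := by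
      refine Finset.sum_congr rfl fun a _ => ?_
      split_ifs <;> ring
    rw [this, Finset.sum_sub_distrib, aux_pmf_real_sum, ← Finset.sum_mul, ← Finset.sum_filter]
  rw [h3]
  have h4 : 0 ≤ 1 - p * (1 - Real.exp (-θ)) := by
    rw [← h3]
    refine Finset.sum_nonneg fun a _ => mul_nonneg ENNReal.toReal_nonneg ?_
    split_ifs <;> positivity
  calc (1 - p * (1 - Real.exp (-θ))) ^ l ≤ (Real.exp (-(p * (1 - Real.exp (-θ))))) ^ l := by
        gcongr
        have := Real.add_one_le_exp (-(p * (1 - Real.exp (-θ))))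
        linarith
    _ = _ := by rw [← Real.exp_nat_mul]; congr 1; ring

/-- `1 - exp(-θ) ≥ θ / (1+θ)`. -/
lemma aux_exp_low (u : ℝ) (hu : 0 ≤ u) : u / (1 + u) ≤ 1 - Real.exp (-u) := by
  have h1 : Real.exp (-u) ≤ 1 / (1 + u) := by
    rw [Real.exp_neg, ← one_div]
    apply one_div_le_one_div_of_le (by linarith)
    linarith [Real.add_one_le_exp u]
  have : u / (1 + u) = 1 - 1 / (1 + u) := by field_simp; ring
  linarith

/-- scaled exponential moment bound -/
lemma aux_expo2 {α : Type*} [Fintype α] (l : ℕ) (D : PMF α) (S : α → Prop)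
    [DecidablePred S] (θ ε m : ℝ) (hε0 : 0 < ε) (hε1 : ε ≤ 1) (hθ0 : 0 ≤ θ) (hθ : θ ≤ ε / 4)
    (hm0 : 0 ≤ m)
    (hm : (1 + ε) * m ≤ (l : ℝ) * (∑ a ∈ Finset.univ.filter S, (D a).toReal)) :
    ∑ g : Fin l → α, (prodPMF (fun _ : Fin l => D) g).toReal *
        Real.exp (-(θ * ((Finset.univ.filter fun i => S (g i)).card : ℝ)))
      ≤ Real.exp (-((1 + ε / 2) * (θ * m))) := by
  refine le_trans (aux_expo l D S θ) ?_
  apply Real.exp_le_exp.mpr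
  apply neg_le_neg
  have h1 := aux_exp_low θ hθ0
  have h2 : (1 + ε / 2) * θ ≤ (1 + ε) * (θ / (1 + θ)) := by
    rw [← mul_div_assoc, le_div_iff₀ (by linarith)]
    nlinarith [mul_nonneg hθ0 hε0.le, mul_nonneg hε0.le (sub_nonneg.2 hε1), mul_nonneg hθ0 (sub_nonneg.2 hθ), mul_nonneg (mul_nonneg hθ0 hε0.le) (sub_nonneg.2 hε1),mul_nonneg (mul_nonneg hθ0 hε0.le) (sub_nonneg.2 hθ)]
  calc (1 + ε / 2) * (θ * m) = ((1 + ε / 2) * θ) * m := by ring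
    _ ≤ ((1 + ε) * (θ / (1 + θ))) * m := by gcongr
    _ = ((1 + ε) * m) * (θ / (1 + θ)) := by ring
    _ ≤ _ := by
      apply mul_le_mul hm h1 (by positivity)
      exact le_trans (by positivity) hm

lemma aux_scale (σ s x m lam : ℝ) (I : ℕ) (hσ : σ = max 1 s) (hxm : x ≤ m) (hsm : s / 2 ≤ m)
    (hxl : x ≤ lam) (hI1 : 1 ≤ I) (hI : lam ≤ σ * 2 ^ I) (hx : 1 ≤ x ∨ 1 ≤ s) :
    ∃ i, i < I ∧ x ≤ 2 * (σ * 2 ^ i) ∧ σ * 2 ^ i / 2 ≤ m := by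
  classical
  have hex : ∃ i : ℕ, x ≤ 2 * (σ * 2 ^ i) := by
    refine ⟨I - 1, ?_⟩
    obtain ⟨J, rfl⟩ : ∃ J, I = J + 1 := ⟨I - 1, by omega⟩
    simp only [Nat.add_sub_cancel]
    rw [pow_succ] at hI
    linarith
  have hlt : Nat.find hex < I := by
    obtain ⟨J, rfl⟩ : ∃ J, I = J + 1 := ⟨I - 1, by omega⟩
    have : Nat.find hex ≤ J := by
      apply Nat.find_min'
      rw [pow_succ] at hI
      linarith
    omega
  refine ⟨Nat.find hex, hlt, Nat.find_spec hex, ?_⟩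
  rcases Nat.eq_zero_or_pos (Nat.find hex) with h0 | h0
  · rw [h0]
    simp only [pow_zero, mul_one]
    by_cases h1 : 1 ≤ s
    · rw [hσ, max_eq_right h1]; exact hsm
    · rcases hx with h | h
      · rw [hσ, max_eq_left (by linarith)]; linarith
      · exact absurd h h1
  · have h2 := Nat.find_min hex (Nat.sub_lt h0 one_pos)
    push Not at h2
    obtain ⟨J, hJ⟩ : ∃ J, Nat.find hex = J + 1 := ⟨Nat.find hex - 1, by omega⟩
    rw [hJ] at h2 ⊢
    simp only [Nat.add_sub_cancel] at h2
    have : σ * 2 ^ (J+1) = 2 * (σ * 2 ^ J) := by ring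
    rw [this]
    have hpos : 0 < σ * 2 ^ J := by
      have : 0 < σ := by rw [hσ]; positivity
      positivity
    linarith

/-- The per-level potential. -/
noncomputable def hpot (A κ σ B : ℝ) (I : ℕ) (x : ℝ) : ℝ :=
  A * ∑ i ∈ Finset.range I, Real.exp (-(κ / (σ * 2 ^ i) * x)) + B * Real.exp (-(κ * x))

lemma hpot_pos (A κ σ B : ℝ) (I : ℕ) (x : ℝ) (hA : 0 ≤ A) (hB : 0 < B) : 0 < hpot A κ σ B I x := by
  unfold hpot
  have : 0 ≤ ∑ i ∈ Finset.range I, Real.exp (-(κ / (σ * 2 ^ i) * x)) :=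
    Finset.sum_nonneg fun i _ => (Real.exp_pos _).le
  positivity

lemma hpot_zero (A κ σ B : ℝ) (I : ℕ) : hpot A κ σ B I 0 = A * I + B := by
  simp [hpot]

lemma hpot_le (A κ σ B : ℝ) (I : ℕ) (x : ℝ) (hA : 0 ≤ A) (hB : 0 ≤ B) (hκ : 0 ≤ κ) (hσ : 0 ≤ σ)
    (hx : 0 ≤ x) : hpot A κ σ B I x ≤ A * I + B := by
  rw [← hpot_zero A κ σ B I]
  unfold hpot
  gcongr

lemma aux_term (ε θ x m : ℝ) (hθ : 0 ≤ θ) (hxm : x ≤ m) :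
    Real.exp (-((1 + ε / 2) * (θ * m))) + Real.exp (-(θ * x)) * (1 - Real.exp (-(ε / 2 * (θ * m))))
      ≤ Real.exp (-(θ * x)) := by
  have : Real.exp (-((1 + ε / 2) * (θ * m))) ≤ Real.exp (-(θ * x)) * Real.exp (-(ε / 2 * (θ * m))) := by
    rw [← Real.exp_add]
    apply Real.exp_le_exp.mpr
    have := mul_le_mul_of_nonneg_left hxm hθ
    linarith
  linarith

lemma aux_h_drift {α : Type*} [Fintype α] (l : ℕ) (D : PMF α) (S : α → Prop)
    [DecidablePred S] (ε κ A B σ s m : ℝ) (I x : ℕ) (hε0 : 0 < ε) (hε1 : ε ≤ 1) (hκ : κ = ε / 4)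
    (hs : 0 < s) (hσ : σ = max 1 s) (hB : B = 8 / (κ * s))
    (hA0 : 0 ≤ A) (hA : 2 ≤ A * (Real.exp (-(2 * κ)) * (1 - Real.exp (-(ε * κ / 4)))))
    (hxm : (x : ℝ) ≤ m) (hsm : s / 2 ≤ m) (hxl : x ≤ l) (hI1 : 1 ≤ I) (hI : (l : ℝ) ≤ σ * 2 ^ I)
    (hm : (1 + ε) * m ≤ (l : ℝ) * (∑ a ∈ Finset.univ.filter S, (D a).toReal)) :
    ∑ g : Fin l → α, (prodPMF (fun _ : Fin l => D) g).toReal *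
        hpot A κ σ B I ((Finset.univ.filter fun i => S (g i)).card : ℝ) + 2
      ≤ hpot A κ σ B I x := by
  have hκ0 : 0 < κ := by rw [hκ]; positivity
  have hσ1 : 1 ≤ σ := by rw [hσ]; exact le_max_left _ _
  have hB0 : 0 < B := by rw [hB]; positivity
  have hm0 : 0 ≤ m := by linarith
  set E : ℝ → ℝ := fun θ => ∑ g : Fin l → α, (prodPMF (fun _ : Fin l => D) g).toReal *
        Real.exp (-(θ * ((Finset.univ.filter fun i => S (g i)).card : ℝ))) with hE
  have hlhs : ∑ g : Fin l → α, (prodPMF (fun _ : Fin l => D) g).toReal *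
        hpot A κ σ B I ((Finset.univ.filter fun i => S (g i)).card : ℝ)
      = A * ∑ i ∈ Finset.range I, E (κ / (σ * 2 ^ i)) + B * E κ := by
    simp only [hE, hpot]
    rw [Finset.sum_comm, Finset.mul_sum, Finset.mul_sum, ← Finset.sum_add_distrib]
    refine Finset.sum_congr rfl fun g _ => ?_
    rw [← Finset.mul_sum]
    ring
  have hEb : ∀ θ, 0 ≤ θ → θ ≤ κ →
      E θ + Real.exp (-(θ * x)) * (1 - Real.exp (-(ε / 2 * (θ * m)))) ≤ Real.exp (-(θ * x)) := by
    intro θ h0 h1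
    have h2 := aux_expo2 l D S θ ε m hε0 hε1 h0 (by linarith) hm0 hm
    have h3 := aux_term ε θ x m h0 hxm
    simp only [hE]
    linarith
  have hdrop0 : ∀ θ, 0 ≤ θ → 0 ≤ Real.exp (-(θ * x)) * (1 - Real.exp (-(ε / 2 * (θ * m)))) := by
    intro θ h0
    apply mul_nonneg (Real.exp_pos _).le
    have : Real.exp (-(ε / 2 * (θ * m))) ≤ 1 := by
      apply Real.exp_le_one_iff.mpr
      have : 0 ≤ ε / 2 * (θ * m) := by positivity
      linarith
    linarith
  have hθi : ∀ i : ℕ, 0 ≤ κ / (σ * 2 ^ i) ∧ κ / (σ * 2 ^ i) ≤ κ := by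
    intro i
    have h1 : (1 : ℝ) ≤ σ * 2 ^ i := by
      have : (1 : ℝ) ≤ 2 ^ i := one_le_pow₀ (by norm_num)
      nlinarith
    refine ⟨by positivity, div_le_self hκ0.le h1⟩
  rw [hlhs]
  unfold hpot
  by_cases hx : 1 ≤ x ∨ 1 ≤ s
  · obtain ⟨i, hiI, hi1, hi2⟩ := aux_scale σ s x m l I hσ hxm hsm (by exact_mod_cast hxl) hI1 hI
      (by rcases hx with h | h; · left; exact_mod_cast h
          · right; exact h)
    have hσi : 0 < σ * 2 ^ i := by positivity
    set c0 := Real.exp (-(2 * κ)) * (1 - Real.exp (-(ε * κ / 4))) with hc0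
    have hsumm : ∑ i ∈ Finset.range I, E (κ / (σ * 2 ^ i)) + c0 ≤
        ∑ i ∈ Finset.range I, Real.exp (-(κ / (σ * 2 ^ i) * x)) := by
      have hmem : i ∈ Finset.range I := Finset.mem_range.mpr hiI
      rw [← Finset.add_sum_erase _ _ hmem, ← Finset.add_sum_erase _ (fun i => Real.exp (-(κ / (σ * 2 ^ i) * x))) hmem]
      have ha : ∑ i ∈ (Finset.range I).erase i, E (κ / (σ * 2 ^ i)) ≤
          ∑ i ∈ (Finset.range I).erase i, Real.exp (-(κ / (σ * 2 ^ i) * x)) := by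
        refine Finset.sum_le_sum fun k _ => ?_
        have := hEb _ (hθi k).1 (hθi k).2
        have := hdrop0 _ (hθi k).1
        linarith
      have hb := hEb _ (hθi i).1 (hθi i).2
      have hc : c0 ≤ Real.exp (-(κ / (σ * 2 ^ i) * x)) * (1 - Real.exp (-(ε / 2 * (κ / (σ * 2 ^ i) * m)))) := by
        rw [hc0]
        have e1 : κ / (σ * 2 ^ i) * x ≤ 2 * κ := by
          rw [div_mul_eq_mul_div, div_le_iff₀ hσi]
          nlinarith
        have e2 : κ / 2 ≤ κ / (σ * 2 ^ i) * m := by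
          rw [div_mul_eq_mul_div, le_div_iff₀ hσi]
          nlinarith
        have e3 : ε * κ / 4 ≤ ε / 2 * (κ / (σ * 2 ^ i) * m) := by nlinarith
        apply mul_le_mul
        · apply Real.exp_le_exp.mpr; linarith
        · have : Real.exp (-(ε / 2 * (κ / (σ * 2 ^ i) * m))) ≤ Real.exp (-(ε * κ / 4)) := by
            apply Real.exp_le_exp.mpr; linarith
          linarith
        · have : Real.exp (-(ε * κ / 4)) ≤ 1 := by
            apply Real.exp_le_one_iff.mpr
            have : 0 ≤ ε * κ / 4 := by positivity
            linarith
          linarith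
        · exact (Real.exp_pos _).le
      linarith
    have h5 := hEb κ hκ0.le le_rfl
    have h6 := hdrop0 κ hκ0.le
    have h7 : E κ ≤ Real.exp (-(κ * x)) := by linarith
    have h8 := mul_le_mul_of_nonneg_left h7 hB0.le
    have h9 := mul_le_mul_of_nonneg_left hsumm hA0
    rw [mul_add] at h9
    linarith
  · push Not at hx
    obtain ⟨hx0, hs1⟩ := hx
    have hx0 : x = 0 := by omega
    have hsumm : ∑ i ∈ Finset.range I, E (κ / (σ * 2 ^ i)) ≤
        ∑ i ∈ Finset.range I, Real.exp (-(κ / (σ * 2 ^ i) * x)) := by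
      refine Finset.sum_le_sum fun k _ => ?_
      have := hEb _ (hθi k).1 (hθi k).2
      have := hdrop0 _ (hθi k).1
      linarith
    have h9 := mul_le_mul_of_nonneg_left hsumm hA0
    have hκ1 : κ ≤ 1 := by linarith
    have h2 := aux_expo2 l D S κ ε m hε0 hε1 hκ0.le (by linarith) hm0 hm
    have h3 : E κ ≤ Real.exp (-(κ * s / 2)) := by
      refine le_trans h2 ?_
      apply Real.exp_le_exp.mpr
      have : κ * (s / 2) ≤ κ * m := by gcongr
      have : 0 ≤ κ * m := by positivity
      nlinarith
    have hu : 0 ≤ κ * s / 2 := by positivity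
    have h4 := aux_exp_low (κ * s / 2) hu
    have h5 : κ * s / 4 ≤ (κ * s / 2) / (1 + κ * s / 2) := by
      rw [le_div_iff₀ (by linarith)]
      have : κ * s ≤ 1 := by nlinarith
      nlinarith
    have h6 : B * (κ * s / 4) = 2 := by rw [hB]; field_simp; norm_num
    have h7 : Real.exp (-(κ * (x : ℝ))) = 1 := by rw [hx0]; simp
    rw [h7]
    have h8 : B * (E κ + κ * s / 4) ≤ B * 1 := by
      apply mul_le_mul_of_nonneg_left _ hB0.le
      linarith
    rw [mul_add, h6] at h8
    linarith

/-- Abstract level-based theorem. -/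
lemma aux_level_based {n l m : ℕ} (hl : 0 < l) (hm1 : 0 < m) (level : BitStr n → ℕ)
    (D : Popn n l → PMF (BitStr n)) (init : PMF (Popn n l)) (G : Set (Popn n l))
    (hG : ∀ P : Popn n l, (∃ i, m ≤ level (P i)) → P ∈ G)
    (ε γ A : ℝ) (z : ℕ → ℝ) (I : ℕ → ℕ) (hε0 : 0 < ε) (hε1 : ε ≤ 1) (hγ0 : 0 < γ) (hγ1 : γ ≤ 1)
    (hA0 : 0 ≤ A) (hA : 2 ≤ A * (Real.exp (-(2 * (ε / 4))) * (1 - Real.exp (-(ε * (ε / 4) / 4)))))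
    (hz : ∀ j < m, 0 < z j) (hI1 : ∀ j < m, 1 ≤ I j) (hI : ∀ j < m, 1 ≤ z j * 2 ^ I j)
    (hG1 : ∀ P : Popn n l, ∀ j < m,
      γ * l ≤ ((Finset.univ.filter fun i => j ≤ level (P i)).card : ℝ) →
      z j ≤ ∑ a ∈ Finset.univ.filter (fun a => j + 1 ≤ level a), (D P a).toReal)
    (hG2 : ∀ P : Popn n l, ∀ j ≤ m,
      (1 + ε) * min (((Finset.univ.filter fun i => j ≤ level (P i)).card : ℝ) / l) γ
      ≤ ∑ a ∈ Finset.univ.filter (fun a => j ≤ level a), (D P a).toReal)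
    (M : ℝ) (hM : M = ∑ j ∈ Finset.range m, (A * I j + 8 / ((ε / 4) * (l * z j))))
    (hfail : M * Real.exp (-(ε / 2 * ((ε / 4) * (γ * l)))) ≤ 1) :
    expHitTime init (fun P => prodPMF fun _ : Fin l => D P) G ≤ ENNReal.ofReal M := by
  classical
  have hlr : (0 : ℝ) < l := by exact_mod_cast hl
  set κ := ε / 4 with hκ
  have hκ0 : 0 < κ := by positivity
  set X : ℕ → Popn n l → ℕ := fun j P => (Finset.univ.filter fun i => j ≤ level (P i)).card with hX
  have hXl : ∀ j P, X j P ≤ l := fun j P => by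
    simpa using Finset.card_le_univ (Finset.univ.filter fun i => j ≤ level (P i))
  set h : ℕ → ℝ → ℝ := fun j x => hpot A κ (max 1 (l * z j)) (8 / (κ * (l * z j))) (I j) x with hh
  set F : ℕ → ℝ := fun j => ∑ i ∈ Finset.Ico (j + 1) m, h i 0 with hF
  set W : ℕ → Popn n l → ℝ := fun j P => F j + h j (X (j + 1) P) with hW
  have hB : ∀ j < m, 0 < 8 / (κ * (l * z j)) := fun j hj => by have := hz j hj; positivity
  have hhpos : ∀ j < m, ∀ x, 0 < h j x := fun j hj x => hpot_pos _ _ _ _ _ _ hA0 (hB j hj)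
  have hhle : ∀ j < m, ∀ x, 0 ≤ x → h j x ≤ h j 0 := fun j hj x hx => by
    simp only [hh]
    rw [hpot_zero]
    exact hpot_le _ _ _ _ _ _ hA0 (hB j hj).le hκ0.le (by positivity) hx
  have hFnn : ∀ j, 0 ≤ F j := fun j => Finset.sum_nonneg fun i hi =>
    (hhpos i (Finset.mem_Ico.mp hi).2 0).le
  have hM' : M = F 0 + h 0 0 := by
    simp only [hM, hF]
    rw [add_comm (∑ i ∈ _, _), ← Finset.sum_eq_sum_Ico_succ_bot hm1 (fun i => h i 0), Finset.range_eq_Ico]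
    refine Finset.sum_congr rfl fun j _ => ?_
    simp only [hh, hpot_zero]
  have hX0 : ∀ P, X 0 P = l := fun P => by simp [hX]
  have hJ : ∀ P : Popn n l, ∃ j, (j < m ∧ γ * l ≤ X j P) ∧
      ∀ j', j' < m → γ * l ≤ X j' P → W j P ≤ W j' P := by
    intro P
    obtain ⟨j, hj, hmin⟩ := Finset.exists_min_image
      ((Finset.range m).filter fun j => γ * l ≤ X j P) (fun j => W j P)
      ⟨0, by
        simp only [Finset.mem_filter, Finset.mem_range]
        refine ⟨hm1, ?_⟩
        rw [hX0]; nlinarith⟩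
    simp only [Finset.mem_filter, Finset.mem_range] at hj hmin
    exact ⟨j, hj, fun j' h1 h2 => hmin j' ⟨h1, h2⟩⟩
  choose J hJ1 hJ2 using hJ
  have hV0 : ∀ P, 0 ≤ W (J P) P := fun P =>
    add_nonneg (hFnn _) (hhpos _ (hJ1 P).1 _).le
  have hVM : ∀ P, W (J P) P ≤ M := by
    intro P
    refine le_trans (hJ2 P 0 hm1 (by rw [hX0]; nlinarith)) ?_
    rw [hM']
    simp only [hW]
    have := hhle 0 hm1 (X 1 P) (by positivity)
    simpa using this
  refine aux_drift init _ G (fun P => W (J P) P) M hV0 hVM ?_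
  intro P hPG
  have hM0 : 0 ≤ M := le_trans (hV0 P) (hVM P)
  obtain ⟨hjm, hjX⟩ := hJ1 P
  have hmin := hJ2 P
  change ∑ Q, _ * W (J Q) Q + 1 ≤ W (J P) P
  generalize J P = j at hjm hjX hmin ⊢
  -- X (j+1) P is small
  have hxlt : (X (j + 1) P : ℝ) < γ * l := by
    by_contra hcon
    push Not at hcon
    by_cases hj1 : j + 1 < m
    · have h1 := hmin (j + 1) hj1 hcon
      have h2 : F j = h (j + 1) 0 + F (j + 1) := Finset.sum_eq_sum_Ico_succ_bot hj1 _
      have h3 := hhle (j + 1) hj1 (X (j + 1 + 1) P) (by positivity)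
      have h4 := hhpos j hjm (X (j + 1) P)
      simp only [hW] at h1
      linarith
    · have hjm' : j + 1 = m := by omega
      apply hPG
      apply hG
      have : 0 < X (j + 1) P := by
        have : (0 : ℝ) < X (j + 1) P := lt_of_lt_of_le (by positivity) hcon
        exact_mod_cast this
      obtain ⟨i, hi⟩ := Finset.card_pos.mp this
      simp only [Finset.mem_filter, Finset.mem_univ, true_and] at hi
      exact ⟨i, hjm' ▸ hi⟩
  have hpt : ∀ Q : Popn n l, W (J Q) Q ≤ F j + h j (X (j + 1) Q)
      + (M * Real.exp (κ * (γ * l))) * Real.exp (-(κ * X j Q)) := by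
    intro Q
    by_cases hQ : γ * l ≤ X j Q
    · have h1 := hJ2 Q j hjm hQ
      have h2 : 0 ≤ (M * Real.exp (κ * (γ * l))) * Real.exp (-(κ * X j Q)) := by positivity
      simp only [hW] at h1 ⊢
      linarith
    · push Not at hQ
      have h1 : M ≤ (M * Real.exp (κ * (γ * l))) * Real.exp (-(κ * X j Q)) := by
        rw [mul_assoc, ← Real.exp_add]
        apply le_mul_of_one_le_right hM0
        apply Real.one_le_exp
        nlinarith
      have h2 := hVM Q
      have h3 := hhpos j hjm (X (j + 1) Q)
      have h4 := hFnn j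
      linarith
  set pr : Popn n l → ℝ := fun Q => ((prodPMF fun _ : Fin l => D P) Q).toReal with hpr
  have hpr1 : ∑ Q, pr Q = 1 := aux_pmf_real_sum _
  have hpr0 : ∀ Q, 0 ≤ pr Q := fun Q => ENNReal.toReal_nonneg
  set p := ∑ a ∈ Finset.univ.filter (fun a => j + 1 ≤ level a), (D P a).toReal with hp
  have hzj := hz j hjm
  have hg1 := hG1 P j hjm hjX
  have hg2 := hG2 P (j + 1) (by omega)
  have hd := aux_h_drift l (D P) (fun a => j + 1 ≤ level a) ε κ A (8 / (κ * (l * z j)))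
    (max 1 (l * z j)) (l * z j) (l * p / (1 + ε)) (I j) (X (j + 1) P) hε0 hε1 hκ (by positivity) rfl rfl
    hA0 hA
    (by
      rw [min_eq_left (by rw [div_le_iff₀ hlr]; exact hxlt.le)] at hg2
      rw [le_div_iff₀ (by linarith)]
      have := mul_le_mul_of_nonneg_left hg2 hlr.le
      calc _ = l * ((1 + ε) * ((X (j + 1) P : ℝ) / l)) := by field_simp
        _ ≤ _ := this)
    (by
      rw [div_le_div_iff₀ (by norm_num) (by linarith)]
      have := mul_le_mul_of_nonneg_left hg1 hlr.le
      have h0 : 0 < l * z j := by positivity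
      nlinarith)
    (hXl _ _) (hI1 j hjm)
    (by
      have h1 : (l : ℝ) ≤ (l * z j) * 2 ^ I j := by
        have := mul_le_mul_of_nonneg_left (hI j hjm) hlr.le
        linarith
      refine le_trans h1 ?_
      gcongr
      exact le_max_right _ _)
    (by
      have : (1 + ε) * (l * p / (1 + ε)) = l * p := by field_simp
      rw [this])
  have hg3 := hG2 P j hjm.le
  have hf := aux_expo2 l (D P) (fun a => j ≤ level a) κ ε (γ * l) hε0 hε1 hκ0.le le_rfl (by positivity)
    (by
      rw [min_eq_right (by rw [le_div_iff₀ hlr]; exact hjX)] at hg3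
      have := mul_le_mul_of_nonneg_left hg3 hlr.le
      linarith)
  have hf2 : (M * Real.exp (κ * (γ * l))) * ∑ Q, pr Q * Real.exp (-(κ * X j Q)) ≤ 1 := by
    refine le_trans ?_ hfail
    calc _ ≤ (M * Real.exp (κ * (γ * l))) * Real.exp (-((1 + ε / 2) * (κ * (γ * l)))) := by
          gcongr
      _ = _ := by
          rw [mul_assoc, ← Real.exp_add]; congr 2; ring
  have htot : ∑ Q, pr Q * W (J Q) Q ≤ F j + ∑ Q, pr Q * h j (X (j + 1) Q)
      + (M * Real.exp (κ * (γ * l))) * ∑ Q, pr Q * Real.exp (-(κ * X j Q)) := by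
    calc ∑ Q, pr Q * W (J Q) Q ≤ ∑ Q, pr Q * (F j + h j (X (j + 1) Q)
      + (M * Real.exp (κ * (γ * l))) * Real.exp (-(κ * X j Q))) := by
          refine Finset.sum_le_sum fun Q _ => mul_le_mul_of_nonneg_left (hpt Q) (hpr0 Q)
      _ = (∑ Q, pr Q) * F j + ∑ Q, pr Q * h j (X (j + 1) Q)
      + (M * Real.exp (κ * (γ * l))) * ∑ Q, pr Q * Real.exp (-(κ * X j Q)) := by
          rw [Finset.sum_mul, Finset.mul_sum, ← Finset.sum_add_distrib, ← Finset.sum_add_distrib]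
          refine Finset.sum_congr rfl fun Q _ => ?_
          ring
      _ = _ := by rw [hpr1, one_mul]
  have hd' : ∑ Q, pr Q * h j (X (j + 1) Q) + 2 ≤ h j (X (j + 1) P) := hd
  simp only [hW] at htot ⊢
  linarith

/-- The fitness level of a bit string. -/
def plevel (n r : ℕ) (x : BitStr n) : ℕ :=
  if ones x ≤ n - r then ones x else if ones x = n then n - r + 1 else n - r

lemma ones_le {n : ℕ} (x : BitStr n) : ones x ≤ n := by
  simpa [ones] using Finset.card_le_univ (Finset.univ.filter fun i => x i = true)

lemma ones_eq_iff {n : ℕ} (x : BitStr n) : ones x = n → x = allOnesStr n := by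
  intro h
  have h1 : (Finset.univ.filter fun i => x i = true) = Finset.univ := by
    apply Finset.eq_univ_of_card
    rw [Fintype.card_fin]; exact h
  funext i
  have : i ∈ (Finset.univ.filter fun i => x i = true) := by rw [h1]; simp
  simpa [allOnesStr] using this

lemma ones_allOnes (n : ℕ) : ones (allOnesStr n) = n := by
  simp [ones, allOnesStr]

lemma plevel_opt {n r : ℕ} (hr : 1 ≤ r) (hrn : r ≤ n) (x : BitStr n) (h : n - r + 1 ≤ plevel n r x) :
    x = allOnesStr n := by
  apply ones_eq_iff
  unfold plevel at h
  split_ifs at h <;> omega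

lemma plevel_allOnes {n r : ℕ} (hr : 1 ≤ r) (hrn : r ≤ n) :
    plevel n r (allOnesStr n) = n - r + 1 := by
  unfold plevel
  rw [ones_allOnes, if_neg (by omega), if_pos rfl]

lemma plevel_lt {n r : ℕ} (hr : 1 ≤ r) (hrn : r ≤ n) (x y : BitStr n)
    (h : plevel n r x < plevel n r y) : plateauF n r x < plateauF n r y := by
  have hx := ones_le x
  have hy := ones_le y
  unfold plevel at h
  unfold plateauF
  split_ifs at h ⊢ <;> first | omega | (exact_mod_cast (by omega))

lemma plevel_ge_ones {n r : ℕ} (x : BitStr n) (j : ℕ) (hj : j ≤ n - r) (h : j ≤ ones x) :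
    j ≤ plevel n r x := by
  unfold plevel
  split_ifs <;> omega

lemma ones_ge_plevel {n r : ℕ} (x : BitStr n) (j : ℕ) (hj : j ≤ n - r) (h : j ≤ plevel n r x) :
    j ≤ ones x := by
  unfold plevel at h
  split_ifs at h <;> omega

lemma aux_sel_mu {l : ℕ} (μ : ℕ) (hμ : 0 < μ) (b : ℝ) (hb : 0 < b) (hbl : b ≤ (l : ℝ) / μ)
    (T S : Finset (Fin l)) (hS : S.card = μ) (hST : (∀ i ∈ S, i ∈ T) ∨ (∀ i ∈ T, i ∈ S))
    (w : PMF (Fin l)) (hw : ∀ i, w i = if i ∈ S then ((μ : ℝ≥0∞))⁻¹ else 0) (γ : ℝ)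
    (hγ : b * γ ≤ 1) (hγT : γ ≤ (T.card : ℝ) / l) :
    b * γ ≤ ∑ i ∈ T, (w i).toReal := by
  have hμr : (0 : ℝ) < μ := by exact_mod_cast hμ
  have hl : (0 : ℝ) < l := by
    have : 0 < (l : ℝ) / μ := lt_of_lt_of_le hb hbl
    by_contra hcon
    have h0 : (l : ℝ) = 0 := le_antisymm (not_lt.mp hcon) (by positivity)
    rw [h0] at this; simp at this
  have hwr : ∀ i, (w i).toReal = if i ∈ S then ((μ : ℝ))⁻¹ else 0 := by
    intro i; rw [hw]; split_ifs <;> simp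
  rcases hST with h | h
  · have : ∑ i ∈ S, (w i).toReal ≤ ∑ i ∈ T, (w i).toReal :=
      Finset.sum_le_sum_of_subset_of_nonneg h (fun i _ _ => ENNReal.toReal_nonneg)
    have h1 : ∑ i ∈ S, (w i).toReal = 1 := by
      rw [Finset.sum_congr rfl (fun i hi => by rw [hwr, if_pos hi])]
      rw [Finset.sum_const, hS, nsmul_eq_mul, mul_inv_cancel₀ hμr.ne']
    linarith
  · have h1 : ∑ i ∈ T, (w i).toReal = T.card / μ := by
      rw [Finset.sum_congr rfl (fun i hi => by rw [hwr, if_pos (h i hi)])]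
      rw [Finset.sum_const, nsmul_eq_mul, div_eq_mul_inv]
    rw [h1]
    calc b * γ ≤ b * ((T.card : ℝ) / l) := by gcongr
      _ ≤ (l : ℝ) / μ * ((T.card : ℝ) / l) := by gcongr
      _ = _ := by field_simp

lemma aux_sel_tour {l : ℕ} (hl : 0 < l) (k : ℕ) (T : Finset (Fin l))
    (pick : (Fin k → Fin l) → Fin l → ℝ≥0∞)
    (hp1 : ∀ d, ∑ i, pick d i = 1)
    (hp2 : ∀ d, (∃ j, d j ∈ T) → ∀ i, pick d i ≠ 0 → i ∈ T)
    (w : PMF (Fin l)) (hw : ∀ i, w i = (∑ d : Fin k → Fin l, pick d i) / (l : ℝ≥0∞) ^ k) :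
    1 - (1 - (T.card : ℝ) / l) ^ k ≤ ∑ i ∈ T, (w i).toReal := by
  classical
  have hlr : (0 : ℝ) < l := by exact_mod_cast hl
  have hpt : ∀ d i, pick d i ≠ ⊤ := by
    intro d i h
    have : pick d i ≤ 1 := by
      rw [← hp1 d]; exact Finset.single_le_sum (f := fun i => pick d i) (fun _ _ => zero_le) (Finset.mem_univ i)
    rw [h] at this; simp at this
  have hwr : ∀ i, (w i).toReal = (∑ d : Fin k → Fin l, (pick d i).toReal) / (l : ℝ) ^ k := by
    intro i
    rw [hw, ENNReal.toReal_div, ENNReal.toReal_sum (fun d _ => hpt d i), ENNReal.toReal_pow,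
      ENNReal.toReal_natCast]
  have hp1r : ∀ d, ∑ i, (pick d i).toReal = 1 := by
    intro d
    rw [← ENNReal.toReal_sum (fun i _ => hpt d i), hp1]; simp
  simp_rw [hwr]
  rw [← Finset.sum_div, Finset.sum_comm, le_div_iff₀ (by positivity)]
  have hbad : (Finset.univ.filter fun d : Fin k → Fin l => ∀ j, d j ∉ T) =
      Fintype.piFinset (fun _ : Fin k => Tᶜ) := by
    ext d; simp [Fintype.mem_piFinset]
  have hcard : ((Finset.univ.filter fun d : Fin k → Fin l => ∀ j, d j ∉ T).card : ℝ)
      = ((l : ℝ) - T.card) ^ k := by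
    have hTl : T.card ≤ l := by simpa using Finset.card_le_univ T
    rw [hbad, Fintype.card_piFinset, Finset.prod_const, Finset.card_univ, Fintype.card_fin,
      Finset.card_compl, Fintype.card_fin]
    push_cast [Nat.cast_sub hTl]
    rfl
  have hpw : ∀ d : Fin k → Fin l, (1 : ℝ) - (if ∀ j, d j ∉ T then 1 else 0) ≤ ∑ i ∈ T, (pick d i).toReal := by
    intro d
    split_ifs with h
    · rw [sub_self]; exact Finset.sum_nonneg fun i _ => ENNReal.toReal_nonneg
    · push Not at h
      rw [sub_zero, ← hp1r d]
      apply le_of_eq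
      symm
      apply Finset.sum_subset (Finset.subset_univ _)
      intro i _ hi
      by_contra h0
      apply hi
      apply hp2 d h
      intro h1
      rw [h1] at h0; simp at h0
  calc (1 - (1 - (T.card : ℝ) / l) ^ k) * (l : ℝ) ^ k = (l : ℝ) ^ k - ((l : ℝ) - T.card) ^ k := by
        rw [sub_mul, one_mul, ← mul_pow]
        congr 2
        field_simp
    _ = ∑ d : Fin k → Fin l, ((1 : ℝ) - (if ∀ j, d j ∉ T then 1 else 0)) := by
        rw [Finset.sum_sub_distrib, ← Finset.sum_filter, Finset.sum_const, Finset.sum_const, nsmul_eq_mul, nsmul_eq_mul, mul_one, mul_one, hcard,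
          Finset.card_univ]
        simp
    _ ≤ _ := Finset.sum_le_sum fun d _ => hpw d

lemma aux_sel {n l r : ℕ} (hl : 0 < l) (hr : 1 ≤ r) (hrn : r ≤ n) (E δ b : ℝ) (hE : 0 < E)
    (hδ0 : 0 < δ) (hδ1 : δ ≤ 1) (hb : b = (1 + δ) * E) (sel : Popn n l → PMF (Fin l))
    (h : (∃ k : ℕ, b ≤ (k : ℝ) ∧ IsTournamentSel (plateauF n r) k sel) ∨
         (∃ μ : ℕ, 0 < μ ∧ b ≤ (l : ℝ) / (μ : ℝ) ∧ IsMuCommaSel (plateauF n r) μ sel))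
    (P : Popn n l) (j : ℕ) :
    (1 + δ / 2) * E * min (((Finset.univ.filter fun i => j ≤ plevel n r (P i)).card : ℝ) / l) (δ / (4 * b))
      ≤ ∑ i ∈ Finset.univ.filter (fun i => j ≤ plevel n r (P i)), (sel P i).toReal := by
  classical
  set T := Finset.univ.filter (fun i => j ≤ plevel n r (P i)) with hT
  have hlr : (0 : ℝ) < l := by exact_mod_cast hl
  have hb0 : 0 < b := by rw [hb]; positivity
  set γ := min ((T.card : ℝ) / l) (δ / (4 * b)) with hγ
  have hγ0 : 0 ≤ γ := le_min (by positivity) (by positivity)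
  have hγ1 : γ ≤ (T.card : ℝ) / l := min_le_left _ _
  have hγ2 : b * γ ≤ δ / 4 := by
    calc b * γ ≤ b * (δ / (4 * b)) := by gcongr; exact min_le_right _ _
      _ = δ / 4 := by field_simp
  rcases h with ⟨k, hk, hsel⟩ | ⟨μ, hμ, hk, hsel⟩
  · obtain ⟨pick, hp1, hp2, hw⟩ := hsel P
    have h1 := aux_sel_tour hl k T pick hp1 (by
      rintro d ⟨i0, hi0⟩ i hi
      have h2 := (hp2 d i hi).2 i0
      simp only [hT, Finset.mem_filter, Finset.mem_univ, true_and] at hi0 ⊢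
      by_contra hcon
      have := plevel_lt hr hrn (P i) (P (d i0)) (by omega)
      linarith) (sel P) hw
    refine le_trans ?_ h1
    have hTl : (T.card : ℝ) / l ≤ 1 := by
      rw [div_le_one hlr]
      exact_mod_cast (by simpa using Finset.card_le_univ T)
    have h3 : (1 - (T.card : ℝ) / l) ^ k ≤ Real.exp (-(b * γ)) := by
      calc (1 - (T.card : ℝ) / l) ^ k ≤ (Real.exp (-γ)) ^ k := by
            apply pow_le_pow_left₀ (by linarith)
            linarith [Real.add_one_le_exp (-γ)]
        _ = Real.exp (-(k * γ)) := by rw [← Real.exp_nat_mul]; congr 1; ring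
        _ ≤ _ := by
            apply Real.exp_le_exp.mpr
            have := mul_le_mul_of_nonneg_right hk hγ0
            linarith
    have hu : 0 ≤ b * γ := by positivity
    have h4 := aux_exp_low (b * γ) hu
    have h5 : (1 + δ / 2) * E * γ ≤ b * γ / (1 + b * γ) := by
      rw [le_div_iff₀ (by linarith)]
      have hEγ : 0 ≤ E * γ := by positivity
      have h6 : (1 + δ / 2) * (1 + b * γ) ≤ 1 + δ := by nlinarith
      calc (1 + δ / 2) * E * γ * (1 + b * γ) = ((1 + δ / 2) * (1 + b * γ)) * (E * γ) := by ring
        _ ≤ (1 + δ) * (E * γ) := by gcongr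
        _ = b * γ := by rw [hb]; ring
    linarith
  · obtain ⟨S, hS, hS2, hw⟩ := hsel P
    have h1 := aux_sel_mu μ hμ b hb0 hk T S hS (by
      by_contra hcon
      push Not at hcon
      obtain ⟨⟨i, hiS, hiT⟩, ⟨i', hiT', hiS'⟩⟩ := hcon
      have h2 := hS2 i hiS i' hiS'
      simp only [hT, Finset.mem_filter, Finset.mem_univ, true_and] at hiT hiT'
      have := plevel_lt hr hrn (P i) (P i') (by omega)
      linarith) (sel P) hw γ (by linarith) hγ1
    refine le_trans ?_ h1
    rw [hb]
    have hEγ : 0 ≤ E * γ := by positivity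
    nlinarith

lemma aux_mut_lb {n : ℕ} (hn : 0 < n) (χ χ1 : ℝ) (hχ0 : 0 < χ1) (hχ1 : χ1 ≤ χ) (hχ2 : χ1 ≤ 1) (hχn : χ ≤ n)
    (mutOp : BitStr n → PMF (BitStr n)) (hm : IsBitwiseMut (χ / n) mutOp) (x y : BitStr n) (d : ℕ)
    (hd : hammingDist x y ≤ d) :
    (χ1 / n) ^ d * (1 - χ / n) ^ n ≤ (mutOp x y).toReal := by
  have hnr : (0 : ℝ) < n := by exact_mod_cast hn
  have hp1 : χ / n ≤ 1 := by rw [div_le_one hnr]; exact hχn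
  have hp0 : 0 ≤ χ / n := by have := hχ0.trans_le hχ1; positivity
  have h1 : 0 ≤ 1 - χ / n := by linarith
  rw [hm x y, ENNReal.toReal_ofReal (by positivity)]
  have hc1 : χ1 / n ≤ 1 := by
    have : χ1 / n ≤ χ / n := by gcongr
    linarith
  apply mul_le_mul
  · calc (χ1 / n) ^ d ≤ (χ1 / n) ^ hammingDist x y := pow_le_pow_of_le_one (by positivity) hc1 hd
      _ ≤ _ := by gcongr
  · exact pow_le_pow_of_le_one h1 (by linarith) (Nat.sub_le _ _)
  · positivity
  · positivity

lemma aux_ham_opt {n : ℕ} (x : BitStr n) : hammingDist x (allOnesStr n) = n - ones x := by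
  have h1 : (Finset.univ.filter fun i => x i = true).card + (Finset.univ.filter fun i => ¬ x i = true).card = n := by
    rw [Finset.card_filter_add_card_filter_not]; simp
  have h2 : hammingDist x (allOnesStr n) = (Finset.univ.filter fun i => ¬ x i = true).card := by
    simp only [hammingDist, allOnesStr, ne_eq]
    congr
  unfold ones
  omega

lemma aux_mut_one {n : ℕ} (hn : 0 < n) (χ χ1 : ℝ) (hχ0 : 0 < χ1) (hχ1 : χ1 ≤ χ) (hχ2 : χ1 ≤ 1) (hχn : χ ≤ n)
    (mutOp : BitStr n → PMF (BitStr n)) (hm : IsBitwiseMut (χ / n) mutOp) (x : BitStr n) (T : Finset (BitStr n))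
    (hT : ∀ y, ones y = ones x + 1 → y ∈ T) :
    ((n : ℝ) - ones x) * (χ1 / n * (1 - χ / n) ^ n) ≤ ∑ y ∈ T, (mutOp x y).toReal := by
  classical
  set Z := Finset.univ.filter fun i => ¬ x i = true with hZ
  have hcard : (Z.card : ℝ) = (n : ℝ) - ones x := by
    have h1 : (Finset.univ.filter fun i => x i = true).card + (Finset.univ.filter fun i => ¬ x i = true).card = n := by
      rw [Finset.card_filter_add_card_filter_not]; simp
    have h2 : ones x + Z.card = n := h1
    have : (ones x : ℝ) + Z.card = n := by exact_mod_cast h2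
    linarith
  have hinj : Set.InjOn (fun i => Function.update x i true) Z := by
    intro i hi i' hi' hii
    by_contra hne
    have h1 := congrFun hii i
    simp only [Function.update_self, Function.update_of_ne hne] at h1
    simp only [hZ, Finset.coe_filter, Finset.mem_univ, true_and, Set.mem_ofPred_eq] at hi
    exact hi h1.symm
  have hones : ∀ i ∈ Z, ones (Function.update x i true) = ones x + 1 := by
    intro i hi
    simp only [hZ, Finset.mem_filter, Finset.mem_univ, true_and] at hi
    unfold ones
    have : (Finset.univ.filter fun k => Function.update x i true k = true)
        = insert i (Finset.univ.filter fun k => x k = true) := by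
      ext k
      by_cases hk : k = i
      · subst hk; simp
      · simp [Function.update_of_ne hk, hk]
    rw [this, Finset.card_insert_of_notMem (by simpa using hi)]
  have hham : ∀ i ∈ Z, hammingDist x (Function.update x i true) ≤ 1 := by
    intro i hi
    unfold hammingDist
    calc _ ≤ ({i} : Finset (Fin n)).card := by
          apply Finset.card_le_card
          intro k hk
          simp only [Finset.mem_filter, Finset.mem_univ, true_and] at hk
          rw [Finset.mem_singleton]
          by_contra hne
          exact hk (by rw [Function.update_of_ne hne])
      _ = 1 := by simp
  calc ((n : ℝ) - ones x) * (χ1 / n * (1 - χ / n) ^ n)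
      = ∑ i ∈ Z, (χ1 / n * (1 - χ / n) ^ n) := by
        rw [Finset.sum_const, nsmul_eq_mul, hcard]
    _ ≤ ∑ i ∈ Z, (mutOp x (Function.update x i true)).toReal := by
        refine Finset.sum_le_sum fun i hi => ?_
        have := aux_mut_lb hn χ χ1 hχ0 hχ1 hχ2 hχn mutOp hm x _ 1 (hham i hi)
        rwa [pow_one] at this
    _ = ∑ y ∈ Z.image (fun i => Function.update x i true), (mutOp x y).toReal := by
        rw [Finset.sum_image hinj]
    _ ≤ _ := by
        apply Finset.sum_le_sum_of_subset_of_nonneg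
        · intro y hy
          obtain ⟨i, hi, rfl⟩ := Finset.mem_image.mp hy
          exact hT _ (hones i hi)
        · intro _ _ _; exact ENNReal.toReal_nonneg

lemma aux_bind {n l : ℕ} (w : PMF (Fin l)) (mutOp : BitStr n → PMF (BitStr n)) (P : Popn n l)
    (S : Finset (Fin l)) (T : Finset (BitStr n)) (q : ℝ)
    (hq : ∀ i ∈ S, q ≤ ∑ a ∈ T, (mutOp (P i) a).toReal) :
    (∑ i ∈ S, (w i).toReal) * q ≤ ∑ a ∈ T, ((w.bind fun i => mutOp (P i)) a).toReal := by
  have h1 : ∀ a, ((w.bind fun i => mutOp (P i)) a).toReal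
      = ∑ i, (w i).toReal * (mutOp (P i) a).toReal := by
    intro a
    rw [PMF.bind_apply, tsum_fintype, ENNReal.toReal_sum]
    · simp [ENNReal.toReal_mul]
    · intro i _
      exact ENNReal.mul_ne_top (PMF.apply_ne_top _ _) (PMF.apply_ne_top _ _)
  simp_rw [h1]
  rw [Finset.sum_comm, Finset.sum_mul]
  calc ∑ i ∈ S, (w i).toReal * q ≤ ∑ i ∈ S, (w i).toReal * ∑ a ∈ T, (mutOp (P i) a).toReal := by
        refine Finset.sum_le_sum fun i hi => mul_le_mul_of_nonneg_left (hq i hi) ENNReal.toReal_nonneg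
    _ = ∑ i ∈ S, ∑ a ∈ T, (w i).toReal * (mutOp (P i) a).toReal := by simp_rw [Finset.mul_sum]
    _ ≤ _ := Finset.sum_le_sum_of_subset_of_nonneg (Finset.subset_univ _)
        (fun i _ _ => Finset.sum_nonneg fun a _ => mul_nonneg ENNReal.toReal_nonneg ENNReal.toReal_nonneg)

lemma aux_logsum (n : ℕ) (hn : 0 < n) :
    ∑ j ∈ Finset.range n, Real.log ((n : ℝ) / ((n : ℝ) - j)) ≤ n := by
  have hnr : (0 : ℝ) < n := by exact_mod_cast hn
  have h1 : ∑ j ∈ Finset.range n, Real.log ((n : ℝ) - j) = Real.log (n.factorial) := by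
    rw [← Finset.prod_range_add_one_eq_factorial, Nat.cast_prod, Real.log_prod (fun i _ => by positivity)]
    rw [← Finset.sum_range_reflect]
    refine Finset.sum_congr rfl fun j hj => ?_
    have hj := Finset.mem_range.mp hj
    congr 1
    have h2 : n - 1 - j + 1 + j = n := by omega
    have h3 : ((n - 1 - j + 1 : ℕ) : ℝ) + j = n := by exact_mod_cast h2
    have h4 : n - 1 - j + j + 1 = n := by omega
    have h5 : ((n - 1 - j : ℕ) : ℝ) + j + 1 = n := by exact_mod_cast h4
    first
      | (push_cast at h3 ⊢; linarith)
      | (push_cast at h5 ⊢; linarith)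
  have h2 : ∑ j ∈ Finset.range n, Real.log ((n : ℝ) / ((n : ℝ) - j))
      = n * Real.log n - Real.log (n.factorial) := by
    rw [← h1]
    have : ∑ j ∈ Finset.range n, Real.log ((n : ℝ) / ((n : ℝ) - j))
        = ∑ j ∈ Finset.range n, (Real.log n - Real.log ((n : ℝ) - j)) := by
      refine Finset.sum_congr rfl fun j hj => ?_
      have hj : (j : ℝ) < n := by exact_mod_cast Finset.mem_range.mp hj
      rw [Real.log_div hnr.ne' (by linarith)]
    rw [this, Finset.sum_sub_distrib, Finset.sum_const, Finset.card_range, nsmul_eq_mul]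
  rw [h2]
  have h3 := Real.pow_div_factorial_le_exp (n : ℝ) hnr.le n
  have h4 := Real.log_le_log (by positivity) h3
  rw [Real.log_exp, Real.log_div (by positivity) (by positivity), Real.log_pow] at h4
  linarith

/-- Upgrade probabilities. -/
noncomputable def zlev (n r : ℕ) (γ χ1 : ℝ) (j : ℕ) : ℝ :=
  if j < n - r then γ * (χ1 * (((n : ℝ) - j) / n)) else γ * (χ1 / n) ^ r

lemma aux_z {n r : ℕ} (hr : 2 ≤ r) (hrn : r ≤ n) (γ χ1 : ℝ) (hγ0 : 0 < γ) (hγ1 : γ ≤ 1)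
    (hχ0 : 0 < χ1) (hχ1 : χ1 ≤ 1) :
    (∀ j, j < n - r + 1 → 0 < zlev n r γ χ1 j ∧ zlev n r γ χ1 j ≤ 1) ∧
    (∑ j ∈ Finset.range (n - r + 1), Real.log (1 / zlev n r γ χ1 j)
      ≤ (Real.log (1 / (γ * χ1 ^ r)) + 1 + r) * n) ∧
    (∑ j ∈ Finset.range (n - r + 1), 1 / zlev n r γ χ1 j ≤ 2 * (1 / (γ * χ1 ^ r)) * (n : ℝ) ^ r) := by
  have hn : 0 < n := by omega
  have hnr : (0 : ℝ) < n := by exact_mod_cast hn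
  have hn1 : (1 : ℝ) ≤ n := by exact_mod_cast hn
  have hχr : χ1 ^ r ≤ χ1 := by
    calc χ1 ^ r ≤ χ1 ^ 1 := pow_le_pow_of_le_one hχ0.le hχ1 (by omega)
      _ = χ1 := pow_one _
  have hχr1 : χ1 ^ r ≤ 1 := hχr.trans hχ1
  have hg1 : 1 ≤ 1 / (γ * χ1 ^ r) := by
    rw [le_div_iff₀ (by positivity), one_mul]
    exact mul_le_one₀ hγ1 (by positivity) hχr1
  have ha0 : 0 ≤ Real.log (1 / (γ * χ1 ^ r)) := Real.log_nonneg hg1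
  have hjlt : ∀ j, j < n - r → (j : ℝ) + 1 ≤ n := fun j hj => by
    have : j + 1 ≤ n := by omega
    exact_mod_cast this
  have hlast : zlev n r γ χ1 (n - r) = γ * (χ1 / n) ^ r := by simp [zlev]
  have hlow : ∀ j, j < n - r → zlev n r γ χ1 j = γ * (χ1 * (((n : ℝ) - j) / n)) := fun j hj => by
    simp [zlev, hj]
  have hlast' : 1 / zlev n r γ χ1 (n - r) = 1 / (γ * χ1 ^ r) * (n : ℝ) ^ r := by
    rw [hlast, div_pow]; field_simp
  have hlow' : ∀ j, j < n - r → 1 / zlev n r γ χ1 j ≤ 1 / (γ * χ1 ^ r) * ((n : ℝ) / ((n : ℝ) - j)) := by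
    intro j hj
    have hjn := hjlt j hj
    have hpos : (0 : ℝ) < (n : ℝ) - j := by linarith
    rw [hlow j hj]
    have : 1 / (γ * (χ1 * (((n : ℝ) - j) / n))) = 1 / (γ * χ1) * ((n : ℝ) / ((n : ℝ) - j)) := by
      field_simp
    rw [this]
    gcongr
  have hpos : ∀ j, j < n - r + 1 → 0 < zlev n r γ χ1 j ∧ zlev n r γ χ1 j ≤ 1 := by
    intro j hj
    by_cases h : j < n - r
    · have hjn := hjlt j h
      have hpos : (0 : ℝ) < (n : ℝ) - j := by linarith
      rw [hlow j h]
      refine ⟨by positivity, ?_⟩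
      apply mul_le_one₀ hγ1 (by positivity)
      apply mul_le_one₀ hχ1 (by positivity)
      rw [div_le_one hnr]
      have : (0 : ℝ) ≤ j := by positivity
      linarith
    · have : j = n - r := by omega
      rw [this, hlast]
      refine ⟨by positivity, ?_⟩
      apply mul_le_one₀ hγ1 (by positivity)
      apply pow_le_one₀ (by positivity)
      rw [div_le_one hnr]; linarith
  refine ⟨hpos, ?_, ?_⟩
  · rw [Finset.sum_range_succ]
    have h1 : ∑ j ∈ Finset.range (n - r), Real.log (1 / zlev n r γ χ1 j)
        ≤ ∑ j ∈ Finset.range (n - r), (Real.log (1 / (γ * χ1 ^ r)) + Real.log ((n : ℝ) / ((n : ℝ) - j))) := by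
      refine Finset.sum_le_sum fun j hj => ?_
      have hj := Finset.mem_range.mp hj
      have hjn := hjlt j hj
      have hp : (0 : ℝ) < (n : ℝ) - j := by linarith
      have hz := (hpos j (by omega)).1
      rw [← Real.log_mul (by positivity) (by positivity)]
      exact Real.log_le_log (by positivity) (hlow' j hj)
    rw [Finset.sum_add_distrib, Finset.sum_const, Finset.card_range, nsmul_eq_mul] at h1
    have h2 : ∑ j ∈ Finset.range (n - r), Real.log ((n : ℝ) / ((n : ℝ) - j)) ≤ n := by
      refine le_trans ?_ (aux_logsum n hn)
      apply Finset.sum_le_sum_of_subset_of_nonneg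
      · intro j hj
        have := Finset.mem_range.mp hj
        exact Finset.mem_range.mpr (by omega)
      · intro j hj _
        have hj : (j : ℝ) < n := by exact_mod_cast Finset.mem_range.mp hj
        apply Real.log_nonneg
        rw [le_div_iff₀ (by linarith)]
        have : (0 : ℝ) ≤ j := by positivity
        linarith
    have h3 : Real.log (1 / zlev n r γ χ1 (n - r)) ≤ Real.log (1 / (γ * χ1 ^ r)) + r * n := by
      rw [hlast', Real.log_mul (by positivity) (by positivity), Real.log_pow]
      gcongr
      have := Real.log_le_sub_one_of_pos hnr
      linarith
    have h4 : ((n - r : ℕ) : ℝ) + 1 ≤ n := by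
      have : n - r + 1 ≤ n := by omega
      exact_mod_cast this
    nlinarith
  · rw [Finset.sum_range_succ, hlast']
    have h1 : ∑ j ∈ Finset.range (n - r), 1 / zlev n r γ χ1 j
        ≤ ∑ j ∈ Finset.range (n - r), 1 / (γ * χ1 ^ r) * (n : ℝ) := by
      refine Finset.sum_le_sum fun j hj => ?_
      have hj := Finset.mem_range.mp hj
      have hjn := hjlt j hj
      refine le_trans (hlow' j hj) ?_
      gcongr
      apply div_le_self hnr.le
      linarith
    rw [Finset.sum_const, Finset.card_range, nsmul_eq_mul] at h1
    have h4 : ((n - r : ℕ) : ℝ) ≤ n := by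
      have : n - r ≤ n := by omega
      exact_mod_cast this
    have h5 : (n : ℝ) * n ≤ (n : ℝ) ^ r := by
      calc (n : ℝ) * n = (n : ℝ) ^ 2 := by ring
        _ ≤ _ := pow_le_pow_right₀ hn1 hr
    have h6 : ((n - r : ℕ) : ℝ) * (1 / (γ * χ1 ^ r) * (n : ℝ)) ≤ 1 / (γ * χ1 ^ r) * (n : ℝ) ^ r := by
      calc ((n - r : ℕ) : ℝ) * (1 / (γ * χ1 ^ r) * (n : ℝ)) ≤ (n : ℝ) * (1 / (γ * χ1 ^ r) * (n : ℝ)) := by gcongr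
        _ = 1 / (γ * χ1 ^ r) * ((n : ℝ) * n) := by ring
        _ ≤ _ := by gcongr
    linarith

lemma aux_G {n l r : ℕ} (hl : 0 < l) (hr : 2 ≤ r) (hrn : r ≤ n) (χ χ1 δ b γ : ℝ)
    (hχ0 : 0 < χ1) (hχ1 : χ1 ≤ χ) (hχ2 : χ1 ≤ 1) (hχn : χ ≤ n)
    (hδ0 : 0 < δ) (hδ1 : δ ≤ 1) (hb : b = (1 + δ) * Real.exp χ) (hγ : γ = δ / (4 * b))
    (hq : 1 ≤ (1 + δ / 8) * (Real.exp χ * (1 - χ / n) ^ n))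
    (sel : Popn n l → PMF (Fin l)) (mutOp : BitStr n → PMF (BitStr n))
    (hm : IsBitwiseMut (χ / n) mutOp)
    (h : (∃ k : ℕ, b ≤ (k : ℝ) ∧ IsTournamentSel (plateauF n r) k sel) ∨
         (∃ μ : ℕ, 0 < μ ∧ b ≤ (l : ℝ) / (μ : ℝ) ∧ IsMuCommaSel (plateauF n r) μ sel))
    (P : Popn n l) :
    (∀ j < n - r + 1, γ * l ≤ ((Finset.univ.filter fun i => j ≤ plevel n r (P i)).card : ℝ) →
      zlev n r γ χ1 j ≤ ∑ a ∈ Finset.univ.filter (fun a => j + 1 ≤ plevel n r a),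
        (((sel P).bind fun i => mutOp (P i)) a).toReal) ∧
    (∀ j, (1 + δ / 4) * min (((Finset.univ.filter fun i => j ≤ plevel n r (P i)).card : ℝ) / l) γ
      ≤ ∑ a ∈ Finset.univ.filter (fun a => j ≤ plevel n r a),
        (((sel P).bind fun i => mutOp (P i)) a).toReal) := by
  classical
  have hn : 0 < n := by omega
  have hnr : (0 : ℝ) < n := by exact_mod_cast hn
  have hlr : (0 : ℝ) < l := by exact_mod_cast hl
  have hE := Real.exp_pos χ
  set E := Real.exp χ with hEdef
  have hb0 : 0 < b := by rw [hb]; positivity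
  have hγ0 : 0 < γ := by rw [hγ]; positivity
  set q := (1 - χ / n) ^ n with hqdef
  have hq0 : 0 ≤ q := by
    apply pow_nonneg
    have : χ / n ≤ 1 := by rw [div_le_one hnr]; exact hχn
    linarith
  have hEq : 1 + δ / 4 ≤ (1 + δ / 2) * E * q := by
    have h1 : (1 + δ / 4) * (1 + δ / 8) ≤ 1 + δ / 2 := by nlinarith
    have h2 : 0 ≤ E * q := by positivity
    calc 1 + δ / 4 ≤ (1 + δ / 4) * ((1 + δ / 8) * (E * q)) := by
          apply le_mul_of_one_le_right (by positivity) hq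
      _ = ((1 + δ / 4) * (1 + δ / 8)) * (E * q) := by ring
      _ ≤ (1 + δ / 2) * (E * q) := by gcongr
      _ = _ := by ring
  have hself : ∀ x : BitStr n, q ≤ (mutOp x x).toReal := by
    intro x
    have := aux_mut_lb hn χ χ1 hχ0 hχ1 hχ2 hχn mutOp hm x x 0 (by simp)
    simpa using this
  have hsing : ∀ (x y : BitStr n) (T : Finset (BitStr n)), y ∈ T →
      (mutOp x y).toReal ≤ ∑ a ∈ T, (mutOp x a).toReal := by
    intro x y T hy
    exact Finset.single_le_sum (f := fun a => (mutOp x a).toReal)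
      (fun _ _ => ENNReal.toReal_nonneg) hy
  have hsel := aux_sel hl (by omega : 1 ≤ r) hrn E δ b hE hδ0 hδ1 hb sel h P
  rw [← hγ] at hsel
  constructor
  · intro j hj hX
    have hs := hsel j
    rw [min_eq_right (by rw [le_div_iff₀ hlr]; exact hX)] at hs
    have key : ∀ st : ℝ, 0 ≤ st → (∀ i ∈ Finset.univ.filter (fun i => j ≤ plevel n r (P i)),
        q * st ≤ ∑ a ∈ Finset.univ.filter (fun a => j + 1 ≤ plevel n r a), (mutOp (P i) a).toReal) →
        γ * st ≤ ∑ a ∈ Finset.univ.filter (fun a => j + 1 ≤ plevel n r a),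
        (((sel P).bind fun i => mutOp (P i)) a).toReal := by
      intro st hst hall
      refine le_trans ?_ (aux_bind (sel P) mutOp P _ _ _ hall)
      have h0 : 0 ≤ q * st := by positivity
      refine le_trans ?_ (mul_le_mul_of_nonneg_right hs h0)
      have : 0 ≤ γ * st := by positivity
      calc γ * st ≤ ((1 + δ / 2) * E * q) * (γ * st) := by
            apply le_mul_of_one_le_left this; linarith
        _ = _ := by ring
    unfold zlev
    split_ifs with hjlt
    · have hjn : (j : ℝ) < n := by
        have : j < n := by omega
        exact_mod_cast this
      have hj0 : (0 : ℝ) ≤ j := by positivity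
      have hfrac : 0 ≤ ((n : ℝ) - j) / n := div_nonneg (by linarith) hnr.le
      apply key _ (by positivity)
      intro i hi
      simp only [Finset.mem_filter, Finset.mem_univ, true_and] at hi
      by_cases hup : j + 1 ≤ plevel n r (P i)
      · have h1 := hsing (P i) (P i) (Finset.univ.filter (fun a => j + 1 ≤ plevel n r a)) (by simpa using hup)
        have h2 := hself (P i)
        have h3 : q * (χ1 * (((n : ℝ) - j) / n)) ≤ q := by
          apply mul_le_of_le_one_right hq0
          apply mul_le_one₀ hχ2 hfrac
          rw [div_le_one hnr]; linarith
        linarith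
      · have hones : ones (P i) = j := by
          have : plevel n r (P i) = j := by omega
          unfold plevel at this
          split_ifs at this <;> omega
        have h1 := aux_mut_one hn χ χ1 hχ0 hχ1 hχ2 hχn mutOp hm (P i)
          (Finset.univ.filter (fun a => j + 1 ≤ plevel n r a)) (by
            intro y hy
            simp only [Finset.mem_filter, Finset.mem_univ, true_and]
            apply plevel_ge_ones y (j + 1) (by omega)
            omega)
        rw [hones] at h1
        refine le_trans (le_of_eq ?_) h1
        rw [← hqdef]
        ring
    · have hje : j = n - r := by omega
      apply key _ (by positivity)
      intro i hi
      simp only [Finset.mem_filter, Finset.mem_univ, true_and] at hi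
      have hones : j ≤ ones (P i) := ones_ge_plevel (P i) j hje.le hi
      have h1 := aux_mut_lb hn χ χ1 hχ0 hχ1 hχ2 hχn mutOp hm (P i) (allOnesStr n) r (by
        rw [aux_ham_opt]; omega)
      have h2 := hsing (P i) (allOnesStr n) (Finset.univ.filter (fun a => j + 1 ≤ plevel n r a)) (by
        simp only [Finset.mem_filter, Finset.mem_univ, true_and]
        rw [plevel_allOnes (by omega) hrn]; omega)
      rw [← hqdef] at h1
      linarith
  · intro j
    have hs := hsel j
    have h1 := aux_bind (sel P) mutOp P (Finset.univ.filter (fun i => j ≤ plevel n r (P i)))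
      (Finset.univ.filter (fun a => j ≤ plevel n r a)) q (by
        intro i hi
        refine le_trans (hself (P i)) (hsing (P i) (P i) _ ?_)
        simpa using hi)
    refine le_trans ?_ h1
    refine le_trans ?_ (mul_le_mul_of_nonneg_right hs hq0)
    have h2 : 0 ≤ min (((Finset.univ.filter fun i => j ≤ plevel n r (P i)).card : ℝ) / l) γ :=
      le_min (by positivity) hγ0.le
    have := mul_le_mul_of_nonneg_right hEq h2
    linarith

lemma aux_pow_two (z : ℝ) (hz : 0 < z) (hz1 : z ≤ 1) (I : ℕ) (h3 : 2 * Real.log (1 / z) ≤ I) :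
    1 ≤ z * 2 ^ I := by
  have h1 : 1 / z ≤ 2 ^ I := by
    have h2 : (2 : ℝ) ^ I = Real.exp (I * Real.log 2) := by
      rw [← Real.exp_log (show (0 : ℝ) < 2 ^ I by positivity), Real.log_pow]
    rw [h2, ← Real.exp_log (show 0 < 1 / z by positivity)]
    apply Real.exp_le_exp.mpr
    have h4 : (1 : ℝ) / 2 ≤ Real.log 2 := by linarith [Real.log_two_gt_d9]
    have h5 : (I : ℝ) * (1 / 2) ≤ I * Real.log 2 := mul_le_mul_of_nonneg_left h4 (by positivity)
    linarith
  rw [div_le_iff₀ hz] at h1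
  linarith

set_option maxHeartbeats 2000000

/-- Runtime of the non-elitist EA on `Plateau_r` with bitwise
mutation rate `χ/n` and `k`-tournament (`k ≥ (1+δ)e^χ`) or `(μ,λ)`-selection
(`λ/μ ≥ (1+δ)e^χ`) and population size `λ ≥ c ln n`:
`E[T] ≤ C (n^r + n λ)`. -/
theorem plateau_runtime_bitwise
    (r : ℕ) (hr : 2 ≤ r) (χ δ : ℝ) (hχ : 0 < χ) (hδ0 : 0 < δ) (hδ1 : δ ≤ 1) :
    ∃ c C : ℝ, 0 < c ∧ 0 < C ∧ ∃ n₀ : ℕ, ∀ n : ℕ, n₀ ≤ n →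
      ∀ l : ℕ, ∀ sel : Popn n l → PMF (Fin l), ∀ mutOp : BitStr n → PMF (BitStr n),
        IsBitwiseMut (χ / n) mutOp →
        ((∃ k : ℕ, (1 + δ) * Real.exp χ ≤ (k : ℝ) ∧ IsTournamentSel (plateauF n r) k sel) ∨
         (∃ μ : ℕ, 0 < μ ∧ (1 + δ) * Real.exp χ ≤ (l : ℝ) / (μ : ℝ) ∧
            IsMuCommaSel (plateauF n r) μ sel)) →
        c * Real.log n ≤ (l : ℝ) →
        (l : ℝ≥0∞) * expHitTime (PMF.uniformOfFintype (Popn n l)) (eaStep sel mutOp) (optSet n l)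
          ≤ ENNReal.ofReal (C * ((n : ℝ) ^ r + (n : ℝ) * (l : ℝ))) := by
  classical
  set χ1 := min 1 χ with hχ1def
  have hχ0 : 0 < χ1 := lt_min one_pos hχ
  have hχ1 : χ1 ≤ χ := min_le_right _ _
  have hχ2 : χ1 ≤ 1 := min_le_left _ _
  set b := (1 + δ) * Real.exp χ with hb
  have hE1 : 1 ≤ Real.exp χ := Real.one_le_exp hχ.le
  have hb1 : 1 ≤ b := by nlinarith
  set γ := δ / (4 * b) with hγ
  have hγ0 : 0 < γ := by positivity
  have hγ1 : γ ≤ 1 := by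
    rw [hγ, div_le_one (by positivity)]; linarith
  set ε := δ / 4 with hε
  have hε0 : 0 < ε := by positivity
  have hε1 : ε ≤ 1 := by linarith
  set c0 := Real.exp (-(2 * (ε / 4))) * (1 - Real.exp (-(ε * (ε / 4) / 4))) with hc0
  have hc0pos : 0 < c0 := by
    apply mul_pos (Real.exp_pos _)
    have h1 : 0 < ε * (ε / 4) / 4 := by positivity
    exact lt_of_lt_of_le (by positivity) (aux_exp_low _ h1.le)
  set A := 2 / c0 with hA
  have hA0 : 0 < A := by positivity
  have hAc : 2 ≤ A * c0 := by rw [hA]; field_simp; exact le_rfl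
  set g := 1 / (γ * χ1 ^ r) with hg
  have hg0 : 0 < g := by positivity
  have hg1 : 1 ≤ g := by
    rw [hg, le_div_iff₀ (by positivity), one_mul]
    exact mul_le_one₀ hγ1 (by positivity) (pow_le_one₀ hχ0.le hχ2)
  set CI := 2 * (Real.log g + 1 + r) + 2 with hCI
  have hCI0 : 0 < CI := by
    have : 0 ≤ Real.log g := Real.log_nonneg hg1
    positivity
  set CB := 8 / (ε / 4) * (2 * g) with hCB
  have hCB0 : 0 < CB := by positivity
  set C := A * CI + CB with hC
  have hC0 : 0 < C := by positivity
  set τ := ε / 2 * ((ε / 4) * γ) with hτ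
  have hτ0 : 0 < τ := by positivity
  have hlim : ∀ᶠ n : ℕ in Filter.atTop, 1 ≤ (1 + δ / 8) * (Real.exp χ * (1 - χ / n) ^ n) := by
    have h1 := Real.tendsto_one_add_div_pow_exp (-χ)
    have h2 := (h1.const_mul (Real.exp χ)).const_mul (1 + δ / 8)
    have h3 : 1 < (1 + δ / 8) * (Real.exp χ * Real.exp (-χ)) := by
      rw [← Real.exp_add]; simp; positivity
    filter_upwards [h2.eventually (lt_mem_nhds h3)] with n hn
    have : (1 : ℝ) + -χ / n = 1 - χ / n := by ring
    rw [this] at hn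
    exact hn.le
  obtain ⟨n1, hn1⟩ := Filter.eventually_atTop.mp hlim
  refine ⟨(r + 1) / τ, C, by positivity, hC0, max n1 (max r (max ⌈χ⌉₊ ⌈C⌉₊)), ?_⟩
  intro n hn l sel mutOp hmut hsel hlog
  have hnn1 : n1 ≤ n := le_trans (le_max_left _ _) hn
  have hn' := le_trans (le_max_right _ _) hn
  have hrn : r ≤ n := le_trans (le_max_left _ _) hn'
  have hn'' := le_trans (le_max_right _ _) hn'
  have hχn : χ ≤ n := Nat.ceil_le.mp (le_trans (le_max_left _ _) hn'')
  have hCn : C ≤ n := Nat.ceil_le.mp (le_trans (le_max_right _ _) hn'')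
  have hnpos : 0 < n := by omega
  have hnr : (0 : ℝ) < n := by exact_mod_cast hnpos
  have hn1r : (1 : ℝ) ≤ n := by exact_mod_cast hnpos
  have hlogpos : 0 < Real.log n := Real.log_pos (by
    have : 1 < n := by omega
    exact_mod_cast this)
  have hlr : (0 : ℝ) < l := lt_of_lt_of_le (by positivity) hlog
  have hl : 0 < l := by exact_mod_cast hlr
  have hl1 : (1 : ℝ) ≤ l := by exact_mod_cast hl
  obtain ⟨hz, hzlog, hzinv⟩ := aux_z hr hrn γ χ1 hγ0 hγ1 hχ0 hχ2
  set z := zlev n r γ χ1 with hzdef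
  set I : ℕ → ℕ := fun j => ⌈2 * Real.log (1 / z j)⌉₊ + 1 with hI
  have hlogz : ∀ j < n - r + 1, 0 ≤ Real.log (1 / z j) := by
    intro j hj
    apply Real.log_nonneg
    rw [le_div_iff₀ (hz j hj).1]; linarith [(hz j hj).2]
  set M := ∑ j ∈ Finset.range (n - r + 1), (A * I j + 8 / ((ε / 4) * (l * z j))) with hM
  have hsumI : ∑ j ∈ Finset.range (n - r + 1), (I j : ℝ) ≤ CI * n := by
    have h1 : ∑ j ∈ Finset.range (n - r + 1), (I j : ℝ)
        ≤ ∑ j ∈ Finset.range (n - r + 1), (2 * Real.log (1 / z j) + 2) := by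
      refine Finset.sum_le_sum fun j hj => ?_
      have h2 := hlogz j (Finset.mem_range.mp hj)
      have h3 := (Nat.ceil_lt_add_one (by linarith : 0 ≤ 2 * Real.log (1 / z j))).le
      simp only [hI]
      push_cast
      linarith
    rw [Finset.sum_add_distrib, ← Finset.mul_sum, Finset.sum_const, Finset.card_range,
      nsmul_eq_mul] at h1
    have h4 : ((n - r + 1 : ℕ) : ℝ) ≤ n := by
      have : n - r + 1 ≤ n := by omega
      exact_mod_cast this
    rw [hCI]
    linarith
  have hlM : l * M ≤ C * ((n : ℝ) ^ r + n * l) := by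
    have h1 : l * M = A * l * ∑ j ∈ Finset.range (n - r + 1), (I j : ℝ)
        + 8 / (ε / 4) * ∑ j ∈ Finset.range (n - r + 1), 1 / z j := by
      rw [hM, Finset.mul_sum, Finset.mul_sum, Finset.mul_sum, ← Finset.sum_add_distrib]
      refine Finset.sum_congr rfl fun j hj => ?_
      have := (hz j (Finset.mem_range.mp hj)).1
      field_simp
    rw [h1]
    calc _ ≤ A * l * (CI * n) + 8 / (ε / 4) * (2 * g * (n : ℝ) ^ r) := by gcongr
      _ = (A * CI) * (n * l) + CB * (n : ℝ) ^ r := by rw [hCB]; ring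
      _ ≤ C * (n * l) + C * (n : ℝ) ^ r := by
          have : A * CI ≤ C := by linarith
          have : CB ≤ C := by
            have : 0 < A * CI := by positivity
            linarith
          gcongr
      _ = _ := by ring
  have hM2 : M ≤ C * (n : ℝ) ^ r := by
    have hnpow : (n : ℝ) ≤ (n : ℝ) ^ r := le_self_pow₀ hn1r (by omega)
    have h1 : M ≤ A * ∑ j ∈ Finset.range (n - r + 1), (I j : ℝ)
        + 8 / (ε / 4) * ∑ j ∈ Finset.range (n - r + 1), 1 / z j := by
      rw [hM, Finset.mul_sum, Finset.mul_sum, ← Finset.sum_add_distrib]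
      refine Finset.sum_le_sum fun j hj => ?_
      have hzj := (hz j (Finset.mem_range.mp hj)).1
      have : 8 / ((ε / 4) * (l * z j)) ≤ 8 / (ε / 4) * (1 / z j) := by
        rw [div_mul_div_comm, mul_one]
        apply div_le_div_of_nonneg_left (by norm_num) (by positivity)
        gcongr
        exact le_mul_of_one_le_left hzj.le hl1
      linarith
    calc M ≤ A * (CI * n) + 8 / (ε / 4) * (2 * g * (n : ℝ) ^ r) := by
          refine le_trans h1 ?_
          gcongr
      _ ≤ A * (CI * (n : ℝ) ^ r) + 8 / (ε / 4) * (2 * g * (n : ℝ) ^ r) := by gcongr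
      _ = _ := by rw [hC, hCB]; ring
  have hfail : M * Real.exp (-(ε / 2 * ((ε / 4) * (γ * l)))) ≤ 1 := by
    have h1 : Real.exp (-(ε / 2 * ((ε / 4) * (γ * l)))) ≤ ((n : ℝ) ^ (r + 1))⁻¹ := by
      have h2 : (n : ℝ) ^ (r + 1) = Real.exp ((r + 1) * Real.log n) := by
        rw [← Real.exp_log (show 0 < (n : ℝ) ^ (r + 1) by positivity), Real.log_pow]
        push_cast; rfl
      rw [h2, ← Real.exp_neg]
      apply Real.exp_le_exp.mpr
      apply neg_le_neg
      have h3 := mul_le_mul_of_nonneg_left hlog hτ0.le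
      calc (r + 1) * Real.log n = τ * ((r + 1) / τ * Real.log n) := by field_simp
        _ ≤ τ * l := h3
        _ = _ := by rw [hτ]; ring
    calc _ ≤ (C * (n : ℝ) ^ r) * ((n : ℝ) ^ (r + 1))⁻¹ := by
          apply mul_le_mul hM2 h1 (Real.exp_pos _).le (by positivity)
      _ = C / n := by rw [pow_succ]; field_simp
      _ ≤ 1 := by rw [div_le_one hnr]; exact hCn
  have hGG := fun P => aux_G hl hr hrn χ χ1 δ b γ hχ0 hχ1 hχ2 hχn hδ0 hδ1 hb hγ (hn1 n hnn1)
    sel mutOp hmut hsel P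
  have hmain := aux_level_based (m := n - r + 1) hl (by omega) (plevel n r)
    (fun P => (sel P).bind fun i => mutOp (P i)) (PMF.uniformOfFintype (Popn n l)) (optSet n l)
    (by
      rintro P ⟨i, hi⟩
      exact ⟨i, plevel_opt (by omega) hrn (P i) hi⟩)
    ε γ A z I hε0 hε1 hγ0 hγ1 hA0.le hAc (fun j hj => (hz j hj).1)
    (fun j _ => by simp only [hI]; omega)
    (fun j hj => by
      have hzj := (hz j hj).1
      apply aux_pow_two (z j) (hz j hj).1 (hz j hj).2
      simp only [hI]
      push_cast
      linarith [Nat.le_ceil (2 * Real.log (1 / z j))])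
    (fun P j hj hX => (hGG P).1 j hj hX)
    (fun P j _ => (hGG P).2 j)
    M hM hfail
  have hmain' : expHitTime (PMF.uniformOfFintype (Popn n l)) (eaStep sel mutOp) (optSet n l)
      ≤ ENNReal.ofReal M := hmain
  calc (l : ℝ≥0∞) * expHitTime (PMF.uniformOfFintype (Popn n l)) (eaStep sel mutOp) (optSet n l)
      ≤ (l : ℝ≥0∞) * ENNReal.ofReal M := by gcongr
    _ = ENNReal.ofReal (l * M) := by
        rw [ENNReal.ofReal_mul hlr.le, ENNReal.ofReal_natCast]
    _ ≤ _ := ENNReal.ofReal_le_ofReal hlM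
end

section
/- Fix an integer constant r ≥ 2 and constants c ∈ (0,1) and K > 0. There exist constants c' > 0, C > 0 and n₀ ∈ ℕ such that for all n ≥ n₀ the following holds: the non-elitist EA maximizing Plateau_r on {0,1}^n, using fitness-proportionate selection, bitwise mutation with mutation probability (1−c)/n², and population size λ satisfying c'·n²·ln n ≤ λ ≤ n^K, has expected runtime E[T] ≤ C·(λ·n²·ln n + n^{2r+1}). -/
open scoped ENNReal

/-! ### Expectations with respect to finite PMFs -/

/-- Real-valued expectation for a PMF on a finite type. -/
noncomputable def pexp {α : Type*} [Fintype α] (p : PMF α) (h : α → ℝ) : ℝ :=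
  ∑ a, (p a).toReal * h a

lemma pmf_sum_toReal {α : Type*} [Fintype α] (p : PMF α) : ∑ a, (p a).toReal = 1 := by
  have h : ∑ a, p a = 1 := by simpa [tsum_fintype] using p.tsum_coe
  rw [← ENNReal.toReal_sum (fun a _ => p.apply_ne_top a), h]
  simp

lemma pexp_const {α : Type*} [Fintype α] (p : PMF α) (k : ℝ) : pexp p (fun _ => k) = k := by
  unfold pexp
  rw [← Finset.sum_mul, pmf_sum_toReal, one_mul]

lemma pexp_mono {α : Type*} [Fintype α] (p : PMF α) {g h : α → ℝ} (H : ∀ a, g a ≤ h a) :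
    pexp p g ≤ pexp p h :=
  Finset.sum_le_sum fun a _ => mul_le_mul_of_nonneg_left (H a) ENNReal.toReal_nonneg

lemma pexp_nonneg {α : Type*} [Fintype α] (p : PMF α) {h : α → ℝ} (H : ∀ a, 0 ≤ h a) :
    0 ≤ pexp p h :=
  Finset.sum_nonneg fun a _ => mul_nonneg ENNReal.toReal_nonneg (H a)

lemma pexp_add {α : Type*} [Fintype α] (p : PMF α) (g h : α → ℝ) :
    pexp p (fun a => g a + h a) = pexp p g + pexp p h := by
  unfold pexp
  rw [← Finset.sum_add_distrib]
  exact Finset.sum_congr rfl fun a _ => by ring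

lemma pexp_mul_left {α : Type*} [Fintype α] (p : PMF α) (k : ℝ) (h : α → ℝ) :
    pexp p (fun a => k * h a) = k * pexp p h := by
  unfold pexp
  rw [Finset.mul_sum]
  exact Finset.sum_congr rfl fun a _ => by ring

lemma pexp_bind {α β : Type*} [Fintype α] [Fintype β] (p : PMF α) (k : α → PMF β) (h : β → ℝ) :
    pexp (p.bind k) h = pexp p (fun a => pexp (k a) h) := by
  unfold pexp
  have : ∀ b, ((p.bind k) b).toReal = ∑ a, (p a).toReal * (k a b).toReal := by
    intro b
    rw [PMF.bind_apply, tsum_fintype, ENNReal.toReal_sum]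
    · simp
    · intro a _
      exact ENNReal.mul_ne_top (p.apply_ne_top a) ((k a).apply_ne_top b)
  simp only [this, Finset.sum_mul, Finset.mul_sum]
  rw [Finset.sum_comm]
  exact Finset.sum_congr rfl fun a _ => Finset.sum_congr rfl fun b _ => by ring

lemma pexp_prod {ι α : Type*} [Fintype ι] [DecidableEq ι] [Fintype α]
    (p : ι → PMF α) (h : ι → α → ℝ) :
    pexp (prodPMF p) (fun g => ∏ i, h i (g i)) = ∏ i, pexp (p i) (h i) := by
  unfold pexp
  rw [Finset.prod_univ_sum, Fintype.piFinset_univ]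
  refine Finset.sum_congr rfl fun g _ => ?_
  simp only [prodPMF, PMF.ofFintype_apply, ENNReal.toReal_prod]
  rw [Finset.prod_mul_distrib]

lemma ofReal_pexp {α : Type*} [Fintype α] (p : PMF α) {h : α → ℝ} (H : ∀ a, 0 ≤ h a) :
    ENNReal.ofReal (pexp p h) = ∑ a, p a * ENNReal.ofReal (h a) := by
  unfold pexp
  rw [ENNReal.ofReal_sum_of_nonneg (fun a _ => mul_nonneg ENNReal.toReal_nonneg (H a))]
  refine Finset.sum_congr rfl fun a _ => ?_
  rw [ENNReal.ofReal_mul ENNReal.toReal_nonneg, ENNReal.ofReal_toReal (p.apply_ne_top a)]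

/-! ### Backward survival probabilities -/

open Classical in
/-- Probability of avoiding `G` at times `0,…,t` when starting in `P`. -/
noncomputable def bsurv {n l : ℕ} (step : Popn n l → PMF (Popn n l)) (G : Set (Popn n l)) :
    ℕ → Popn n l → ℝ
  | 0 => fun P => if P ∈ G then 0 else 1
  | (t + 1) => fun P => if P ∈ G then 0 else pexp (step P) (bsurv step G t)

lemma bsurv_mem {n l : ℕ} (step : Popn n l → PMF (Popn n l)) (G : Set (Popn n l)) (t : ℕ)
    {P : Popn n l} (h : P ∈ G) : bsurv step G t P = 0 := by
  cases t <;> simp [bsurv, h]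

lemma bsurv_nonneg {n l : ℕ} (step : Popn n l → PMF (Popn n l)) (G : Set (Popn n l)) (t : ℕ)
    (P : Popn n l) : 0 ≤ bsurv step G t P := by
  induction t generalizing P with
  | zero => simp only [bsurv]; split_ifs <;> norm_num
  | succ t ih =>
    simp only [bsurv]; split_ifs
    · exact le_rfl
    · exact pexp_nonneg _ ih

lemma bsurv_le_one {n l : ℕ} (step : Popn n l → PMF (Popn n l)) (G : Set (Popn n l)) (t : ℕ)
    (P : Popn n l) : bsurv step G t P ≤ 1 := by
  induction t generalizing P with
  | zero => simp only [bsurv]; split_ifs <;> norm_num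
  | succ t ih =>
    simp only [bsurv]; split_ifs
    · norm_num
    · exact (pexp_mono _ ih).trans (pexp_const _ 1).le

lemma bsurv_succ_le {n l : ℕ} (step : Popn n l → PMF (Popn n l)) (G : Set (Popn n l)) (t : ℕ)
    (P : Popn n l) : bsurv step G (t + 1) P ≤ pexp (step P) (bsurv step G t) := by
  simp only [bsurv]; split_ifs
  · exact pexp_nonneg _ (bsurv_nonneg step G t)
  · exact le_rfl

lemma bsurv_anti_succ {n l : ℕ} (step : Popn n l → PMF (Popn n l)) (G : Set (Popn n l)) (t : ℕ)
    (P : Popn n l) : bsurv step G (t + 1) P ≤ bsurv step G t P := by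
  induction t generalizing P with
  | zero =>
    by_cases h : P ∈ G
    · simp [bsurv_mem, h]
    · have h0 : bsurv step G 0 P = 1 := by simp [bsurv, h]
      rw [h0]; exact bsurv_le_one _ _ _ _
  | succ t ih =>
    by_cases h : P ∈ G
    · simp [bsurv_mem, h]
    · have e1 : bsurv step G (t + 1 + 1) P = pexp (step P) (bsurv step G (t + 1)) := by
        rw [bsurv]; simp [h]
      have e2 : bsurv step G (t + 1) P = pexp (step P) (bsurv step G t) := by
        rw [bsurv]; simp [h]
      rw [e1, e2]
      exact pexp_mono _ ih

lemma bsurv_anti {n l : ℕ} (step : Popn n l → PMF (Popn n l)) (G : Set (Popn n l))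
    (P : Popn n l) : Antitone fun t => bsurv step G t P :=
  antitone_nat_of_succ_le fun t => bsurv_anti_succ step G t P

lemma notYet_mem {n l : ℕ} (init : PMF (Popn n l)) (step : Popn n l → PMF (Popn n l))
    (G : Set (Popn n l)) (t : ℕ) {P : Popn n l} (h : P ∈ G) : notYet init step G t P = 0 := by
  cases t <;> simp [notYet, h]

lemma survProb_add {n l : ℕ} (init : PMF (Popn n l)) (step : Popn n l → PMF (Popn n l))
    (G : Set (Popn n l)) (s t : ℕ) :
    survProb init step G (s + t)
      = ∑ P, notYet init step G s P * ENNReal.ofReal (bsurv step G t P) := by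
  induction t generalizing s with
  | zero =>
    unfold survProb
    refine Finset.sum_congr rfl fun P _ => ?_
    by_cases h : P ∈ G
    · simp [notYet_mem, h]
    · simp [bsurv, h]
  | succ t ih =>
    have e : s + (t + 1) = (s + 1) + t := by ring
    rw [e, ih]
    have h1 : ∀ Q, notYet init step G (s + 1) Q * ENNReal.ofReal (bsurv step G t Q)
        = ∑ P, notYet init step G s P * step P Q * ENNReal.ofReal (bsurv step G t Q) := by
      intro Q
      by_cases h : Q ∈ G
      · simp [bsurv_mem, h]
      · rw [notYet, Set.indicator_of_mem (by simpa using h), Finset.sum_mul]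
    have h2 : ∀ P, notYet init step G s P * ENNReal.ofReal (bsurv step G (t + 1) P)
        = ∑ Q, notYet init step G s P * step P Q * ENNReal.ofReal (bsurv step G t Q) := by
      intro P
      by_cases h : P ∈ G
      · simp [notYet_mem, h]
      · have e2 : bsurv step G (t + 1) P = pexp (step P) (bsurv step G t) := by
          rw [bsurv]; simp [h]
        rw [e2, ofReal_pexp _ (bsurv_nonneg step G t), Finset.mul_sum]
        exact Finset.sum_congr rfl fun Q _ => by ring
    simp only [h1, h2]
    rw [Finset.sum_comm]

lemma survProb_le_one {n l : ℕ} (init : PMF (Popn n l)) (step : Popn n l → PMF (Popn n l))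
    (G : Set (Popn n l)) (t : ℕ) : survProb init step G t ≤ 1 := by
  have h := survProb_add init step G 0 t
  rw [zero_add] at h
  rw [h]
  calc ∑ P, notYet init step G 0 P * ENNReal.ofReal (bsurv step G t P)
      ≤ ∑ P, init P := by
        refine Finset.sum_le_sum fun P _ => ?_
        calc notYet init step G 0 P * ENNReal.ofReal (bsurv step G t P)
            ≤ init P * 1 := by
              refine mul_le_mul' ?_ ?_
              · rw [notYet]; exact Set.indicator_le_self _ _ _
              · exact ENNReal.ofReal_le_one.2 (bsurv_le_one _ _ _ _)
          _ = init P := mul_one _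
    _ = 1 := by simpa [tsum_fintype] using init.tsum_coe

lemma expHitTime_le {n l : ℕ} (init : PMF (Popn n l)) (step : Popn n l → PMF (Popn n l))
    (G : Set (Popn n l)) (T : ℕ) (hT : ∀ P, bsurv step G T P ≤ 1 / 2) :
    expHitTime init step G ≤ 2 * T := by
  unfold expHitTime
  refine ENNReal.tsum_le_of_sum_range_le fun N => ?_
  have hhalf : ∀ s, survProb init step G (T + s) ≤ (1 / 2) * survProb init step G s := by
    intro s
    rw [add_comm, survProb_add]
    unfold survProb
    rw [Finset.mul_sum]
    refine Finset.sum_le_sum fun P _ => ?_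
    rw [mul_comm]
    refine mul_le_mul' ?_ le_rfl
    calc ENNReal.ofReal (bsurv step G T P) ≤ ENNReal.ofReal (1 / 2) :=
          ENNReal.ofReal_le_ofReal (hT P)
      _ = 1 / 2 := by
          rw [ENNReal.ofReal_div_of_pos (by norm_num)]; simp
  set A := ∑ t ∈ Finset.range N, survProb init step G t with hA
  have hAfin : A ≠ ⊤ := by
    have : A ≤ N := by
      calc A ≤ ∑ t ∈ Finset.range N, (1 : ℝ≥0∞) :=
            Finset.sum_le_sum fun t _ => survProb_le_one _ _ _ _
        _ = N := by simp
    exact ne_top_of_le_ne_top (by simp) this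
  have key : A ≤ T + (1 / 2) * A := by
    calc A ≤ ∑ t ∈ Finset.range (T + N), survProb init step G t :=
          Finset.sum_le_sum_of_subset (Finset.range_subset_range.2 (by omega))
      _ = ∑ t ∈ Finset.range T, survProb init step G t
          + ∑ t ∈ Finset.range N, survProb init step G (T + t) := Finset.sum_range_add _ _ _
      _ ≤ T + (1 / 2) * A := by
          refine add_le_add ?_ ?_
          · calc ∑ t ∈ Finset.range T, survProb init step G t
                ≤ ∑ t ∈ Finset.range T, (1 : ℝ≥0∞) :=
                  Finset.sum_le_sum fun t _ => survProb_le_one _ _ _ _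
              _ = T := by simp
          · rw [hA, Finset.mul_sum]
            exact Finset.sum_le_sum fun t _ => hhalf t
  clear_value A
  lift A to NNReal using hAfin
  have k2 : (A : ℝ) ≤ T + (1 / 2) * A := by
    have : A ≤ (T : NNReal) + (1 / 2) * A := by
      have e : ((1 / 2 : NNReal) : ℝ≥0∞) = 1 / 2 := by
        rw [ENNReal.coe_div (by norm_num)]; simp
      rw [← ENNReal.coe_le_coe]
      push_cast [e]
      simpa using key
    exact_mod_cast this
  have k3 : (A : ℝ) ≤ 2 * T := by linarith
  have k4 : A ≤ 2 * (T : NNReal) := by exact_mod_cast k3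
  calc (A : ℝ≥0∞) ≤ ((2 * (T : NNReal) : NNReal) : ℝ≥0∞) := ENNReal.coe_le_coe.2 k4
    _ = 2 * T := by push_cast; rfl

/-! ### Level counts and Laplace transforms -/

/-- Number of individuals with at least `j` one-bits. -/
def cnt {n l : ℕ} (j : ℕ) (P : Popn n l) : ℕ :=
  (Finset.univ.filter fun i => j ≤ ones (P i)).card

/-- Indicator of having at least `j` one-bits. -/
noncomputable def ind {n : ℕ} (j : ℕ) (x : BitStr n) : ℝ := if j ≤ ones x then 1 else 0

/-- Offspring distribution. -/
noncomputable def offs {n l : ℕ} (sel : Popn n l → PMF (Fin l))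
    (mutOp : BitStr n → PMF (BitStr n)) (P : Popn n l) : PMF (BitStr n) :=
  (sel P).bind fun i => mutOp (P i)

lemma ind_nonneg {n : ℕ} (j : ℕ) (x : BitStr n) : 0 ≤ ind j x := by
  unfold ind; split_ifs <;> norm_num

lemma ind_le_one {n : ℕ} (j : ℕ) (x : BitStr n) : ind j x ≤ 1 := by
  unfold ind; split_ifs <;> norm_num

lemma cnt_eq_sum {n l : ℕ} (j : ℕ) (P : Popn n l) : (cnt j P : ℝ) = ∑ i, ind j (P i) := by
  unfold cnt ind
  rw [Finset.sum_ite]; simp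

/-- Exponential moment of a product functional of the next population. -/
lemma step_prod_le {n l : ℕ} (sel : Popn n l → PMF (Fin l))
    (mutOp : BitStr n → PMF (BitStr n)) (P : Popn n l) (g : BitStr n → ℝ) (k q : ℝ)
    (hk : 0 ≤ k) (hk1 : k ≤ 1) (hg0 : ∀ x, 0 ≤ g x) (hg1 : ∀ x, g x ≤ 1)
    (hq : q ≤ pexp (offs sel mutOp P) g) :
    pexp (eaStep sel mutOp P) (fun Q => ∏ i, (1 - k * g (Q i))) ≤ Real.exp (-(l * q * k)) := by
  have e := pexp_prod (fun _ : Fin l => offs sel mutOp P) (fun _ x => 1 - k * g x)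
  have e1 : pexp (offs sel mutOp P) (fun x => 1 - k * g x)
      = 1 - k * pexp (offs sel mutOp P) g := by
    have := pexp_add (offs sel mutOp P) (fun _ => 1) (fun x => (-k) * g x)
    rw [pexp_const, pexp_mul_left] at this
    rw [← sub_eq_zero] at this ⊢
    rw [← this]
    have : (fun x => 1 - k * g x) = fun x => 1 + (-k) * g x := by funext x; ring
    rw [this]; ring
  have h0 : 0 ≤ pexp (offs sel mutOp P) (fun x => 1 - k * g x) :=
    pexp_nonneg _ fun x => by
      have := mul_le_mul hk1 (hg1 x) (hg0 x) zero_le_one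
      linarith
  have h1 : pexp (offs sel mutOp P) (fun x => 1 - k * g x) ≤ Real.exp (-(q * k)) := by
    rw [e1]
    have := Real.add_one_le_exp (-(q * k))
    have h3 := mul_le_mul_of_nonneg_left hq hk
    linarith
  have e2 : eaStep sel mutOp P = prodPMF (fun _ : Fin l => offs sel mutOp P) := rfl
  rw [e2, e, Finset.prod_const, Finset.card_univ, Fintype.card_fin]
  calc _ ≤ Real.exp (-(q * k)) ^ l := pow_le_pow_left₀ h0 h1 _
    _ = Real.exp (-(l * q * k)) := by
      rw [← Real.exp_nat_mul]; congr 1; ring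

lemma laplace_le {n l : ℕ} (sel : Popn n l → PMF (Fin l))
    (mutOp : BitStr n → PMF (BitStr n)) (P : Popn n l) (j : ℕ) (θ : ℝ) (hθ : 0 ≤ θ) :
    pexp (eaStep sel mutOp P) (fun Q => Real.exp (-(θ * cnt j Q)))
      ≤ Real.exp (-(l * pexp (offs sel mutOp P) (ind j) * (1 - Real.exp (-θ)))) := by
  have hE : Real.exp (-θ) ≤ 1 := Real.exp_le_one_iff.2 (by linarith)
  have h := step_prod_le sel mutOp P (ind j) (1 - Real.exp (-θ)) _ (by linarith)
    (by have := Real.exp_pos (-θ); linarith) (ind_nonneg j) (ind_le_one j) le_rfl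
  refine le_trans (le_of_eq ?_) h
  congr 1
  funext Q
  rw [cnt_eq_sum, Finset.mul_sum, ← Finset.sum_neg_distrib, Real.exp_sum]
  refine Finset.prod_congr rfl fun i _ => ?_
  unfold ind
  split_ifs <;> simp

lemma one_sub_exp_neg_ge (θ : ℝ) (hθ : 0 ≤ θ) (hθ1 : θ ≤ 1) :
    θ - θ ^ 2 / 2 ≤ 1 - Real.exp (-θ) := by
  have h := Real.quadratic_le_exp_of_nonneg hθ
  have hp : 0 < 1 + θ + θ ^ 2 / 2 := by positivity
  have : Real.exp (-θ) ≤ 1 - θ + θ ^ 2 / 2 := by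
    rw [Real.exp_neg]
    calc (Real.exp θ)⁻¹ ≤ (1 + θ + θ ^ 2 / 2)⁻¹ := inv_anti₀ hp h
      _ ≤ 1 - θ + θ ^ 2 / 2 := by
        rw [inv_le_iff_one_le_mul₀ hp]
        nlinarith [sq_nonneg (θ ^ 2)]
  linarith

lemma stay_le {n l : ℕ} (sel : Popn n l → PMF (Fin l))
    (mutOp : BitStr n → PMF (BitStr n)) (P : Popn n l) (j : ℕ) (δ M : ℝ)
    (hδ : 0 < δ) (hδ1 : δ ≤ 1) (hM : 0 ≤ M)
    (hq : (1 + δ) * M ≤ l * pexp (offs sel mutOp P) (ind j)) :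
    pexp (eaStep sel mutOp P) (fun Q => if (cnt j Q : ℝ) < M then 1 else 0)
      ≤ Real.exp (-(M * δ ^ 2 / 4)) := by
  have h := laplace_le sel mutOp P j (δ / 2) (by linarith)
  have hl := one_sub_exp_neg_ge (δ / 2) (by linarith) (by linarith)
  calc pexp (eaStep sel mutOp P) (fun Q => if (cnt j Q : ℝ) < M then 1 else 0)
      ≤ pexp (eaStep sel mutOp P)
          (fun Q => Real.exp (δ / 2 * M) * Real.exp (-(δ / 2 * cnt j Q))) := by
        refine pexp_mono _ fun Q => ?_
        rw [← Real.exp_add]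
        split_ifs with hc
        · apply Real.one_le_exp
          nlinarith
        · exact (Real.exp_pos _).le
    _ ≤ Real.exp (δ / 2 * M)
        * Real.exp (-(l * pexp (offs sel mutOp P) (ind j) * (1 - Real.exp (-(δ / 2))))) := by
        rw [pexp_mul_left]
        exact mul_le_mul_of_nonneg_left h (Real.exp_pos _).le
    _ ≤ Real.exp (-(M * δ ^ 2 / 4)) := by
        rw [← Real.exp_add]
        apply Real.exp_le_exp.2
        have h0 : 0 ≤ δ / 2 - (δ / 2) ^ 2 / 2 := by nlinarith
        have h1 := mul_le_mul hq hl h0 (le_trans (by positivity) hq)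
        have h2 : 0 ≤ M * δ ^ 2 * (1 - δ) := by
          have : 0 ≤ 1 - δ := by linarith
          positivity
        nlinarith

/-- One phase: from level `j` being well populated to level `j+1` being well populated. -/
lemma phase_le {n l : ℕ} (sel : Popn n l → PMF (Fin l))
    (mutOp : BitStr n → PMF (BitStr n)) (G : Set (Popn n l)) (j : ℕ) (δ M b ε p' : ℝ) (T : ℕ)
    (θ : ℕ → ℝ) (hδ1 : δ ≤ 1) (hb : 0 ≤ b) (hε : 0 ≤ ε) (hp : 0 ≤ p')
    (hstay : ∀ P : Popn n l, M ≤ cnt j P →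
      pexp (eaStep sel mutOp P) (fun Q => if (cnt j Q : ℝ) < M then 1 else 0) ≤ ε)
    (hgrow : ∀ P : Popn n l, M ≤ cnt j P → (cnt (j + 1) P : ℝ) < M →
      (1 + δ) * cnt (j + 1) P + b ≤ l * pexp (offs sel mutOp P) (ind (j + 1)))
    (hθ0 : ∀ t, 0 ≤ θ t) (hθ1 : ∀ t, θ t ≤ δ / 2) (hθs : ∀ t, θ (t + 1) ≤ (1 + δ / 2) * θ t)
    (hnext : ∀ P : Popn n l, M ≤ cnt (j + 1) P → bsurv (eaStep sel mutOp) G T P ≤ p')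
    (t : ℕ) (P : Popn n l) (hP : M ≤ cnt j P) :
    bsurv (eaStep sel mutOp) G (T + t) P ≤ p' + t * ε
      + Real.exp (θ 0 * M - θ t * cnt (j + 1) P - b / 2 * ∑ s ∈ Finset.range t, θ s) := by
  induction t generalizing P with
  | zero =>
    by_cases h : M ≤ cnt (j + 1) P
    · have := hnext P h
      have h2 := Real.exp_pos (θ 0 * M - θ 0 * cnt (j + 1) P
        - b / 2 * ∑ s ∈ Finset.range 0, θ s)
      simp only [add_zero, Nat.cast_zero, zero_mul]
      linarith
    · push Not at h
      have h1 := bsurv_le_one (eaStep sel mutOp) G (T + 0) P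
      have h2 : 1 ≤ Real.exp (θ 0 * M - θ 0 * cnt (j + 1) P
          - b / 2 * ∑ s ∈ Finset.range 0, θ s) := by
        apply Real.one_le_exp
        simp only [Finset.range_zero, Finset.sum_empty, mul_zero, sub_zero]
        have := mul_le_mul_of_nonneg_left h.le (hθ0 0)
        linarith
      simp only [Nat.cast_zero, zero_mul]
      linarith
  | succ t ih =>
    by_cases h : M ≤ cnt (j + 1) P
    · have h0 := hnext P h
      have h1 := bsurv_anti (eaStep sel mutOp) G P (Nat.le_add_right T (t + 1))
      have h2 := Real.exp_pos (θ 0 * M - θ (t + 1) * cnt (j + 1) P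
        - b / 2 * ∑ s ∈ Finset.range (t + 1), θ s)
      have h3 : 0 ≤ ((t + 1 : ℕ) : ℝ) * ε := by positivity
      simp only at h1
      linarith
    · push Not at h
      set β := b / 2 * ∑ s ∈ Finset.range t, θ s with hβ
      have hbound : ∀ Q : Popn n l, bsurv (eaStep sel mutOp) G (T + t) Q
          ≤ (if (cnt j Q : ℝ) < M then 1 else 0) + ((p' + t * ε)
            + Real.exp (θ 0 * M - β) * Real.exp (-(θ t * cnt (j + 1) Q))) := by
        intro Q
        have hE : Real.exp (θ 0 * M - β) * Real.exp (-(θ t * cnt (j + 1) Q))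
            = Real.exp (θ 0 * M - θ t * cnt (j + 1) Q - β) := by
          rw [← Real.exp_add]; congr 1; ring
        rw [hE]
        split_ifs with hc
        · have h1 := bsurv_le_one (eaStep sel mutOp) G (T + t) Q
          have h2 := Real.exp_pos (θ 0 * M - θ t * cnt (j + 1) Q - β)
          have h3 : 0 ≤ p' + t * ε := by positivity
          linarith
        · have := ih Q (not_lt.1 hc)
          linarith
      have hL := laplace_le sel mutOp P (j + 1) (θ t) (hθ0 t)
      have hl := one_sub_exp_neg_ge (θ t) (hθ0 t) (by linarith [hθ1 t])
      have hg := hgrow P hP h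
      have hx : (0 : ℝ) ≤ cnt (j + 1) P := Nat.cast_nonneg _
      have hδ : 0 ≤ δ := by linarith [hθ0 0, hθ1 0]
      have hexp : Real.exp (θ 0 * M - β) * pexp (eaStep sel mutOp P)
            (fun Q => Real.exp (-(θ t * cnt (j + 1) Q)))
          ≤ Real.exp (θ 0 * M - θ (t + 1) * cnt (j + 1) P
            - b / 2 * ∑ s ∈ Finset.range (t + 1), θ s) := by
        refine (mul_le_mul_of_nonneg_left hL (Real.exp_pos _).le).trans ?_
        rw [← Real.exp_add]
        apply Real.exp_le_exp.2
        rw [Finset.sum_range_succ, mul_add, ← hβ]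
        have a1 : 0 ≤ θ t * (1 - θ t / 2) :=
          mul_nonneg (hθ0 t) (by linarith [hθ1 t])
        have a2 : θ t * (1 - θ t / 2) ≤ 1 - Real.exp (-(θ t)) := by
          refine le_trans (le_of_eq ?_) hl; ring
        have a3 := mul_le_mul hg a2 a1 (le_trans (by positivity) hg)
        have a4 : b / 2 * θ t ≤ b * (θ t * (1 - θ t / 2)) := by
          have : 0 ≤ b * θ t * (1 / 2 - θ t / 2) :=
            mul_nonneg (mul_nonneg hb (hθ0 t)) (by linarith [hθ1 t])
          linarith
        have a5 : (1 + δ / 2) * θ t ≤ (1 + δ) * (θ t * (1 - θ t / 2)) := by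
          have h1 : 0 ≤ θ t * ((1 + δ) * (1 - θ t / 2) - (1 + δ / 2)) := by
            apply mul_nonneg (hθ0 t)
            have : (1 + δ) * (1 - δ / 4) ≤ (1 + δ) * (1 - θ t / 2) :=
              mul_le_mul_of_nonneg_left (by linarith [hθ1 t]) (by linarith)
            nlinarith
          linarith
        have a6 : θ (t + 1) * cnt (j + 1) P
            ≤ (1 + δ) * (θ t * (1 - θ t / 2)) * cnt (j + 1) P :=
          mul_le_mul_of_nonneg_right ((hθs t).trans a5) hx
        nlinarith
      calc bsurv (eaStep sel mutOp) G (T + (t + 1)) P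
          ≤ pexp (eaStep sel mutOp P) (bsurv (eaStep sel mutOp) G (T + t)) :=
            bsurv_succ_le _ _ _ _
        _ ≤ _ := pexp_mono _ hbound
        _ = pexp (eaStep sel mutOp P) (fun Q => if (cnt j Q : ℝ) < M then 1 else 0)
            + ((p' + t * ε) + Real.exp (θ 0 * M - β) * pexp (eaStep sel mutOp P)
              (fun Q => Real.exp (-(θ t * cnt (j + 1) Q)))) := by
            rw [pexp_add, pexp_add, pexp_const, pexp_mul_left]
        _ ≤ _ := by
            have := hstay P hP
            push_cast
            linarith

/-- Last phase: from a well populated plateau to the optimum. -/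
lemma last_phase_le {n l : ℕ} (sel : Popn n l → PMF (Fin l))
    (mutOp : BitStr n → PMF (BitStr n)) (j : ℕ) (M ε z : ℝ) (hε : 0 ≤ ε)
    (hstay : ∀ P : Popn n l, M ≤ cnt j P →
      pexp (eaStep sel mutOp P) (fun Q => if (cnt j Q : ℝ) < M then 1 else 0) ≤ ε)
    (hz : ∀ P : Popn n l, M ≤ cnt j P →
      z ≤ pexp (offs sel mutOp P) (fun x => if x = allOnesStr n then 1 else 0))
    (t : ℕ) (P : Popn n l) (hP : M ≤ cnt j P) :
    bsurv (eaStep sel mutOp) (optSet n l) t P ≤ t * ε + Real.exp (-(t * (l * z))) := by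
  induction t generalizing P with
  | zero => simpa using bsurv_le_one _ _ _ _
  | succ t ih =>
    have hbound : ∀ Q : Popn n l, bsurv (eaStep sel mutOp) (optSet n l) t Q
        ≤ (if (cnt j Q : ℝ) < M then 1 else 0) + (t * ε + Real.exp (-(t * (l * z)))
          * ∏ i, (1 - 1 * (if Q i = allOnesStr n then (1 : ℝ) else 0))) := by
      intro Q
      have hpr : (0 : ℝ) ≤ ∏ i, (1 - 1 * (if Q i = allOnesStr n then (1 : ℝ) else 0)) :=
        Finset.prod_nonneg fun i _ => by split_ifs <;> norm_num
      have hr : 0 ≤ t * ε + Real.exp (-(t * (l * z)))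
          * ∏ i, (1 - 1 * (if Q i = allOnesStr n then (1 : ℝ) else 0)) := by positivity
      by_cases hQ : Q ∈ optSet n l
      · rw [bsurv_mem _ _ _ hQ]
        split_ifs <;> linarith
      · have e : ∏ i, (1 - 1 * (if Q i = allOnesStr n then (1 : ℝ) else 0)) = 1 := by
          refine Finset.prod_eq_one fun i _ => ?_
          have : Q i ≠ allOnesStr n := fun h => hQ ⟨i, h⟩
          simp [this]
        split_ifs with hc
        · have := bsurv_le_one (eaStep sel mutOp) (optSet n l) t Q
          linarith
        · rw [e]
          have := ih Q (not_lt.1 hc)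
          linarith
    have hs := step_prod_le sel mutOp P (fun x => if x = allOnesStr n then 1 else 0) 1 z
      (by norm_num) le_rfl (fun x => by split_ifs <;> norm_num)
      (fun x => by split_ifs <;> norm_num) (hz P hP)
    calc bsurv (eaStep sel mutOp) (optSet n l) (t + 1) P
        ≤ pexp (eaStep sel mutOp P) (bsurv (eaStep sel mutOp) (optSet n l) t) :=
          bsurv_succ_le _ _ _ _
      _ ≤ _ := pexp_mono _ hbound
      _ = pexp (eaStep sel mutOp P) (fun Q => if (cnt j Q : ℝ) < M then 1 else 0)
          + (t * ε + Real.exp (-(t * (l * z))) * pexp (eaStep sel mutOp P)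
            (fun Q => ∏ i, (1 - 1 * (if Q i = allOnesStr n then (1 : ℝ) else 0)))) := by
          rw [pexp_add, pexp_add, pexp_const, pexp_mul_left]
      _ ≤ _ := by
          have h1 := hstay P hP
          have h2 := mul_le_mul_of_nonneg_left hs (Real.exp_pos (-(t * (l * z)))).le
          rw [← Real.exp_add] at h2
          have e : -(↑t * (↑l * z)) + -(↑l * z * 1) = -(((t + 1 : ℕ) : ℝ) * (l * z)) := by
            push_cast; ring
          rw [e] at h2
          push_cast at h2 ⊢
          linarith

/-! ### Fitness, selection and mutation estimates -/

lemma plateauF_ge {n r j : ℕ} (hj : j ≤ n - r) (x : BitStr n) (hx : j ≤ ones x) :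
    (j : ℝ) ≤ plateauF n r x := by
  unfold plateauF
  split_ifs with h1 h2
  · exact_mod_cast hx
  · exact_mod_cast (by omega : j ≤ n)
  · exact_mod_cast hj

lemma plateauF_le {n r j : ℕ} (hj : j ≤ n - r) (x : BitStr n) (hx : ¬ j ≤ ones x) :
    plateauF n r x ≤ (j : ℝ) - 1 := by
  unfold plateauF
  rw [if_pos (by omega)]
  have : ones x + 1 ≤ j := by omega
  have h : ((ones x + 1 : ℕ) : ℝ) ≤ j := by exact_mod_cast this
  push_cast at h
  linarith

lemma plateauF_nonneg {n r : ℕ} (x : BitStr n) : 0 ≤ plateauF n r x := by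
  unfold plateauF
  split_ifs <;> positivity

lemma sel_ge {n l r j : ℕ} (sel : Popn n l → PMF (Fin l)) (hsel : IsPropSel (plateauF n r) sel)
    (P : Popn n l) (hj1 : 1 ≤ j) (hj : j ≤ n - r) (hl : 0 < l) (γ g κ : ℝ)
    (hγ0 : 0 ≤ γ) (hγ1 : γ ≤ 1 / 2) (hκ : κ = 1 + (1 - γ) / n)
    (hg0 : 0 ≤ g) (hgγ : g ≤ γ) (hgX : g * l ≤ cnt j P) :
    κ * g ≤ pexp (sel P) (fun i => ind j (P i)) := by
  have hn : 1 ≤ n := by omega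
  have hnR : (1 : ℝ) ≤ n := by exact_mod_cast hn
  have hlR : (0 : ℝ) < l := by exact_mod_cast hl
  have hjR : (1 : ℝ) ≤ j := by exact_mod_cast hj1
  have hjn : (j : ℝ) ≤ n := by exact_mod_cast (by omega : j ≤ n)
  set F := ∑ i, plateauF n r (P i) with hF
  have hF0 : 0 ≤ F := Finset.sum_nonneg fun i _ => plateauF_nonneg _
  set a := ∑ i, plateauF n r (P i) * ind j (P i) with ha
  have haX : (j : ℝ) * cnt j P ≤ a := by
    rw [cnt_eq_sum, Finset.mul_sum]
    refine Finset.sum_le_sum fun i _ => ?_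
    unfold ind
    split_ifs with h
    · simpa using plateauF_ge hj _ h
    · simp
  have hrest : F - a ≤ ((j : ℝ) - 1) * (l - cnt j P) := by
    have e : ((l : ℝ) - cnt j P) = ∑ i : Fin l, (1 - ind j (P i)) := by
      rw [cnt_eq_sum, Finset.sum_sub_distrib]; simp
    rw [e, hF, ha, ← Finset.sum_sub_distrib, Finset.mul_sum]
    refine Finset.sum_le_sum fun i _ => ?_
    unfold ind
    split_ifs with h
    · simp
    · simpa using plateauF_le hj _ h
  have haF : a ≤ F := by
    refine Finset.sum_le_sum fun i _ => ?_
    have := mul_le_mul_of_nonneg_left (ind_le_one j (P i)) (plateauF_nonneg (r := r) (P i))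
    linarith
  have hXn : (0 : ℝ) ≤ cnt j P := Nat.cast_nonneg _
  rcases eq_or_lt_of_le hF0 with h0 | h0
  · have hX0 : (cnt j P : ℝ) ≤ 0 := by nlinarith
    have hg : g = 0 := by
      have : g * l ≤ 0 := hgX.trans hX0
      have : g ≤ 0 := by
        by_contra hc
        push Not at hc
        have := mul_pos hc hlR
        linarith
      linarith
    rw [hg, mul_zero]
    exact pexp_nonneg _ fun i => ind_nonneg _ _
  · have hs : pexp (sel P) (fun i => ind j (P i)) = a / F := by
      unfold pexp
      rw [ha, Finset.sum_div]
      refine Finset.sum_congr rfl fun i _ => ?_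
      rw [(hsel P i).2 h0.ne', ENNReal.toReal_ofReal (div_nonneg (plateauF_nonneg _) hF0)]
      ring
    rw [hs, le_div_iff₀ h0]
    have hκ1 : 1 ≤ κ := by
      rw [hκ]
      have : 0 ≤ (1 - γ) / n := div_nonneg (by linarith) (by linarith)
      linarith
    have hκn : (1 - γ) / n * n = 1 - γ := by field_simp
    have hκ2 : κ ≤ 2 := by
      rw [hκ]
      have : (1 - γ) / n ≤ 1 := by
        rw [div_le_one (by linarith)]; linarith
      linarith
    have hκg : κ * g ≤ 1 := by nlinarith
    -- main inequality: `κ (j - 1 + g) ≤ j`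
    have hmain : κ * (j - 1 + g) ≤ j := by
      have h1 : (1 - γ) / n * (j - 1 + g) ≤ (1 - γ) / n * n :=
        mul_le_mul_of_nonneg_left (by linarith) (div_nonneg (by linarith) (by linarith))
      rw [hκ]
      nlinarith
    -- suffices a (1 - κ g) ≥ κ g (F - a)
    have h1 : κ * g * (F - a) ≤ κ * g * (((j : ℝ) - 1) * (l * (1 - g))) := by
      apply mul_le_mul_of_nonneg_left _ (by positivity)
      refine hrest.trans (mul_le_mul_of_nonneg_left ?_ (by linarith))
      linarith
    have h2 : (j : ℝ) * (g * l) * (1 - κ * g) ≤ a * (1 - κ * g) := by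
      apply mul_le_mul_of_nonneg_right _ (by linarith)
      exact (mul_le_mul_of_nonneg_left hgX (by linarith)).trans haX
    have h3 : κ * g * (((j : ℝ) - 1) * (l * (1 - g))) ≤ (j : ℝ) * (g * l) * (1 - κ * g) := by
      have : 0 ≤ (g * l) * (j - κ * (j - 1 + g)) :=
        mul_nonneg (by positivity) (by linarith)
      nlinarith
    nlinarith

lemma sel_zero {n l : ℕ} (p : PMF (Fin l)) (P : Popn n l) :
    pexp p (fun i => ind 0 (P i)) = 1 := by
  have : (fun i => ind 0 (P i)) = fun _ => (1 : ℝ) := by funext i; simp [ind]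
  rw [this, pexp_const]

lemma single_le_pexp {α : Type*} [Fintype α] (p : PMF α) (h : α → ℝ) (H : ∀ a, 0 ≤ h a) (a : α)
    (ha : h a = 1) : (p a).toReal ≤ pexp p h := by
  unfold pexp
  have := Finset.single_le_sum (f := fun a => (p a).toReal * h a)
    (fun a _ => mul_nonneg ENNReal.toReal_nonneg (H a)) (Finset.mem_univ a)
  simpa [ha] using this

lemma mut_toReal {n : ℕ} {p : ℝ} {mutOp : BitStr n → PMF (BitStr n)} (hm : IsBitwiseMut p mutOp)
    (hp0 : 0 ≤ p) (hp1 : p ≤ 1) (x y : BitStr n) :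
    (mutOp x y).toReal = p ^ hammingDist x y * (1 - p) ^ (n - hammingDist x y) := by
  rw [hm x y, ENNReal.toReal_ofReal]
  have : 0 ≤ 1 - p := by linarith
  positivity

lemma mut_stay {n : ℕ} {p : ℝ} {mutOp : BitStr n → PMF (BitStr n)} (hm : IsBitwiseMut p mutOp)
    (hp0 : 0 ≤ p) (hp1 : p ≤ 1) (j : ℕ) (x : BitStr n) (hx : j ≤ ones x) :
    (1 - p) ^ n ≤ pexp (mutOp x) (ind j) := by
  have h := single_le_pexp (mutOp x) (ind j) (ind_nonneg j) x (by simp [ind, hx])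
  rw [mut_toReal hm hp0 hp1] at h
  simpa using h

lemma mut_up {n : ℕ} {p : ℝ} {mutOp : BitStr n → PMF (BitStr n)} (hm : IsBitwiseMut p mutOp)
    (hp0 : 0 ≤ p) (hp1 : p ≤ 1) (j : ℕ) (x : BitStr n) (hx : ones x = j) (hj : j < n) :
    p * (1 - p) ^ n ≤ pexp (mutOp x) (ind (j + 1)) := by
  have hex : ∃ k, x k = false := by
    by_contra hc
    push Not at hc
    have : ones x = n := by
      unfold ones
      have : (Finset.univ.filter fun i => x i = true) = Finset.univ := by
        apply Finset.filter_true_of_mem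
        intro i _
        simpa using hc i
      rw [this]; simp
    omega
  obtain ⟨k, hk⟩ := hex
  set y := Function.update x k true with hy
  have hones : ones y = j + 1 := by
    rw [← hx]
    unfold ones
    have : (Finset.univ.filter fun i => y i = true)
        = insert k (Finset.univ.filter fun i => x i = true) := by
      ext i
      by_cases h : i = k
      · subst h; simp [hy]
      · simp [hy, Function.update_of_ne h, h]
    rw [this, Finset.card_insert_of_notMem (by simp [hk])]
  have hd : hammingDist x y = 1 := by
    unfold hammingDist
    have : (Finset.univ.filter fun i => x i ≠ y i) = {k} := by
      ext i
      by_cases h : i = k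
      · subst h; simp [hy, hk]
      · simp [hy, Function.update_of_ne h, h]
    rw [this]; simp
  have h := single_le_pexp (mutOp x) (ind (j + 1)) (ind_nonneg _) y (by simp [ind, hones])
  rw [mut_toReal hm hp0 hp1, hd, pow_one] at h
  refine le_trans (mul_le_mul_of_nonneg_left ?_ hp0) h
  exact pow_le_pow_of_le_one (by linarith) (by linarith) (by omega)

lemma mut_opt {n r : ℕ} {p : ℝ} {mutOp : BitStr n → PMF (BitStr n)} (hm : IsBitwiseMut p mutOp)
    (hp0 : 0 ≤ p) (hp1 : p ≤ 1) (x : BitStr n) (hx : n - r ≤ ones x) :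
    p ^ r * (1 - p) ^ n ≤ pexp (mutOp x) (fun y => if y = allOnesStr n then 1 else 0) := by
  have h := single_le_pexp (mutOp x) (fun y => if y = allOnesStr n then 1 else 0)
    (fun y => by split_ifs <;> norm_num) (allOnesStr n) (by simp)
  rw [mut_toReal hm hp0 hp1] at h
  have hd : hammingDist x (allOnesStr n) ≤ r := by
    have h1 : hammingDist x (allOnesStr n) + ones x = n := by
      unfold hammingDist ones allOnesStr
      have := Finset.card_filter_add_card_filter_not (s := (Finset.univ : Finset (Fin n)))
        (fun i => x i = true)
      simp only [Finset.card_univ, Fintype.card_fin] at this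
      simp only [ne_eq]
      omega
    omega
  refine le_trans (mul_le_mul ?_ ?_ ?_ ?_) h
  · exact pow_le_pow_of_le_one hp0 hp1 hd
  · exact pow_le_pow_of_le_one (by linarith) (by linarith) (by omega)
  · have : 0 ≤ 1 - p := by linarith
    positivity
  · positivity

lemma offs_stay {n l : ℕ} (sel : Popn n l → PMF (Fin l)) {p : ℝ}
    {mutOp : BitStr n → PMF (BitStr n)} (hm : IsBitwiseMut p mutOp)
    (hp0 : 0 ≤ p) (hp1 : p ≤ 1) (j : ℕ) (P : Popn n l) :
    (1 - p) ^ n * pexp (sel P) (fun i => ind j (P i)) ≤ pexp (offs sel mutOp P) (ind j) := by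
  unfold offs
  rw [pexp_bind, ← pexp_mul_left]
  refine pexp_mono _ fun i => ?_
  by_cases h : j ≤ ones (P i)
  · simpa [ind, h] using mut_stay hm hp0 hp1 j (P i) h
  · have := pexp_nonneg (mutOp (P i)) (ind_nonneg (n := n) j)
    have e : ind j (P i) = 0 := by simp [ind, h]
    rw [e, mul_zero]; exact this

lemma offs_up {n l : ℕ} (sel : Popn n l → PMF (Fin l)) {p : ℝ}
    {mutOp : BitStr n → PMF (BitStr n)} (hm : IsBitwiseMut p mutOp)
    (hp0 : 0 ≤ p) (hp1 : p ≤ 1) (j : ℕ) (hj : j < n) (P : Popn n l) :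
    (1 - p) ^ n * (1 - p) * pexp (sel P) (fun i => ind (j + 1) (P i))
      + p * (1 - p) ^ n * pexp (sel P) (fun i => ind j (P i))
      ≤ pexp (offs sel mutOp P) (ind (j + 1)) := by
  unfold offs
  rw [pexp_bind, ← pexp_mul_left, ← pexp_mul_left, ← pexp_add]
  refine pexp_mono _ fun i => ?_
  by_cases h : j + 1 ≤ ones (P i)
  · have h1 := mut_stay hm hp0 hp1 (j + 1) (P i) h
    have e1 : ind (j + 1) (P i) = 1 := by simp [ind, h]
    have e2 : ind j (P i) = 1 := by simp [ind, (by omega : j ≤ ones (P i))]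
    rw [e1, e2]; linarith
  · have e1 : ind (j + 1) (P i) = 0 := by simp [ind, h]
    by_cases h' : j ≤ ones (P i)
    · have e2 : ind j (P i) = 1 := by simp [ind, h']
      have h1 := mut_up hm hp0 hp1 j (P i) (by omega) hj
      rw [e1, e2]; linarith
    · have e2 : ind j (P i) = 0 := by simp [ind, h']
      rw [e1, e2]
      have := pexp_nonneg (mutOp (P i)) (ind_nonneg (n := n) (j + 1))
      linarith

lemma offs_opt {n l r : ℕ} (sel : Popn n l → PMF (Fin l)) {p : ℝ}
    {mutOp : BitStr n → PMF (BitStr n)} (hm : IsBitwiseMut p mutOp)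
    (hp0 : 0 ≤ p) (hp1 : p ≤ 1) (P : Popn n l) :
    p ^ r * (1 - p) ^ n * pexp (sel P) (fun i => ind (n - r) (P i))
      ≤ pexp (offs sel mutOp P) (fun y => if y = allOnesStr n then 1 else 0) := by
  unfold offs
  rw [pexp_bind, ← pexp_mul_left]
  refine pexp_mono _ fun i => ?_
  by_cases h : n - r ≤ ones (P i)
  · simpa [ind, h] using mut_opt hm hp0 hp1 (P i) h
  · have e : ind (n - r) (P i) = 0 := by simp [ind, h]
    rw [e, mul_zero]
    exact pexp_nonneg _ fun y => by split_ifs <;> norm_num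

/-! ### Putting the phases together -/

lemma phase_cor {n l : ℕ} (sel : Popn n l → PMF (Fin l))
    (mutOp : BitStr n → PMF (BitStr n)) (G : Set (Popn n l)) (j : ℕ) (δ M b ε p' : ℝ) (T : ℕ)
    (t1 t2 : ℕ) (hl : 0 < l) (hδ : 0 < δ)
    (hδ1 : δ ≤ 1) (hb : 0 ≤ b) (hε : 0 ≤ ε) (hp : 0 ≤ p') (hMl : M ≤ l)
    (ht1 : (l : ℝ) ≤ (1 + δ / 2) ^ t1)
    (hstay : ∀ P : Popn n l, M ≤ cnt j P →
      pexp (eaStep sel mutOp P) (fun Q => if (cnt j Q : ℝ) < M then 1 else 0) ≤ ε)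
    (hgrow : ∀ P : Popn n l, M ≤ cnt j P → (cnt (j + 1) P : ℝ) < M →
      (1 + δ) * cnt (j + 1) P + b ≤ l * pexp (offs sel mutOp P) (ind (j + 1)))
    (hnext : ∀ P : Popn n l, M ≤ cnt (j + 1) P → bsurv (eaStep sel mutOp) G T P ≤ p')
    (P : Popn n l) (hP : M ≤ cnt j P) :
    bsurv (eaStep sel mutOp) G (T + (t1 + t2)) P ≤ p' + ((t1 + t2 : ℕ) : ℝ) * ε
      + Real.exp (1 - b * δ * t2 / 4) := by
  have hlR : (0 : ℝ) < l := by exact_mod_cast hl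
  set θ : ℕ → ℝ := fun t => min ((1 / (l : ℝ)) * (1 + δ / 2) ^ t) (δ / 2) with hθ
  have hθ0 : ∀ t, 0 ≤ θ t := fun t => by
    simp only [hθ]; positivity
  have hθ1 : ∀ t, θ t ≤ δ / 2 := fun t => min_le_right _ _
  have hθs : ∀ t, θ (t + 1) ≤ (1 + δ / 2) * θ t := by
    intro t
    simp only [hθ]
    rw [mul_min_of_nonneg _ _ (by positivity)]
    refine min_le_min (le_of_eq (by ring)) ?_
    nlinarith
  have h := phase_le sel mutOp G j δ M b ε p' T θ hδ1 hb hε hp hstay hgrow hθ0 hθ1 hθs hnext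
    (t1 + t2) P hP
  refine h.trans ?_
  have hsum : (t2 : ℝ) * (δ / 2) ≤ ∑ s ∈ Finset.range (t1 + t2), θ s := by
    rw [Finset.sum_range_add]
    have h1 : 0 ≤ ∑ s ∈ Finset.range t1, θ s := Finset.sum_nonneg fun s _ => hθ0 s
    have h2 : (t2 : ℝ) * (δ / 2) ≤ ∑ s ∈ Finset.range t2, θ (t1 + s) := by
      have : ∑ s ∈ Finset.range t2, (δ / 2) ≤ ∑ s ∈ Finset.range t2, θ (t1 + s) := by
        refine Finset.sum_le_sum fun s _ => ?_
        simp only [hθ]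
        refine le_min ?_ le_rfl
        have hpow : (l : ℝ) ≤ (1 + δ / 2) ^ (t1 + s) :=
          ht1.trans (pow_le_pow_right₀ (by linarith) (by omega))
        have : 1 ≤ 1 / (l : ℝ) * (1 + δ / 2) ^ (t1 + s) := by
          rw [one_div, ← div_eq_inv_mul, le_div_iff₀ hlR]; linarith
        linarith
      simpa using this
    linarith
  have hθM : θ 0 * M ≤ 1 := by
    have h1 : θ 0 ≤ 1 / l := by
      simp only [hθ]; refine (min_le_left _ _).trans (by simp)
    calc θ 0 * M ≤ θ 0 * l := mul_le_mul_of_nonneg_left hMl (hθ0 0)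
      _ ≤ 1 / l * l := mul_le_mul_of_nonneg_right h1 hlR.le
      _ = 1 := by field_simp
  have hx : 0 ≤ θ (t1 + t2) * cnt (j + 1) P := mul_nonneg (hθ0 _) (Nat.cast_nonneg _)
  have hbs := mul_le_mul_of_nonneg_left hsum (by linarith : 0 ≤ b / 2)
  refine add_le_add le_rfl (Real.exp_le_exp.2 ?_)
  linarith

lemma levels_le {n l : ℕ} (sel : Popn n l → PMF (Fin l))
    (mutOp : BitStr n → PMF (BitStr n)) (m : ℕ) (δ M b ε z : ℝ)
    (t1 t2 T1 : ℕ) (hl : 0 < l) (hδ : 0 < δ)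
    (hδ1 : δ ≤ 1) (hb : 0 ≤ b) (hε : 0 ≤ ε) (hMl : M ≤ l)
    (ht1 : (l : ℝ) ≤ (1 + δ / 2) ^ t1)
    (hstay : ∀ j ≤ m, ∀ P : Popn n l, M ≤ cnt j P →
      pexp (eaStep sel mutOp P) (fun Q => if (cnt j Q : ℝ) < M then 1 else 0) ≤ ε)
    (hgrow : ∀ j < m, ∀ P : Popn n l, M ≤ cnt j P → (cnt (j + 1) P : ℝ) < M →
      (1 + δ) * cnt (j + 1) P + b ≤ l * pexp (offs sel mutOp P) (ind (j + 1)))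
    (hz : ∀ P : Popn n l, M ≤ cnt m P →
      z ≤ pexp (offs sel mutOp P) (fun x => if x = allOnesStr n then 1 else 0))
    (P : Popn n l) :
    bsurv (eaStep sel mutOp) (optSet n l) (T1 + m * (t1 + t2)) P
      ≤ T1 * ε + Real.exp (-(T1 * (l * z)))
        + m * (((t1 + t2 : ℕ) : ℝ) * ε + Real.exp (1 - b * δ * t2 / 4)) := by
  set η := ((t1 + t2 : ℕ) : ℝ) * ε + Real.exp (1 - b * δ * t2 / 4) with hη
  have hη0 : 0 ≤ η := by positivity
  have key : ∀ k ≤ m, ∀ P : Popn n l, M ≤ cnt (m - k) P →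
      bsurv (eaStep sel mutOp) (optSet n l) (T1 + k * (t1 + t2)) P
        ≤ T1 * ε + Real.exp (-(T1 * (l * z))) + k * η := by
    intro k
    induction k with
    | zero =>
      intro _ P hP
      have := last_phase_le sel mutOp m M ε z hε (hstay m le_rfl) hz T1 P (by simpa using hP)
      simpa using this
    | succ k ih =>
      intro hk P hP
      have e : m - k = (m - (k + 1)) + 1 := by omega
      have ih' := ih (by omega)
      rw [e] at ih'
      have h := phase_cor sel mutOp (optSet n l) (m - (k + 1)) δ M b ε
        (T1 * ε + Real.exp (-(T1 * (l * z))) + k * η) (T1 + k * (t1 + t2)) t1 t2 hl hδ hδ1 hb hε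
        (by positivity) hMl ht1 (hstay _ (by omega)) (hgrow _ (by omega)) ih' P hP
      have e2 : T1 + k * (t1 + t2) + (t1 + t2) = T1 + (k + 1) * (t1 + t2) := by ring
      rw [e2] at h
      refine h.trans (le_of_eq ?_)
      rw [add_assoc, ← hη]
      push_cast
      ring
  have h0 : M ≤ cnt (m - m) P := by
    have : cnt (m - m) P = l := by simp [cnt]
    rw [this]; exact hMl
  exact key m le_rfl P h0

/-- Numerical drift estimate. -/
lemma drift_num (c : ℝ) (hc0 : 0 < c) (hc1 : c < 1) (n : ℕ) (hn : 12 / c ≤ n) :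
    1 + c / (4 * n) ≤ (1 - (1 - c) / (n : ℝ) ^ 2) ^ (n + 1) * (1 + (1 - c / 2) / n) := by
  have hn12 : (12 : ℝ) ≤ n := by
    refine le_trans ?_ hn
    rw [le_div_iff₀ hc0]; linarith
  have hn0 : (0 : ℝ) < n := by linarith
  set u : ℝ := 1 / n with hu
  have hu0 : 0 < u := by positivity
  have hu1 : 12 * u ≤ c := by
    rw [div_le_iff₀ hc0] at hn
    rw [hu, mul_one_div, div_le_iff₀ hn0]; linarith
  have e1 : (1 - c) / (n : ℝ) ^ 2 = (1 - c) * u ^ 2 := by rw [hu]; field_simp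
  have e2 : c / (4 * (n : ℝ)) = c * u / 4 := by rw [hu]; field_simp
  have e3 : (1 - c / 2) / (n : ℝ) = (1 - c / 2) * u := by rw [hu]; field_simp
  have hun : u * n = 1 := by rw [hu]; field_simp
  have hp1 : (1 - c) * u ^ 2 ≤ 1 := by nlinarith
  have hB := one_add_mul_le_pow (a := -((1 - c) * u ^ 2)) (by linarith) (n + 1)
  rw [e1, e2, e3]
  have hB' : 1 - (1 - c) * (u + u ^ 2) ≤ (1 - (1 - c) * u ^ 2) ^ (n + 1) := by
    refine le_trans (le_of_eq ?_) (hB.trans (le_of_eq ?_))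
    · push_cast
      have : (n : ℝ) * u ^ 2 = u := by rw [pow_two, ← mul_assoc, mul_comm (n : ℝ) u, hun, one_mul]
      linear_combination (1 - c) * this
    · rw [← sub_eq_add_neg]
  refine le_trans ?_ (mul_le_mul_of_nonneg_right hB' (by nlinarith))
  have h1 : (1 - c) * (u + u ^ 2) * ((1 - c / 2) * u) ≤ 2 * u ^ 2 := by
    have a1 : (1 - c) * (1 - c / 2) ≤ 1 := by nlinarith
    have a2 : u + u ^ 2 ≤ 2 * u := by nlinarith
    calc (1 - c) * (u + u ^ 2) * ((1 - c / 2) * u)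
        = ((1 - c) * (1 - c / 2)) * ((u + u ^ 2) * u) := by ring
      _ ≤ 1 * ((2 * u) * u) := by
          apply mul_le_mul a1 _ (by positivity) (by norm_num)
          exact mul_le_mul_of_nonneg_right a2 hu0.le
      _ = 2 * u ^ 2 := by ring
  have h2 : (1 - c) * u ^ 2 ≤ u ^ 2 := by nlinarith [sq_nonneg u]
  nlinarith

/-- The survival bound for concrete parameters. -/
lemma half_bound {n l r : ℕ} (c : ℝ) (hc0 : 0 < c) (hc1 : c < 1) (hr : r ≤ n)
    (sel : Popn n l → PMF (Fin l)) (mutOp : BitStr n → PMF (BitStr n))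
    (hsel : IsPropSel (plateauF n r) sel)
    (hm : IsBitwiseMut ((1 - c) / (n : ℝ) ^ 2) mutOp) (hr1 : 1 ≤ r)
    (hn : 12 / c ≤ n) (hl : 0 < l) (t1 t2 T1 : ℕ)
    (ht1 : (l : ℝ) ≤ (1 + c / (4 * n) / 2) ^ t1) (P : Popn n l) :
    bsurv (eaStep sel mutOp) (optSet n l) (T1 + (n - r) * (t1 + t2)) P
      ≤ T1 * Real.exp (-(c / 2 * l * (c / (4 * n)) ^ 2 / 4))
        + Real.exp (-(T1 * (l * (((1 - c) / (n : ℝ) ^ 2) ^ r * (1 / 2) * (c / 2)))))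
        + (n - r : ℕ) * (((t1 + t2 : ℕ) : ℝ) * Real.exp (-(c / 2 * l * (c / (4 * n)) ^ 2 / 4))
          + Real.exp (1 - (l * ((1 - c) / (n : ℝ) ^ 2 * (1 / 2) * (c / 2))) * (c / (4 * n))
            * t2 / 4)) := by
  have hn12 : (12 : ℝ) ≤ n := by
    refine le_trans ?_ hn
    rw [le_div_iff₀ hc0]; linarith
  have hn0 : (0 : ℝ) < n := by linarith
  have hlR : (0 : ℝ) < l := by exact_mod_cast hl
  set p := (1 - c) / (n : ℝ) ^ 2 with hp
  set δ := c / (4 * (n : ℝ)) with hδ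
  have hp0 : 0 ≤ p := div_nonneg (by linarith) (by positivity)
  have hpn : p * n ≤ 1 / 12 := by
    have : p * n = (1 - c) / n := by rw [hp]; field_simp
    rw [this, div_le_iff₀ hn0]; linarith
  have hp1 : p ≤ 1 := by nlinarith
  have h1p : 0 ≤ 1 - p := by linarith
  have hδ0 : 0 < δ := by positivity
  have hδ1 : δ ≤ 1 := by
    rw [hδ, div_le_one (by positivity)]; linarith
  have hhalf : 1 / 2 ≤ (1 - p) ^ n := by
    have hB := one_add_mul_le_pow (a := -p) (by linarith) n
    rw [← sub_eq_add_neg] at hB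
    linarith
  have hdr := drift_num c hc0 hc1 n hn
  rw [← hp, ← hδ] at hdr
  set κ := 1 + (1 - c / 2) / (n : ℝ) with hκ
  have hκ1 : 1 ≤ κ := by
    have : 0 ≤ (1 - c / 2) / (n : ℝ) := div_nonneg (by linarith) hn0.le
    linarith
  have hsj : ∀ j ≤ n - r, ∀ P : Popn n l, c / 2 * l ≤ cnt j P →
      c / 2 ≤ pexp (sel P) (fun i => ind j (P i)) := by
    intro j hj P hP
    rcases Nat.eq_zero_or_pos j with h0 | h0
    · subst h0; rw [sel_zero]; linarith
    · have := sel_ge sel hsel P h0 hj hl (c / 2) (c / 2) κ (by linarith) (by linarith) hκ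
        (by linarith) le_rfl hP
      nlinarith
  refine levels_le sel mutOp (n - r) δ (c / 2 * l) (l * (p * (1 / 2) * (c / 2)))
    (Real.exp (-(c / 2 * l * δ ^ 2 / 4))) (p ^ r * (1 / 2) * (c / 2)) t1 t2 T1 hl hδ0 hδ1
    (by positivity) (Real.exp_pos _).le (by nlinarith) ht1 ?_ ?_ ?_ P
  · intro j hj P hP
    rcases Nat.eq_zero_or_pos j with h0 | h0
    · subst h0
      have e : (fun Q : Popn n l => if (cnt 0 Q : ℝ) < c / 2 * l then (1 : ℝ) else 0)
          = fun _ => 0 := by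
        funext Q
        have h1 : cnt 0 Q = l := by simp [cnt]
        rw [h1, if_neg]
        nlinarith
      rw [e, pexp_const]
      exact (Real.exp_pos _).le
    · apply stay_le sel mutOp P j δ _ hδ0 hδ1 (by positivity)
      have h1 := sel_ge sel hsel P h0 hj hl (c / 2) (c / 2) κ (by linarith) (by linarith) hκ
        (by linarith) le_rfl hP
      have h2 := offs_stay sel hm hp0 hp1 j P
      have h3 : (1 - p) ^ (n + 1) ≤ (1 - p) ^ n :=
        pow_le_pow_of_le_one h1p (by linarith) (by omega)
      have h4 : (1 + δ) * (c / 2) ≤ pexp (offs sel mutOp P) (ind j) := by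
        calc (1 + δ) * (c / 2) ≤ ((1 - p) ^ (n + 1) * κ) * (c / 2) :=
              mul_le_mul_of_nonneg_right hdr (by linarith)
          _ ≤ ((1 - p) ^ n * κ) * (c / 2) := by gcongr
          _ = (1 - p) ^ n * (κ * (c / 2)) := by ring
          _ ≤ (1 - p) ^ n * pexp (sel P) (fun i => ind j (P i)) := by gcongr
          _ ≤ _ := h2
      have h5 := mul_le_mul_of_nonneg_left h4 hlR.le
      linarith
  · intro j hj P hP hx
    have hx0 : (0 : ℝ) ≤ cnt (j + 1) P := Nat.cast_nonneg _
    have hg1 := sel_ge sel hsel P (by omega : 1 ≤ j + 1) (by omega) hl (c / 2)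
      (cnt (j + 1) P / l) κ (by linarith) (by linarith) hκ (by positivity)
      (by rw [div_le_iff₀ hlR]; exact hx.le) (by rw [div_mul_cancel₀ _ hlR.ne'])
    have hg2 := hsj j (by omega) P hP
    have h2 := offs_up sel hm hp0 hp1 j (by omega) P
    have h3 : (1 + δ) * (cnt (j + 1) P / l)
        ≤ (1 - p) ^ n * (1 - p) * pexp (sel P) (fun i => ind (j + 1) (P i)) := by
      calc (1 + δ) * (cnt (j + 1) P / l) ≤ ((1 - p) ^ (n + 1) * κ) * (cnt (j + 1) P / l) :=
            mul_le_mul_of_nonneg_right hdr (by positivity)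
        _ = (1 - p) ^ n * (1 - p) * (κ * (cnt (j + 1) P / l)) := by ring
        _ ≤ _ := by gcongr
    have h4 : p * (1 / 2) * (c / 2)
        ≤ p * (1 - p) ^ n * pexp (sel P) (fun i => ind j (P i)) := by gcongr
    have h5 := mul_le_mul_of_nonneg_left ((add_le_add h3 h4).trans h2) hlR.le
    refine le_trans (le_of_eq ?_) h5
    field_simp
  · intro P hP
    have hg2 := hsj (n - r) le_rfl P hP
    refine le_trans ?_ (offs_opt (r := r) sel hm hp0 hp1 P)
    gcongr


set_option maxHeartbeats 2000000 in
/-- Runtime of the non-elitist EA on `Plateau_r` with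
fitness-proportionate selection, bitwise mutation probability `(1−c)/n²`, and
population size `c' n² ln n ≤ λ ≤ n^K`: `E[T] ≤ C (λ n² ln n + n^{2r+1})`. -/
theorem plateau_runtime_propSel_lowMut
    (r : ℕ) (hr : 2 ≤ r) (c K : ℝ) (hc0 : 0 < c) (hc1 : c < 1) (hK : 0 < K) :
    ∃ c' C : ℝ, 0 < c' ∧ 0 < C ∧ ∃ n₀ : ℕ, ∀ n : ℕ, n₀ ≤ n →
      ∀ l : ℕ, ∀ sel : Popn n l → PMF (Fin l), ∀ mutOp : BitStr n → PMF (BitStr n),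
        IsPropSel (plateauF n r) sel →
        IsBitwiseMut ((1 - c) / (n : ℝ) ^ 2) mutOp →
        c' * (n : ℝ) ^ 2 * Real.log n ≤ (l : ℝ) →
        (l : ℝ) ≤ (n : ℝ) ^ K →
        (l : ℝ≥0∞) * expHitTime (PMF.uniformOfFintype (Popn n l)) (eaStep sel mutOp) (optSet n l)
          ≤ ENNReal.ofReal (C * ((l : ℝ) * (n : ℝ) ^ 2 * Real.log n + (n : ℝ) ^ (2 * r + 1))) := by
  have h1c : 0 < 1 - c := by linarith
  set D : ℝ := 8 / (c * (1 - c) ^ r) with hD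
  have hD0 : 0 < D := by positivity
  set B : ℝ := 16 * K / c + 2 with hB
  have hB0 : 0 < B := by positivity
  refine ⟨128 * (2 * r + 3) / c ^ 3 + 192 / (c ^ 2 * (1 - c)), 2 * D + 2 + 2 * B,
    by positivity, by positivity,
    ⌈12 / c⌉₊ + ⌈16 * B⌉₊ + ⌈16 * (D + 1)⌉₊ + 2 * r + 48, ?_⟩
  intro n hn l sel mutOp hsel hm hl1 hl2
  have hn1 : 12 / c ≤ n := (Nat.le_ceil _).trans (by exact_mod_cast (by omega))
  have hn2 : 16 * B ≤ n := (Nat.le_ceil _).trans (by exact_mod_cast (by omega))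
  have hn3 : 16 * (D + 1) ≤ n := (Nat.le_ceil _).trans (by exact_mod_cast (by omega))
  have hn48 : (48 : ℝ) ≤ n := by exact_mod_cast (by omega : 48 ≤ n)
  have hn0 : (0 : ℝ) < n := by linarith
  set L := Real.log n with hL
  have hL1 : 1 ≤ L := by
    rw [hL, Real.le_log_iff_exp_le hn0]
    linarith [Real.exp_one_lt_d9]
  have hLn : L ≤ n := by
    have := Real.log_le_sub_one_of_pos hn0
    linarith
  have hexpL : Real.exp L = n := Real.exp_log hn0
  -- consequences of the lower bound on the population size
  have hla : 128 * (2 * r + 3) / c ^ 3 * (n : ℝ) ^ 2 * L ≤ l := by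
    refine le_trans ?_ hl1
    have : 0 ≤ 192 / (c ^ 2 * (1 - c)) * (n : ℝ) ^ 2 * L := by positivity
    linarith
  have hlb : 192 / (c ^ 2 * (1 - c)) * (n : ℝ) ^ 2 * L ≤ l := by
    refine le_trans ?_ hl1
    have : 0 ≤ 128 * (2 * r + 3) / c ^ 3 * (n : ℝ) ^ 2 * L := by positivity
    linarith
  have hlR : (0 : ℝ) < l := lt_of_lt_of_le (by positivity) hla
  have hl : 0 < l := by exact_mod_cast hlR
  have hl1R : (1 : ℝ) ≤ l := by exact_mod_cast hl
  have hlogl : Real.log l ≤ K * L := by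
    have := Real.log_le_log hlR hl2
    rwa [Real.log_rpow hn0] at this
  -- the phase lengths
  set t1 : ℕ := ⌈16 * K / c * n * L⌉₊ with ht1
  set z : ℝ := ((1 - c) / (n : ℝ) ^ 2) ^ r * (1 / 2) * (c / 2) with hz
  have hz0 : 0 < z := by positivity
  have h2z : 2 / z = D * (n : ℝ) ^ (2 * r) := by
    rw [hz, hD, div_pow, ← pow_mul]
    field_simp
    norm_num
  set T1 : ℕ := ⌈2 / (l * z)⌉₊ with hT1
  have ht1u : (t1 : ℝ) ≤ 16 * K / c * n * L + 1 := (Nat.ceil_lt_add_one (by positivity)).le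
  have hT1u : (T1 : ℝ) ≤ 2 / (l * z) + 1 := (Nat.ceil_lt_add_one (by positivity)).le
  have hT1l : 2 / (l * z) ≤ (T1 : ℝ) := Nat.le_ceil _
  have hnL : (n : ℝ) ≤ n * L := by nlinarith
  have hτ : ((t1 + n : ℕ) : ℝ) ≤ B * (n * L) := by
    push_cast
    rw [hB]
    nlinarith
  have ht1g : (l : ℝ) ≤ (1 + c / (4 * n) / 2) ^ t1 := by
    have hu0 : 0 ≤ c / (4 * (n : ℝ)) / 2 := by positivity
    have hu1 : c / (4 * (n : ℝ)) / 2 ≤ 1 := by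
      rw [div_div, div_le_one (by positivity)]; linarith
    set u := c / (4 * (n : ℝ)) / 2 with hu
    have hlog : u / 2 ≤ Real.log (1 + u) := by
      rw [Real.le_log_iff_exp_le (by linarith)]
      have := Real.exp_bound_div_one_sub_of_interval (x := u / 2) (by linarith) (by linarith)
      refine this.trans ?_
      rw [div_le_iff₀ (by linarith)]
      nlinarith
    rw [← Real.log_le_log_iff hlR (by positivity), Real.log_pow]
    have h1 : K * L ≤ t1 * (u / 2) := by
      have h2 : 16 * K / c * n * L ≤ t1 := Nat.le_ceil _
      have h3 : 16 * K / c * n * L * (u / 2) = K * L := by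
        rw [hu]; field_simp; norm_num
      rw [← h3]
      exact mul_le_mul_of_nonneg_right h2 (by linarith)
    have h4 : (t1 : ℝ) * (u / 2) ≤ t1 * Real.log (1 + u) :=
      mul_le_mul_of_nonneg_left hlog (Nat.cast_nonneg _)
    linarith
  have hT : ∀ P, bsurv (eaStep sel mutOp) (optSet n l) (T1 + (n - r) * (t1 + n)) P ≤ 1 / 2 := by
    intro P
    refine (half_bound c hc0 hc1 (by omega) sel mutOp hsel hm (by omega) hn1 hl t1 n T1 ht1g
      P).trans ?_
    rw [← hz]
    set ε := Real.exp (-(c / 2 * l * (c / (4 * n)) ^ 2 / 4)) with hε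
    have hεn : ε * (n : ℝ) ^ (2 * r + 3) ≤ 1 := by
      rw [hε, ← hexpL, ← Real.exp_nat_mul, ← Real.exp_add, hexpL]
      apply Real.exp_le_one_iff.2
      have h1 : c / 2 * (128 * (2 * r + 3) / c ^ 3 * (n : ℝ) ^ 2 * L) * (c / (4 * n)) ^ 2 / 4
          = (2 * r + 3) * L := by
        field_simp; norm_num
      have h2 : c / 2 * (128 * (2 * r + 3) / c ^ 3 * (n : ℝ) ^ 2 * L) * (c / (4 * n)) ^ 2 / 4
          ≤ c / 2 * l * (c / (4 * n)) ^ 2 / 4 := by gcongr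
      push_cast
      linarith
    have hε0 : 0 < ε := Real.exp_pos _
    have hεm : ∀ k ≤ 2 * r + 3, ε * (n : ℝ) ^ k ≤ 1 := by
      intro k hk
      refine le_trans ?_ hεn
      gcongr
      linarith
    have hb1 : T1 * ε ≤ 1 / 16 := by
      have h1 : (T1 : ℝ) ≤ (D + 1) * (n : ℝ) ^ (2 * r) := by
        have h2 : 2 / (l * z) ≤ 2 / z := by
          apply div_le_div_of_nonneg_left (by norm_num) hz0
          nlinarith
        have h3 : (1 : ℝ) ≤ (n : ℝ) ^ (2 * r) := one_le_pow₀ (by linarith)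
        rw [h2z] at h2
        linarith
      have h4 := hεm (2 * r + 1) (by omega)
      have h5 : 16 * (D + 1) * (ε * (n : ℝ) ^ (2 * r)) ≤ ε * (n : ℝ) ^ (2 * r + 1) := by
        have := mul_le_mul_of_nonneg_right hn3 (by positivity : 0 ≤ ε * (n : ℝ) ^ (2 * r))
        refine this.trans (le_of_eq ?_)
        ring
      have h6 := mul_le_mul_of_nonneg_right h1 hε0.le
      linarith
    have hb2 : Real.exp (-(T1 * (l * z))) ≤ 1 / 4 := by
      have h1 : 2 ≤ (T1 : ℝ) * (l * z) := by
        rwa [div_le_iff₀ (by positivity)] at hT1l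
      have h2 : Real.exp (-(T1 * (l * z))) ≤ Real.exp (-2) := Real.exp_le_exp.2 (by linarith)
      refine h2.trans ?_
      have h3 : (4 : ℝ) ≤ Real.exp 2 := by
        have e : (2 : ℝ) = 1 + 1 := by norm_num
        rw [e, Real.exp_add]
        have := Real.add_one_le_exp (1 : ℝ)
        nlinarith
      rw [Real.exp_neg, one_div]
      exact inv_anti₀ (by norm_num) h3
    have hm' : ((n - r : ℕ) : ℝ) ≤ n := by exact_mod_cast Nat.sub_le n r
    have hb3 : (n : ℝ) * (((t1 + n : ℕ) : ℝ) * ε) ≤ 1 / 16 := by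
      have h1 : ((t1 + n : ℕ) : ℝ) ≤ B * (n * n) :=
        hτ.trans (by gcongr)
      have h2 : (n : ℝ) * (((t1 + n : ℕ) : ℝ) * ε) ≤ n * (B * (n * n) * ε) := by gcongr
      have h3 := mul_le_mul_of_nonneg_right hn2 (by positivity : 0 ≤ ε * (n : ℝ) ^ 3)
      have h4 := hεm 4 (by omega)
      nlinarith
    have hb4 : (n : ℝ) * Real.exp (1 - (l * ((1 - c) / (n : ℝ) ^ 2 * (1 / 2) * (c / 2)))
        * (c / (4 * n)) * n / 4) ≤ 1 / 16 := by
      have h1 : (192 / (c ^ 2 * (1 - c)) * (n : ℝ) ^ 2 * L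
          * ((1 - c) / (n : ℝ) ^ 2 * (1 / 2) * (c / 2))) * (c / (4 * n)) * n / 4 = 3 * L := by
        field_simp; norm_num
      have h2 : (192 / (c ^ 2 * (1 - c)) * (n : ℝ) ^ 2 * L
          * ((1 - c) / (n : ℝ) ^ 2 * (1 / 2) * (c / 2))) * (c / (4 * n)) * n / 4
          ≤ (l * ((1 - c) / (n : ℝ) ^ 2 * (1 / 2) * (c / 2))) * (c / (4 * n)) * n / 4 := by
        gcongr
      have h3 : Real.exp (1 - (l * ((1 - c) / (n : ℝ) ^ 2 * (1 / 2) * (c / 2)))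
        * (c / (4 * n)) * n / 4) ≤ Real.exp (1 - (L + L)) :=
        Real.exp_le_exp.2 (by linarith)
      have h4 : Real.exp (1 - (L + L)) = Real.exp 1 / (n * n) := by
        rw [Real.exp_sub, Real.exp_add, hexpL]
      rw [h4] at h3
      refine (mul_le_mul_of_nonneg_left h3 hn0.le).trans ?_
      have h5 : (n : ℝ) * (Real.exp 1 / (n * n)) = Real.exp 1 / n := by field_simp
      rw [h5, div_le_iff₀ hn0]
      linarith [Real.exp_one_lt_d9]
    have hb5 : ((n - r : ℕ) : ℝ) * (((t1 + n : ℕ) : ℝ) * ε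
          + Real.exp (1 - (l * ((1 - c) / (n : ℝ) ^ 2 * (1 / 2) * (c / 2))) * (c / (4 * n))
            * n / 4)) ≤ n * (((t1 + n : ℕ) : ℝ) * ε
          + Real.exp (1 - (l * ((1 - c) / (n : ℝ) ^ 2 * (1 / 2) * (c / 2))) * (c / (4 * n))
            * n / 4)) := mul_le_mul_of_nonneg_right hm' (by positivity)
    rw [mul_add (n : ℝ)] at hb5
    linarith
  have hE := expHitTime_le (PMF.uniformOfFintype (Popn n l)) (eaStep sel mutOp) (optSet n l)
    (T1 + (n - r) * (t1 + n)) hT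
  refine (mul_le_mul' le_rfl hE).trans ?_
  have e : (l : ℝ≥0∞) * (2 * ((T1 + (n - r) * (t1 + n) : ℕ) : ℝ≥0∞))
      = ENNReal.ofReal ((l : ℝ) * (2 * ((T1 + (n - r) * (t1 + n) : ℕ) : ℝ))) := by
    rw [ENNReal.ofReal_mul (by positivity), ENNReal.ofReal_mul (by norm_num),
      ENNReal.ofReal_natCast, ENNReal.ofReal_natCast]
    simp
  rw [e]
  apply ENNReal.ofReal_le_ofReal
  have hm' : ((n - r : ℕ) : ℝ) ≤ n := by exact_mod_cast Nat.sub_le n r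
  have hTu : ((T1 + (n - r) * (t1 + n) : ℕ) : ℝ) ≤ 2 / (l * z) + 1 + n * (B * (n * L)) := by
    rw [Nat.cast_add, Nat.cast_mul]
    refine add_le_add hT1u ?_
    exact mul_le_mul hm' hτ (Nat.cast_nonneg _) hn0.le
  have h1 : (l : ℝ) * (2 * ((T1 + (n - r) * (t1 + n) : ℕ) : ℝ))
      ≤ l * (2 * (2 / (l * z) + 1 + n * (B * (n * L)))) := by gcongr
  have h2 : (l : ℝ) * (2 / (l * z)) = D * (n : ℝ) ^ (2 * r) := by
    rw [← h2z]; field_simp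
  have h3 : (n : ℝ) ^ (2 * r) ≤ (n : ℝ) ^ (2 * r + 1) :=
    pow_le_pow_right₀ (by linarith) (by omega)
  have h4 : (l : ℝ) ≤ l * (n : ℝ) ^ 2 * L := by
    have : (1 : ℝ) ≤ (n : ℝ) ^ 2 * L := by nlinarith
    nlinarith
  have h5 : 0 < (n : ℝ) ^ (2 * r + 1) := by positivity
  have h6 : 0 < (l : ℝ) * (n : ℝ) ^ 2 * L := by positivity
  calc _ ≤ _ := h1
    _ = 2 * (l * (2 / (l * z))) + 2 * l + 2 * B * (l * (n : ℝ) ^ 2 * L) := by ring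
    _ = 2 * D * (n : ℝ) ^ (2 * r) + 2 * l + 2 * B * (l * (n : ℝ) ^ 2 * L) := by rw [h2]; ring
    _ ≤ 2 * D * (n : ℝ) ^ (2 * r + 1) + 2 * (l * (n : ℝ) ^ 2 * L)
        + 2 * B * (l * (n : ℝ) ^ 2 * L) := by gcongr
    _ ≤ _ := by
        have a1 : 0 < D * (l * (n : ℝ) ^ 2 * L) := by positivity
        have a2 : 0 < B * (n : ℝ) ^ (2 * r + 1) := by positivity
        linarith
end

section
/- Let f be a fitness function taking values in the positive integers, let P ∈ X^λ be a population, let γ ∈ (0,1], and let f_γ denote the ⌈γλ⌉-th largest value among f(P(1)), …, f(P(λ)). Then for fitness-proportionate selection, the cumulative selection probability satisfies β(γ,P) ≥ γ / (1 − (1−γ)/f_γ). -/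
open scoped ENNReal

open Classical in
/-- For fitness-proportionate selection with a
positive-integer-valued fitness `f`, the cumulative selection probability
satisfies `β(γ,P) ≥ γ/(1 − (1−γ)/f_γ)`, where `f_γ` is the `⌈γλ⌉`-th largest
fitness value in the population (characterised by `h1` and `h2`). -/
theorem propSel_cumulative_selection_prob
    (n l : ℕ) (f : BitStr n → ℝ) (hf : ∀ x : BitStr n, ∃ m : ℕ, 0 < m ∧ f x = m)
    (sel : Popn n l → PMF (Fin l)) (hsel : IsPropSel f sel)
    (P : Popn n l) (γ : ℝ) (hγ0 : 0 < γ) (hγ1 : γ ≤ 1) (fγ : ℝ)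
    (h1 : ⌈γ * l⌉₊ ≤ (Finset.univ.filter fun i : Fin l => fγ ≤ f (P i)).card)
    (h2 : (Finset.univ.filter fun i : Fin l => fγ < f (P i)).card < ⌈γ * l⌉₊) :
    ENNReal.ofReal (γ / (1 - (1 - γ) / fγ)) ≤
      ∑ i ∈ Finset.univ.filter (fun i : Fin l => fγ ≤ f (P i)), sel P i := by
  set S := Finset.univ.filter (fun i : Fin l => fγ ≤ f (P i)) with hS
  have hpos : ∀ x, 0 < f x := fun x => by
    obtain ⟨m, hm, e⟩ := hf x
    rw [e]; exact_mod_cast hm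
  -- the value `fγ` is attained
  obtain ⟨i₀, hi₀⟩ : ∃ i, f (P i) = fγ := by
    by_contra! hne
    have : S = Finset.univ.filter (fun i : Fin l => fγ < f (P i)) := by
      ext i
      simp only [hS, Finset.mem_filter, Finset.mem_univ, true_and]
      exact ⟨fun h => lt_of_le_of_ne h (hne i).symm, le_of_lt⟩
    rw [← this] at h2
    omega
  obtain ⟨m, hm, em⟩ := hf (P i₀)
  have hfm : fγ = m := by rw [← hi₀, em]
  have hf1 : 1 ≤ fγ := by rw [hfm]; exact_mod_cast hm
  have hf0 : 0 < fγ := by linarith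
  have hT : 0 < ∑ j, f (P j) :=
    Finset.sum_pos (fun j _ => hpos _) ⟨i₀, Finset.mem_univ _⟩
  have hsum : ∑ i ∈ S, sel P i = ENNReal.ofReal ((∑ i ∈ S, f (P i)) / ∑ j, f (P j)) := by
    rw [Finset.sum_div, ENNReal.ofReal_sum_of_nonneg
      (fun i _ => div_nonneg (hpos _).le hT.le)]
    exact Finset.sum_congr rfl fun i _ => (hsel P i).2 hT.ne'
  rw [hsum]
  apply ENNReal.ofReal_le_ofReal
  have hsplit : ∑ i ∈ S, f (P i) + ∑ i ∈ Sᶜ, f (P i) = ∑ j, f (P j) :=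
    Finset.sum_add_sum_compl S _
  have hA : (S.card : ℝ) * fγ ≤ ∑ i ∈ S, f (P i) := by
    have := Finset.card_nsmul_le_sum S (fun i => f (P i)) fγ
      (fun i hi => (Finset.mem_filter.mp hi).2)
    simpa using this
  have hB : ∑ i ∈ Sᶜ, f (P i) ≤ (Sᶜ.card : ℝ) * (fγ - 1) := by
    have := Finset.sum_le_card_nsmul Sᶜ (fun i => f (P i)) (fγ - 1)
      (fun i hi => by
        have hlt : f (P i) < fγ := by
          simpa [hS] using hi
        obtain ⟨q, _, eq⟩ := hf (P i)
        rw [eq, hfm] at hlt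
        rw [eq, hfm]
        have h3 : q + 1 ≤ m := by exact_mod_cast hlt
        have h4 : (q : ℝ) + 1 ≤ m := by exact_mod_cast h3
        linarith)
    simpa only [nsmul_eq_mul] using this
  have hk : γ * l ≤ (S.card : ℝ) := Nat.ceil_le.mp h1
  have hc : (S.card : ℝ) + (Sᶜ.card : ℝ) = l := by
    have := Finset.card_add_card_compl S
    rw [Fintype.card_fin] at this
    exact_mod_cast this
  rw [← hsplit] at hT ⊢
  generalize (∑ i ∈ S, f (P i)) = A at *
  generalize (∑ i ∈ Sᶜ, f (P i)) = B at *
  have hA' : γ * l * fγ ≤ A := le_trans (mul_le_mul_of_nonneg_right hk hf0.le) hA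
  have hB' : B ≤ (l * (1 - γ)) * (fγ - 1) :=
    le_trans hB (mul_le_mul_of_nonneg_right (by linarith) (by linarith))
  have hD : 0 < fγ - 1 + γ := by linarith
  have e : γ / (1 - (1 - γ) / fγ) = γ * fγ / (fγ - 1 + γ) := by
    have : 1 - (1 - γ) / fγ = (fγ - 1 + γ) / fγ := by field_simp; ring
    rw [this, div_div_eq_mul_div]
  rw [e, div_le_div_iff₀ hD hT]
  have u := mul_le_mul_of_nonneg_left hB' (mul_pos hγ0 hf0).le
  have v := mul_le_mul_of_nonneg_right hA'
    (mul_nonneg (by linarith : 0 ≤ fγ - 1) (by linarith : 0 ≤ 1 - γ))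
  nlinarith [u, v]
end

section
/- Let f : X → ℝ be a fitness function and A_1, …, A_m an f-based partition of X = {0,1}^n, i.e., a partition such that f(x) < f(y) whenever x ∈ A_i, y ∈ A_j and i < j. Suppose the mutation operator satisfies Pr( mutate(x) ∈ A_{j+1} ∪ … ∪ A_m ) ≥ s_* for every j ∈ [m−1] and every x ∈ A_j, for some s_* > 0. If the non-elitist EA uses either k-tournament selection with k ≥ (1 + ln m)·e / s_* and population size λ ≥ k, or (μ,λ)-selection with λ/μ ≥ (1 + ln m) / s_*, then, for any initial population, the expected number of generations until some individual of A_m appears in the population is at most e·m. -/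
open scoped ENNReal

theorem hp_drift {n l : ℕ} (P₀ : Popn n l) (step : Popn n l → PMF (Popn n l))
    (G : Set (Popn n l)) (V : Popn n l → ℝ≥0∞)
    (h : ∀ P, P ∉ G → 1 + ∑ Q, step P Q * V Q ≤ V P) :
    expHitTime (PMF.pure P₀) step G ≤ V P₀ := by
  classical
  have key : ∀ T : ℕ, ∑ t ∈ Finset.range T, survProb (PMF.pure P₀) step G t
      + ∑ P, notYet (PMF.pure P₀) step G T P * V P ≤ V P₀ := by
    intro T
    induction T with
    | zero =>
      simp only [Finset.range_zero, Finset.sum_empty, zero_add]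
      calc ∑ P, notYet (PMF.pure P₀) step G 0 P * V P
          ≤ ∑ P, (if P = P₀ then V P₀ else 0) := by
            apply Finset.sum_le_sum
            intro P _
            simp only [notYet, Set.indicator_apply, PMF.pure_apply]
            split_ifs <;> simp_all
        _ = V P₀ := by simp
    | succ T ih =>
      refine le_trans ?_ ih
      rw [Finset.sum_range_succ, add_assoc]
      gcongr
      have hz : ∀ P, P ∈ G → notYet (PMF.pure P₀) step G T P = 0 := by
        intro P hP
        cases T <;> simp [notYet, hP]
      calc survProb (PMF.pure P₀) step G T
            + ∑ P, notYet (PMF.pure P₀) step G (T + 1) P * V P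
          ≤ ∑ P, notYet (PMF.pure P₀) step G T P
            + ∑ P, (∑ Q, notYet (PMF.pure P₀) step G T Q * step Q P) * V P := by
            unfold survProb
            gcongr with P
            simp only [notYet]
            exact Set.indicator_le_self _ _ _
        _ = ∑ Q, notYet (PMF.pure P₀) step G T Q * (1 + ∑ P, step Q P * V P) := by
            simp only [Finset.sum_mul, mul_add, mul_one, Finset.sum_add_distrib, Finset.mul_sum]
            rw [Finset.sum_comm]
            simp only [mul_assoc]
        _ ≤ _ := by
            apply Finset.sum_le_sum
            intro Q _
            by_cases hQ : Q ∈ G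
            · simp [hz Q hQ]
            · gcongr
              exact h Q hQ
  unfold expHitTime
  rw [ENNReal.tsum_eq_iSup_nat]
  exact iSup_le fun T => le_trans le_self_add (key T)

theorem hp_prod {n l : ℕ} (p : PMF (BitStr n)) (q : BitStr n → Prop) [DecidablePred q] :
    ∑ Q : Popn n l, (if ∀ i, q (Q i) then prodPMF (fun _ : Fin l => p) Q else 0)
      = (∑ y, if q y then p y else 0) ^ l := by
  classical
  have : (∑ y, if q y then p y else 0) ^ l = ∏ _i : Fin l, ∑ y, if q y then p y else 0 := by
    simp
  rw [this, Finset.prod_univ_sum, Fintype.piFinset_univ]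
  apply Finset.sum_congr rfl
  intro Q _
  simp only [prodPMF, PMF.ofFintype_apply]
  split_ifs with h
  · exact Finset.prod_congr rfl fun i _ => by simp [h i]
  · push Not at h
    obtain ⟨i, hi⟩ := h
    exact (Finset.prod_eq_zero (Finset.mem_univ i) (by simp [hi])).symm

theorem hp_real (k l : ℕ) (hl : 0 < l) (hkl : k ≤ l) :
    (k : ℝ) / (Real.exp 1 * l) ≤ 1 - (1 - 1 / (l : ℝ)) ^ k := by
  have hl' : (0 : ℝ) < l := by exact_mod_cast hl
  have hl1 : (1 : ℝ) ≤ l := by exact_mod_cast hl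
  set u : ℝ := k / l with hu
  have hu0 : 0 ≤ u := by positivity
  have hu1 : u ≤ 1 := by
    rw [hu, div_le_one hl']; exact_mod_cast hkl
  have h1 : (1 - 1 / (l : ℝ)) ^ k ≤ Real.exp (-u) := by
    have : 1 - 1 / (l : ℝ) ≤ Real.exp (-(1 / (l : ℝ))) := Real.one_sub_le_exp_neg _
    have h0 : 0 ≤ 1 - 1 / (l : ℝ) := by
      rw [sub_nonneg, div_le_one hl']; exact hl1
    calc _ ≤ Real.exp (-(1 / (l : ℝ))) ^ k := pow_le_pow_left₀ h0 this k
      _ = Real.exp (-u) := by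
        rw [← Real.exp_nat_mul]; congr 1; rw [hu]; ring
  have h2 : Real.exp (-u) ≤ 1 - u / 2 := by
    rw [Real.exp_neg]
    have h3 : 1 + u ≤ Real.exp u := by linarith [Real.add_one_le_exp u]
    calc (Real.exp u)⁻¹ ≤ (1 + u)⁻¹ := inv_anti₀ (by linarith) h3
      _ ≤ 1 - u / 2 := by
        rw [inv_le_iff_one_le_mul₀ (by linarith)]
        nlinarith
  have h4 : (2 : ℝ) ≤ Real.exp 1 := by linarith [Real.add_one_le_exp (1 : ℝ)]
  have h5 : (k : ℝ) / (Real.exp 1 * l) ≤ u / 2 := by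
    rw [hu, div_div, mul_comm]
    gcongr
  linarith

theorem hp_tour {n l : ℕ} (f : BitStr n → ℝ) (k : ℕ) (hl : 0 < l) (hkl : k ≤ l)
    (sel : Popn n l → PMF (Fin l)) (h : IsTournamentSel f k sel) (P : Popn n l)
    (i₀ : Fin l) (T : Finset (Fin l)) (hT : ∀ i, f (P i₀) ≤ f (P i) → i ∈ T) :
    ENNReal.ofReal ((k : ℝ) / (Real.exp 1 * l)) ≤ ∑ i ∈ T, sel P i := by
  classical
  obtain ⟨pick, hp1, hp2, hp3⟩ := h P
  have hl' : (0 : ℝ) < l := by exact_mod_cast hl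
  have hcard : (Finset.univ.filter fun d : Fin k → Fin l => ¬ ∃ j, d j = i₀).card
      = (l - 1) ^ k := by
    have : (Finset.univ.filter fun d : Fin k → Fin l => ¬ ∃ j, d j = i₀)
        = Fintype.piFinset fun _ : Fin k => ({i₀}ᶜ : Finset (Fin l)) := by
      ext d; simp
    rw [this, Fintype.card_piFinset]
    simp [Finset.card_compl]
  have hcard2 : ((Finset.univ.filter fun d : Fin k → Fin l => ∃ j, d j = i₀).card : ℝ)
      = (l : ℝ) ^ k - ((l : ℝ) - 1) ^ k := by
    have h1 := Finset.card_filter_add_card_filter_not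
      (s := (Finset.univ : Finset (Fin k → Fin l))) (fun d => ∃ j, d j = i₀)
    rw [hcard] at h1
    have h2 : (Finset.univ : Finset (Fin k → Fin l)).card = l ^ k := by simp
    rw [h2] at h1
    have h3 : ((l - 1 : ℕ) : ℝ) = (l : ℝ) - 1 := by
      rw [Nat.cast_sub hl]; simp
    have h4 := congrArg (Nat.cast (R := ℝ)) h1
    push_cast [h3] at h4
    linarith
  have hsum : ((Finset.univ.filter fun d : Fin k → Fin l => ∃ j, d j = i₀).card : ℝ≥0∞)
      ≤ ∑ d, ∑ i ∈ T, pick d i := by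
    rw [Finset.card_filter, Nat.cast_sum]
    apply Finset.sum_le_sum
    intro d _
    split_ifs with hd
    · obtain ⟨j, hj⟩ := hd
      rw [Nat.cast_one, ← hp1 d]
      apply le_of_eq
      symm
      apply Finset.sum_subset (Finset.subset_univ _)
      intro i _ hi
      by_contra hne
      have := (hp2 d i hne).2 j
      rw [hj] at this
      exact hi (hT i this)
    · simp
  have e1 : ∑ i ∈ T, sel P i = (∑ d, ∑ i ∈ T, pick d i) / (l : ℝ≥0∞) ^ k := by
    rw [Finset.sum_comm]
    simp only [hp3, div_eq_mul_inv, Finset.sum_mul]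
  rw [e1]
  refine le_trans ?_ (ENNReal.div_le_div_right hsum _)
  have e2 : ((Finset.univ.filter fun d : Fin k → Fin l => ∃ j, d j = i₀).card : ℝ≥0∞)
      / (l : ℝ≥0∞) ^ k = ENNReal.ofReal (((l : ℝ) ^ k - ((l : ℝ) - 1) ^ k) / (l : ℝ) ^ k) := by
    rw [ENNReal.ofReal_div_of_pos (by positivity), ← hcard2, ENNReal.ofReal_natCast,
      ENNReal.ofReal_pow hl'.le, ENNReal.ofReal_natCast]
  rw [e2]
  apply ENNReal.ofReal_le_ofReal
  refine (hp_real k l hl hkl).trans (le_of_eq ?_)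
  have : 1 - 1 / (l : ℝ) = ((l : ℝ) - 1) / l := by field_simp
  rw [this, div_pow]
  field_simp

theorem hp_mu {n l : ℕ} (f : BitStr n → ℝ) (μ : ℕ) (hμ : 0 < μ)
    (sel : Popn n l → PMF (Fin l)) (h : IsMuCommaSel f μ sel) (P : Popn n l)
    (i₀ : Fin l) (T : Finset (Fin l)) (hT : ∀ i, f (P i₀) ≤ f (P i) → i ∈ T) :
    (μ : ℝ≥0∞)⁻¹ ≤ ∑ i ∈ T, sel P i := by
  obtain ⟨S, hS, hS2, hS3⟩ := h P
  have : ∃ i ∈ S, i ∈ T := by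
    by_cases h0 : i₀ ∈ S
    · exact ⟨i₀, h0, hT _ le_rfl⟩
    · obtain ⟨i, hi⟩ := Finset.card_pos.1 (hS ▸ hμ)
      exact ⟨i, hi, hT _ (hS2 i hi i₀ h0)⟩
  obtain ⟨i, hi, hiT⟩ := this
  calc (μ : ℝ≥0∞)⁻¹ = sel P i := by rw [hS3]; simp [hi]
    _ ≤ _ := Finset.single_le_sum (f := fun i => sel P i) (fun _ _ => bot_le) hiT

theorem hp_sel {n l m : ℕ} (hm : 0 < m) (f : BitStr n → ℝ) (s : ℝ) (hs : 0 < s)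
    (sel : Popn n l → PMF (Fin l))
    (hsel : (∃ k : ℕ, (1 + Real.log m) * Real.exp 1 / s ≤ (k : ℝ) ∧ k ≤ l ∧
               IsTournamentSel f k sel) ∨
            (∃ μ : ℕ, 0 < μ ∧ (1 + Real.log m) / s ≤ (l : ℝ) / (μ : ℝ) ∧
               IsMuCommaSel f μ sel)) (P : Popn n l)
    (i₀ : Fin l) (T : Finset (Fin l)) (hT : ∀ i, f (P i₀) ≤ f (P i) → i ∈ T) :
    ENNReal.ofReal ((1 + Real.log m) / l) ≤ (∑ i ∈ T, sel P i) * ENNReal.ofReal s := by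
  have hl : 0 < l := i₀.pos
  have hl' : (0 : ℝ) < l := by exact_mod_cast hl
  rcases hsel with ⟨k, hk, hkl, h⟩ | ⟨μ, hμ, hk, h⟩
  · refine le_trans ?_ (mul_le_mul_left (hp_tour f k hl hkl sel h P i₀ T hT) _)
    rw [← ENNReal.ofReal_mul (by positivity)]
    apply ENNReal.ofReal_le_ofReal
    rw [div_le_iff₀ hs] at hk
    have he := Real.exp_pos 1
    rw [div_le_iff₀ hl']
    have : (k : ℝ) / (Real.exp 1 * l) * s * l = k * s / Real.exp 1 := by field_simp
    rw [this, le_div_iff₀ he]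
    exact hk
  · refine le_trans ?_ (mul_le_mul_left (hp_mu f μ hμ sel h P i₀ T hT) _)
    have hμ' : (0 : ℝ) < μ := by exact_mod_cast hμ
    rw [← ENNReal.ofReal_natCast μ, ← ENNReal.ofReal_inv_of_pos hμ',
      ← ENNReal.ofReal_mul (by positivity)]
    apply ENNReal.ofReal_le_ofReal
    rw [div_le_div_iff₀ hs hμ'] at hk
    rw [div_le_iff₀ hl']
    have : (μ : ℝ)⁻¹ * s * l = l * s / μ := by field_simp
    rw [this, le_div_iff₀ hμ']
    exact hk

theorem hp_fail {n l m : ℕ} (hm : 0 < m) (hl : 0 < l)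
    (p : PMF (BitStr n)) (q : BitStr n → Prop) [DecidablePred q]
    (hp : ENNReal.ofReal ((1 + Real.log m) / l) ≤ ∑ y, if q y then 0 else p y) :
    (∑ y, if q y then p y else 0) ^ l ≤ ENNReal.ofReal (1 / (Real.exp 1 * m)) := by
  have hl' : (0 : ℝ) < l := by exact_mod_cast hl
  have hm' : (0 : ℝ) < m := by exact_mod_cast hm
  have hlog : 0 ≤ Real.log m := Real.log_natCast_nonneg m
  have hsum : (∑ y, if q y then p y else 0) + (∑ y, if q y then 0 else p y) = 1 := by
    rw [← Finset.sum_add_distrib, ← p.tsum_coe, tsum_fintype]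
    apply Finset.sum_congr rfl
    intro y _
    split_ifs <;> simp
  set a := (1 + Real.log m) / l with ha
  have ha0 : 0 ≤ a := by positivity
  have h1 : (∑ y, if q y then p y else 0) ≤ ENNReal.ofReal (Real.exp (-a)) := by
    calc (∑ y, if q y then p y else 0) ≤ 1 - ENNReal.ofReal a := by
          apply ENNReal.le_sub_of_add_le_right ENNReal.ofReal_ne_top
          rw [← hsum]
          gcongr
      _ = ENNReal.ofReal (1 - a) := by rw [ENNReal.ofReal_sub _ ha0, ENNReal.ofReal_one]
      _ ≤ _ := ENNReal.ofReal_le_ofReal (Real.one_sub_le_exp_neg a)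
  refine (pow_le_pow_left' h1 l).trans (le_of_eq ?_)
  rw [← ENNReal.ofReal_pow (Real.exp_pos _).le, ← Real.exp_nat_mul]
  congr 1
  have : (l : ℝ) * -a = -(1 + Real.log m) := by rw [ha]; field_simp
  rw [this, Real.exp_neg, Real.exp_add, Real.exp_log hm', one_div]

theorem hp_core (n l m : ℕ) (hm : 0 < m) (hl : 0 < l) (f : BitStr n → ℝ) (lev : BitStr n → ℕ)
    (hlev : ∀ x, lev x < m)
    (hbased : ∀ x y, lev x < lev y → f x < f y)
    (s : ℝ) (hs : 0 < s)
    (sel : Popn n l → PMF (Fin l)) (mutOp : BitStr n → PMF (BitStr n))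
    (hmut : ∀ x, lev x + 1 < m →
      ENNReal.ofReal s ≤ ∑ y, if lev y ≤ lev x then 0 else mutOp x y)
    (hsel : (∃ k : ℕ, (1 + Real.log m) * Real.exp 1 / s ≤ (k : ℝ) ∧ k ≤ l ∧
               IsTournamentSel f k sel) ∨
            (∃ μ : ℕ, 0 < μ ∧ (1 + Real.log m) / s ≤ (l : ℝ) / (μ : ℝ) ∧
               IsMuCommaSel f μ sel))
    (P₀ : Popn n l) :
    expHitTime (PMF.pure P₀) (eaStep sel mutOp) {P : Popn n l | ∃ i : Fin l, lev (P i) = m - 1}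
      ≤ ENNReal.ofReal (Real.exp 1 * m) := by
  classical
  have hm' : (0 : ℝ) < m := by exact_mod_cast hm
  have he := Real.exp_pos 1
  have he2 : (2 : ℝ) ≤ Real.exp 1 := by linarith [Real.add_one_le_exp (1 : ℝ)]
  set L : Popn n l → ℕ := fun P => Finset.univ.sup fun i => lev (P i) with hL
  have hLle : ∀ P i, lev (P i) ≤ L P := fun P i =>
    Finset.le_sup (f := fun i => lev (P i)) (Finset.mem_univ i)
  have hLex : ∀ P, ∃ i, lev (P i) = L P := by
    intro P
    have : (Finset.univ : Finset (Fin l)).Nonempty := ⟨⟨0, hl⟩, Finset.mem_univ _⟩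
    obtain ⟨i, _, hi⟩ := Finset.exists_mem_eq_sup Finset.univ this fun i => lev (P i)
    exact ⟨i, hi.symm⟩
  have hLm : ∀ P, L P < m := fun P => by
    obtain ⟨i, hi⟩ := hLex P
    rw [← hi]; exact hlev _
  have main := hp_drift P₀ (eaStep sel mutOp) {P : Popn n l | ∃ i : Fin l, lev (P i) = m - 1}
    (fun P => ENNReal.ofReal (Real.exp 1 * ((m : ℝ) - 1 - L P))) ?_
  · refine main.trans (ENNReal.ofReal_le_ofReal ?_)
    have : (0 : ℝ) ≤ L P₀ := Nat.cast_nonneg _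
    gcongr
    linarith
  intro P hP
  obtain ⟨i₀, hi₀⟩ := hLex P
  set j := L P with hj
  have hjm : j + 1 < m := by
    have h1 := hLm P
    have h2 : j ≠ m - 1 := fun h => hP ⟨i₀, hi₀.trans h⟩
    omega
  have hjm' : (j : ℝ) + 2 ≤ m := by exact_mod_cast hjm
  -- upgrade probability of a single child
  set c : PMF (BitStr n) := (sel P).bind fun i => mutOp (P i) with hc
  have hup : ENNReal.ofReal ((1 + Real.log m) / l) ≤ ∑ y, if lev y ≤ j then 0 else c y := by
    have h1 := hp_sel hm f s hs sel hsel P i₀ (Finset.univ.filter fun i => lev (P i) = j) (by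
      intro i hi
      simp only [Finset.mem_filter, Finset.mem_univ, true_and]
      refine le_antisymm (hLle P i) ?_
      by_contra hlt
      push Not at hlt
      rw [← hi₀] at hlt
      exact absurd (hbased _ _ hlt) (not_lt.2 hi))
    refine h1.trans ?_
    calc (∑ i ∈ Finset.univ.filter (fun i => lev (P i) = j), sel P i) * ENNReal.ofReal s
        = ∑ i ∈ Finset.univ.filter (fun i => lev (P i) = j), sel P i * ENNReal.ofReal s :=
          Finset.sum_mul _ _ _
      _ ≤ ∑ i ∈ Finset.univ.filter (fun i => lev (P i) = j),
            sel P i * ∑ y, (if lev y ≤ j then 0 else mutOp (P i) y) := by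
          apply Finset.sum_le_sum
          intro i hi
          simp only [Finset.mem_filter, Finset.mem_univ, true_and] at hi
          gcongr
          have := hmut (P i) (by rw [hi]; exact hjm)
          rwa [hi] at this
      _ ≤ ∑ i, sel P i * ∑ y, (if lev y ≤ j then 0 else mutOp (P i) y) :=
          Finset.sum_le_sum_of_subset (Finset.subset_univ _)
      _ = ∑ y, if lev y ≤ j then 0 else c y := by
          simp only [Finset.mul_sum]
          rw [Finset.sum_comm]
          apply Finset.sum_congr rfl
          intro y _
          split_ifs
          · simp
          · rw [hc, PMF.bind_apply, tsum_fintype]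
  have hfail := hp_fail hm hl c (fun y => lev y ≤ j) hup
  rw [← hp_prod] at hfail
  have hstep : eaStep sel mutOp P = prodPMF fun _ : Fin l => c := rfl
  rw [hstep]
  set D := prodPMF fun _ : Fin l => c with hD
  have hD1 : ∑ Q, D Q = 1 := by
    rw [← tsum_fintype (L := SummationFilter.unconditional _)]; exact D.tsum_coe
  calc 1 + ∑ Q, D Q * ENNReal.ofReal (Real.exp 1 * ((m : ℝ) - 1 - L Q))
      ≤ 1 + ∑ Q, (D Q * ENNReal.ofReal (Real.exp 1 * ((m : ℝ) - 2 - j))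
          + (if ∀ i, lev (Q i) ≤ j then D Q else 0)
            * ENNReal.ofReal (Real.exp 1 * ((j : ℝ) + 1))) := by
        gcongr with Q
        split_ifs with h
        · rw [← mul_add, ← ENNReal.ofReal_add (mul_nonneg he.le (by linarith)) (by positivity)]
          gcongr
          have : (0 : ℝ) ≤ L Q := Nat.cast_nonneg _
          nlinarith
        · rw [zero_mul, add_zero]
          push Not at h
          obtain ⟨i, hi⟩ := h
          have h2 : j + 1 ≤ L Q := hi.trans_le (hLle Q i)
          have h3 : (j : ℝ) + 1 ≤ L Q := by exact_mod_cast h2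
          refine mul_le_mul_right (ENNReal.ofReal_le_ofReal ?_) _
          nlinarith
    _ = 1 + (ENNReal.ofReal (Real.exp 1 * ((m : ℝ) - 2 - j))
          + (∑ Q : Popn n l, if ∀ i, lev (Q i) ≤ j then D Q else 0)
            * ENNReal.ofReal (Real.exp 1 * ((j : ℝ) + 1))) := by
        rw [Finset.sum_add_distrib, ← Finset.sum_mul, ← Finset.sum_mul, hD1, one_mul]
    _ ≤ 1 + (ENNReal.ofReal (Real.exp 1 * ((m : ℝ) - 2 - j))
          + ENNReal.ofReal (1 / (Real.exp 1 * m))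
            * ENNReal.ofReal (Real.exp 1 * ((j : ℝ) + 1))) := by
        gcongr
    _ ≤ ENNReal.ofReal (Real.exp 1 * ((m : ℝ) - 1 - j)) := by
        have hnn : 0 ≤ Real.exp 1 * ((m : ℝ) - 2 - j) := mul_nonneg he.le (by linarith)
        rw [← ENNReal.ofReal_mul (by positivity), ← ENNReal.ofReal_add hnn (by positivity),
          ← ENNReal.ofReal_one, ← ENNReal.ofReal_add zero_le_one (by positivity)]
        apply ENNReal.ofReal_le_ofReal
        have h1 : 1 / (Real.exp 1 * m) * (Real.exp 1 * ((j : ℝ) + 1)) = ((j : ℝ) + 1) / m := by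
          field_simp
        have h2 : ((j : ℝ) + 1) / m ≤ 1 := by
          rw [div_le_one hm']; linarith
        rw [h1]
        nlinarith

/-- Level-based theorem under very high selection pressure:
given an `f`-based partition `A_1,…,A_m` of the search space and a mutation
operator upgrading each non-top level with probability at least `s_*`, the EA
with `k`-tournament selection (`k ≥ (1+ln m)e/s_*`, `λ ≥ k`) or
`(μ,λ)`-selection (`λ/μ ≥ (1+ln m)/s_*`) finds an element of `A_m` after at
most `e·m` generations in expectation, from any initial population. -/
theorem levelBased_highPressure
    (n l m : ℕ) (hm : 0 < m) (f : BitStr n → ℝ) (A : Fin m → Finset (BitStr n))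
    (hpart : ∀ x : BitStr n, ∃! j : Fin m, x ∈ A j)
    (hbased : ∀ i j : Fin m, i < j → ∀ x ∈ A i, ∀ y ∈ A j, f x < f y)
    (s : ℝ) (hs : 0 < s)
    (sel : Popn n l → PMF (Fin l)) (mutOp : BitStr n → PMF (BitStr n))
    (hmut : ∀ j : Fin m, (j : ℕ) + 1 < m → ∀ x ∈ A j,
      ENNReal.ofReal s ≤
        ∑ y ∈ Finset.univ.filter (fun y : BitStr n => ∃ i : Fin m, j < i ∧ y ∈ A i),
          mutOp x y)
    (hsel : (∃ k : ℕ, (1 + Real.log m) * Real.exp 1 / s ≤ (k : ℝ) ∧ k ≤ l ∧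
               IsTournamentSel f k sel) ∨
            (∃ μ : ℕ, 0 < μ ∧ (1 + Real.log m) / s ≤ (l : ℝ) / (μ : ℝ) ∧
               IsMuCommaSel f μ sel))
    (P₀ : Popn n l) :
    expHitTime (PMF.pure P₀) (eaStep sel mutOp)
        {P : Popn n l | ∃ i : Fin l, P i ∈ A ⟨m - 1, by omega⟩}
      ≤ ENNReal.ofReal (Real.exp 1 * m) := by
  classical
  have hl : 0 < l := by
    have hlog : 0 ≤ Real.log m := Real.log_natCast_nonneg m
    rcases Nat.eq_zero_or_pos l with h0 | h0
    · exfalso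
      subst h0
      exact (sel P₀).support_nonempty.elim fun i _ => i.elim0
    · exact h0
  choose lev hlev hlevu using fun x => (hpart x)
  have hmem : ∀ x j, x ∈ A j ↔ lev x = j :=
    fun x j => ⟨fun h => (hlevu x j h).symm, fun h => h ▸ hlev x⟩
  have hG : {P : Popn n l | ∃ i : Fin l, P i ∈ A ⟨m - 1, by omega⟩}
      = {P : Popn n l | ∃ i : Fin l, (lev (P i) : ℕ) = m - 1} := by
    ext P
    simp [hmem, Fin.ext_iff]
  rw [hG]
  refine hp_core n l m hm hl f (fun x => (lev x : ℕ)) (fun x => (lev x).2) ?_ s hs sel mutOp ?_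
    hsel P₀
  · intro x y h
    exact hbased _ _ h x (hlev x) y (hlev y)
  · intro x hx
    refine (hmut (lev x) hx x (hlev x)).trans (le_of_eq ?_)
    rw [Finset.sum_filter]
    apply Finset.sum_congr rfl
    intro y _
    have : (∃ i : Fin m, lev x < i ∧ y ∈ A i) ↔ ¬ ((lev y : ℕ) ≤ lev x) := by
      rw [not_le, Fin.val_fin_lt]
      constructor
      · rintro ⟨i, hi, hy⟩
        rwa [(hmem y i).1 hy]
      · intro h
        exact ⟨_, h, hlev y⟩
    by_cases h : (lev y : ℕ) ≤ lev x
    · rw [if_pos h, if_neg (by rw [this]; exact not_not.2 h)]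
    · rw [if_neg h, if_pos (this.2 h)]
end
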